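/- Let λ, μ ∈ ℝ with μ > 0 and 3λ + 2μ > 0, let r₀, E₀ > 0, D₀ > 1, 0 < s₀ < D₀, and p > 0. Let C₁ and C₂ be Lipschitz cavities with parameters r₀, E₀, D₀, and for i = 1, 2 let wᵢ be a normalized solution of the cavity problem in Ωᵢ = ℝ³₋ \ C̄ᵢ. If w₁(x₁, x₂, 0) = w₂(x₁, x₂, 0) for all (x₁, x₂) with x₁² + x₂² < s₀², then C₁ = C₂. -/

import Mathlib

open MeasureTheory Metric Set

noncomputable section

abbrev E3 := EuclideanSpace ℝ (Fin 3)
abbrev E2 := EuclideanSpace ℝ (Fin 2)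

/-- The open lower half-space `{x : x₃ < 0}`. -/
def lowerHalf : Set E3 := {x | x 2 < 0}

/-- The lower half-ball `B⁻_r(0) = {|x| < r, x₃ < 0}`. -/
def negBall (r : ℝ) : Set E3 := {x | ‖x‖ < r ∧ x 2 < 0}

/-- Jacobian matrix of a vector field: `(jac u x) i j = ∂uᵢ/∂xⱼ (x)`. -/
def jac (u : E3 → E3) (x : E3) : Matrix (Fin 3) (Fin 3) ℝ :=
  fun i j => fderiv ℝ u x (EuclideanSpace.single j 1) i

/-- Symmetric part of the Jacobian (strain tensor) `∇̂u`. -/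
def strain (u : E3 → E3) (x : E3) : Matrix (Fin 3) (Fin 3) ℝ :=
  fun i j => (jac u x i j + jac u x j i) / 2

/-- Squared Frobenius norm of a 3×3 matrix. -/
def frob2 (M : Matrix (Fin 3) (Fin 3) ℝ) : ℝ := ∑ i, ∑ j, (M i j)^2

/-- Divergence of a vector field. -/
def divg (u : E3 → E3) (x : E3) : ℝ := ∑ i, jac u x i i

/-- Projection on the first two coordinates. -/
def proj12 (x : E3) : E2 :=
  (x 0) • EuclideanSpace.single 0 1 + (x 1) • EuclideanSpace.single 1 1

/-- Embedding of the plane `{x₃ = 0}` into `ℝ³`: `x' ↦ (x'₁, x'₂, 0)`. -/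
def emb2 (x' : E2) : E3 :=
  (x' 0) • EuclideanSpace.single 0 1 + (x' 1) • EuclideanSpace.single 1 1

/-- Partial derivative of a scalar field in the k-th coordinate direction. -/
def pd (f : E3 → ℝ) (k : Fin 3) (x : E3) : ℝ := fderiv ℝ f x (EuclideanSpace.single k 1)

/-- `S` has boundary of Lipschitz class with constants r₀, E₀: at each boundary point `P`,
after a rigid change of coordinates sending `P` to `0`, the set is locally the open
epigraph of a Lipschitz function `ψ` with `ψ 0 = 0` and Lipschitz constant at most `E₀`. -/
def HasLipschitzBoundary (r₀ E₀ : ℝ) (S : Set E3) : Prop :=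
  ∀ P ∈ frontier S, ∃ (φ : E3 ≃ᵢ E3) (ψ : E2 → ℝ),
    φ P = 0 ∧ ψ 0 = 0 ∧ LipschitzOnWith (Real.toNNReal E₀) ψ (Metric.ball 0 r₀) ∧
    (φ '' S) ∩ Metric.ball 0 r₀ = {x ∈ Metric.ball (0 : E3) r₀ | ψ (proj12 x) < x 2}

/-- `S` has boundary of class C³ with constants r₀, E₀. -/
def HasC3Boundary (r₀ E₀ : ℝ) (S : Set E3) : Prop :=
  ∀ P ∈ frontier S, ∃ (φ : E3 ≃ᵢ E3) (ψ : E2 → ℝ),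
    φ P = 0 ∧ ψ 0 = 0 ∧ ContDiff ℝ 3 ψ ∧ fderiv ℝ ψ 0 = 0 ∧
    (∀ x' ∈ Metric.ball (0 : E2) r₀, ∀ k : ℕ, k ≤ 3 → ‖iteratedFDeriv ℝ k ψ x'‖ ≤ E₀) ∧
    (φ '' S) ∩ Metric.ball 0 r₀ = {x ∈ Metric.ball (0 : E3) r₀ | ψ (proj12 x) < x 2}

/-- Geometric a priori assumptions on a cavity: bounded open set, closure inside the lower
half-space, connected complement in the half-space, contained in `B⁻_{2D₀}(0)`, at distance
at least `D₀` from the plane `{x₃ = 0}`, with diameter less than `D₀`. -/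
def IsCavity (D₀ : ℝ) (C : Set E3) : Prop :=
  IsOpen C ∧ Bornology.IsBounded C ∧ closure C ⊆ lowerHalf ∧
  IsConnected (lowerHalf \ closure C) ∧ C ⊆ negBall (2*D₀) ∧
  (∀ x ∈ C, x 2 ≤ -D₀) ∧ Metric.diam C < D₀

/-- Lipschitz cavity with parameters r₀, E₀, D₀. -/
def IsLipschitzCavity (r₀ E₀ D₀ : ℝ) (C : Set E3) : Prop :=
  IsCavity D₀ C ∧ HasLipschitzBoundary r₀ E₀ C

/-- C³ cavity with parameters r₀, E₀, D₀. -/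
def IsC3Cavity (r₀ E₀ D₀ : ℝ) (C : Set E3) : Prop :=
  IsCavity D₀ C ∧ HasC3Boundary r₀ E₀ C

/-- Normalized solution `w = u − ū` of the cavity problem (with `ū(x) = (p/(3λ+2μ)) x`):
`w` is continuous up to the boundary plane, C¹ on `Ω = ℝ³₋ \ C̄`, `w + ū` lies in the
weighted class, and `w` satisfies the variational identity
`∫_Ω ℂ∇̂w : ∇̂v = −p ∫_{ℝ²} v₃(x₁,x₂,0) dx₁dx₂` for all smooth compactly supported `v`. -/
def IsNormalizedSolution (lam mu p : ℝ) (C : Set E3) (w : E3 → E3) : Prop :=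
  ContinuousOn w ({x : E3 | x 2 ≤ 0} \ closure C) ∧
  ContDiffOn ℝ 1 w (lowerHalf \ closure C) ∧
  IntegrableOn (fun x => ‖w x + (p / (3*lam+2*mu)) • x‖^2 / (1 + ‖x‖^2)) (lowerHalf \ closure C) ∧
  IntegrableOn
    (fun x => frob2 (fun i j => jac w x i j + (p/(3*lam+2*mu)) * (if i = j then 1 else 0)))
    (lowerHalf \ closure C) ∧
  ∀ v : E3 → E3, ContDiff ℝ (⊤ : ℕ∞) v → HasCompactSupport v →
    ∫ x in lowerHalf \ closure C,
        (lam * divg w x * divg v x + 2 * mu * ∑ i, ∑ j, strain w x i j * strain v x i j)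
      = -p * ∫ x' : E2, v (emb2 x') 2

section
open Filter Topology
open scoped ContDiff

lemma pd_contDiff {f : E3 → ℝ} (hf : ContDiff ℝ ∞ f) (k : Fin 3) : ContDiff ℝ ∞ (pd f k) := by
  unfold pd
  exact (hf.fderiv_right (m := ∞) (by simp)).clm_apply contDiff_const

lemma tsupport_pd (f : E3 → ℝ) (k : Fin 3) : tsupport (pd f k) ⊆ tsupport f := by
  refine closure_minimal (fun x hx => ?_) (isClosed_tsupport f)
  by_contra h
  apply hx
  have : fderiv ℝ f x = 0 := by
    have := (support_fderiv_subset ℝ (f := f))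
    by_contra h2
    exact h (this h2)
  simp [pd, this]

lemma hcs_pd {f : E3 → ℝ} (hf : HasCompactSupport f) (k : Fin 3) : HasCompactSupport (pd f k) :=
  hf.mono' (subset_tsupport _ |>.trans (tsupport_pd f k))

lemma ibp {f g : E3 → ℝ} (hf : ContDiff ℝ ∞ f) (hg : ContDiff ℝ ∞ g) (hc : HasCompactSupport g)
    (k : Fin 3) : ∫ x, f x * pd g k x = - ∫ x, pd f k x * g x := by
  unfold pd
  apply integral_mul_fderiv_eq_neg_fderiv_mul_of_integrable
  · exact ((pd_contDiff hf k).continuous.mul hg.continuous).integrable_of_hasCompactSupport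
      hc.mul_left
  · exact (hf.continuous.mul (pd_contDiff hg k).continuous).integrable_of_hasCompactSupport
      (hcs_pd hc k).mul_left
  · exact (hf.continuous.mul hg.continuous).integrable_of_hasCompactSupport
      hc.mul_left
  · intro x _; exact (hf.differentiable (by simp)) x
  · intro x _; exact (hg.differentiable (by simp)) x

/-- Laplacian. -/
def lap3 (f : E3 → ℝ) (x : E3) : ℝ := ∑ k, pd (pd f k) k x

lemma lap3_contDiff {f : E3 → ℝ} (hf : ContDiff ℝ ∞ f) : ContDiff ℝ ∞ (lap3 f) := by
  unfold lap3
  exact ContDiff.sum fun k _ => pd_contDiff (pd_contDiff hf k) k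

lemma tsupport_lap3 (f : E3 → ℝ) : tsupport (lap3 f) ⊆ tsupport f := by
  refine closure_minimal (fun x hx => ?_) (isClosed_tsupport f)
  by_contra h
  apply hx
  unfold lap3
  apply Finset.sum_eq_zero
  intro k _
  exact image_eq_zero_of_notMem_tsupport
    (fun h2 => h ((tsupport_pd _ k).trans (tsupport_pd f k) h2))

lemma hcs_lap3 {f : E3 → ℝ} (hf : HasCompactSupport f) : HasCompactSupport (lap3 f) :=
  hf.mono' (subset_tsupport _ |>.trans (tsupport_lap3 f))

lemma ibp_lap {f g : E3 → ℝ} (hf : ContDiff ℝ ∞ f) (hg : ContDiff ℝ ∞ g)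
    (hc : HasCompactSupport g) : ∫ x, f x * lap3 g x = ∫ x, lap3 f x * g x := by
  unfold lap3
  simp_rw [Finset.mul_sum, Finset.sum_mul]
  rw [integral_finsetSum, integral_finsetSum]
  · refine Finset.sum_congr rfl fun k _ => ?_
    rw [ibp hf (pd_contDiff hg k) (hcs_pd hc k) k, ibp (pd_contDiff hf k) hg hc k, neg_neg]
  · intro k _
    exact ((pd_contDiff (pd_contDiff hf k) k).continuous.mul hg.continuous).integrable_of_hasCompactSupport
      hc.mul_left
  · intro k _
    exact (hf.continuous.mul
      (pd_contDiff (pd_contDiff hg k) k).continuous).integrable_of_hasCompactSupport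
      (hcs_pd (hcs_pd hc k) k).mul_left

/-- regularised radial powers -/
def Qp (a : E3) (ε α : ℝ) (x : E3) : ℝ := (‖x - a‖ ^ 2 + ε ^ 2) ^ α

lemma Qpos (a : E3) {ε : ℝ} (hε : 0 < ε) (x : E3) : 0 < ‖x - a‖ ^ 2 + ε ^ 2 := by positivity

lemma Qp_contDiff (a : E3) {ε : ℝ} (hε : 0 < ε) (α : ℝ) : ContDiff ℝ ∞ (Qp a ε α) := by
  unfold Qp
  apply ContDiff.rpow_const_of_ne
  · exact ((contDiff_id.sub contDiff_const).norm_sq ℝ).add contDiff_const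
  · intro x; exact (Qpos a hε x).ne'

lemma pd_Qp (a : E3) {ε : ℝ} (hε : 0 < ε) (α : ℝ) (k : Fin 3) (x : E3) :
    pd (Qp a ε α) k x = 2 * α * ((x k - a k) * Qp a ε (α - 1) x) := by
  have h1 : HasFDerivAt (fun x : E3 => ‖x - a‖ ^ 2 + ε ^ 2)
      (2 • (innerSL ℝ (x - a)).comp (ContinuousLinearMap.id ℝ E3)) x := by
    have := ((hasFDerivAt_id x).sub_const a).norm_sq
    exact this.add_const _
  have h2 := h1.rpow_const (p := α) (Or.inl (Qpos a hε x).ne')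
  unfold pd
  have : fderiv ℝ (Qp a ε α) x = _ := h2.fderiv
  rw [this]
  simp [Qp, EuclideanSpace.inner_single_right]
  ring

lemma pd_lin_mul (a : E3) {f : E3 → ℝ} (hf : ContDiff ℝ ∞ f) (c : ℝ) (k : Fin 3) (x : E3) :
    pd (fun x => c * ((x k - a k) * f x)) k x = c * (f x + (x k - a k) * pd f k x) := by
  have h1 : HasFDerivAt (fun x : E3 => x k - a k) (EuclideanSpace.proj k : E3 →L[ℝ] ℝ) x :=
    (EuclideanSpace.proj k : E3 →L[ℝ] ℝ).hasFDerivAt.sub_const _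
  have h2 := (h1.mul ((hf.differentiable (by simp)) x).hasFDerivAt).const_mul c
  unfold pd
  rw [show fderiv ℝ (fun x : E3 => c * ((x k - a k) * f x)) x = _ from h2.fderiv]
  simp
  ring

lemma sum_sq_eq (a x : E3) : ∑ k, (x k - a k) ^ 2 = ‖x - a‖ ^ 2 := by
  rw [EuclideanSpace.norm_sq_eq]
  simp

lemma lap3_Qp (a : E3) {ε : ℝ} (hε : 0 < ε) (α : ℝ) (x : E3) :
    lap3 (Qp a ε α) x = 2 * α * (2 * α + 1) * Qp a ε (α - 1) x
      - 4 * α * (α - 1) * ε ^ 2 * Qp a ε (α - 2) x := by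
  have h1 : ∀ k, pd (Qp a ε α) k = fun x => 2 * α * ((x k - a k) * Qp a ε (α - 1) x) :=
    fun k => funext fun x => pd_Qp a hε α k x
  unfold lap3
  simp_rw [h1, pd_lin_mul a (Qp_contDiff a hε _), pd_Qp a hε]
  have hq : Qp a ε (α - 1) x = Qp a ε (α - 2) x * (‖x - a‖ ^ 2 + ε ^ 2) := by
    unfold Qp
    rw [show α - 1 = (α - 2) + 1 by ring, Real.rpow_add (Qpos a hε x), Real.rpow_one]
  have e : α - 1 - 1 = α - 2 := by ring
  rw [e, ← Finset.mul_sum, Finset.sum_add_distrib]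
  have : ∑ k, (x k - a k) * (2 * (α - 1) * ((x k - a k) * Qp a ε (α - 2) x))
      = 2 * (α - 1) * Qp a ε (α - 2) x * ∑ k, (x k - a k) ^ 2 := by
    rw [Finset.mul_sum]; refine Finset.sum_congr rfl fun k _ => by ring
  rw [this, sum_sq_eq, hq]
  simp
  ring

lemma lap3_lincomb {f g : E3 → ℝ} (hf : ContDiff ℝ ∞ f) (hg : ContDiff ℝ ∞ g) (c d : ℝ) (x : E3) :
    lap3 (fun x => c * f x + d * g x) x = c * lap3 f x + d * lap3 g x := by
  have key : ∀ {f g : E3 → ℝ}, ContDiff ℝ ∞ f → ContDiff ℝ ∞ g → ∀ k x,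
      pd (fun x => c * f x + d * g x) k x = c * pd f k x + d * pd g k x := by
    intro f g hf hg k x
    unfold pd
    have h := (((hf.differentiable (by simp)) x).hasFDerivAt.const_mul c).add
      (((hg.differentiable (by simp)) x).hasFDerivAt.const_mul d)
    rw [show fderiv ℝ (fun x => c * f x + d * g x) x = _ from h.fderiv]
    simp
  unfold lap3
  have h1 : ∀ k, pd (fun x => c * f x + d * g x) k = fun x => c * pd f k x + d * pd g k x :=
    fun k => funext fun x => key hf hg k x
  simp_rw [h1, key (pd_contDiff hf _) (pd_contDiff hg _)]
  rw [Finset.sum_add_distrib, Finset.mul_sum, Finset.mul_sum]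

lemma bilap_Q (a : E3) {ε : ℝ} (hε : 0 < ε) (x : E3) :
    lap3 (lap3 (Qp a ε (1/2))) x = -15 * ε ^ 4 * Qp a ε (-7/2) x := by
  have h1 : lap3 (Qp a ε (1/2)) = fun x => 2 * Qp a ε (-1/2) x + ε ^ 2 * Qp a ε (-3/2) x := by
    funext x
    rw [lap3_Qp a hε]
    norm_num
  rw [h1, lap3_lincomb (Qp_contDiff a hε _) (Qp_contDiff a hε _), lap3_Qp a hε, lap3_Qp a hε]
  norm_num
  ring

lemma rep_eps {f : E3 → ℝ} (hf : ContDiff ℝ ∞ f) (hc : HasCompactSupport f) (a : E3) {ε : ℝ}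
    (hε : 0 < ε) : ∫ y, Qp a ε (1/2) y * lap3 (lap3 f) y
      = ∫ y, (-15 * ε ^ 4 * Qp a ε (-7/2) y) * f y := by
  rw [ibp_lap (Qp_contDiff a hε _) (lap3_contDiff hf) (hcs_lap3 hc),
    ibp_lap (lap3_contDiff (Qp_contDiff a hε _)) hf hc]
  simp_rw [bilap_Q a hε]

end

section
open Filter Topology
open scoped ContDiff

def kap : ℝ := ∫ x : E3, ((1 : ℝ) + ‖x‖ ^ 2) ^ (-(7:ℝ) / 2)

lemma kap_int : Integrable (fun x : E3 => ((1 : ℝ) + ‖x‖ ^ 2) ^ (-(7:ℝ) / 2)) :=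
  integrable_rpow_neg_one_add_norm_sq (by simp; norm_num)

lemma kap_pos : 0 < kap := by
  unfold kap
  rw [integral_pos_iff_support_of_nonneg (fun x => by positivity) kap_int]
  have : Function.support (fun x : E3 => ((1 : ℝ) + ‖x‖ ^ 2) ^ (-(7:ℝ) / 2)) = univ := by
    ext x
    simp only [Function.mem_support, mem_univ, iff_true]
    positivity
  rw [this]
  simp

lemma decay_aux : Tendsto (fun x : E3 => ‖x‖ ^ Module.finrank ℝ E3 *
    (kap⁻¹ * ((1 : ℝ) + ‖x‖ ^ 2) ^ (-(7:ℝ) / 2))) (Bornology.cobounded E3) (𝓝 0) := by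
  have h0 : Tendsto (fun r : ℝ => kap⁻¹ * r⁻¹) atTop (𝓝 0) := by
    simpa using tendsto_inv_atTop_zero.const_mul kap⁻¹
  have h1 := h0.comp (tendsto_norm_cobounded_atTop (E := E3))
  refine squeeze_zero' (Eventually.of_forall fun x => ?_) ?_ h1
  · have := kap_pos; positivity
  · have hev : ∀ᶠ x : E3 in Bornology.cobounded E3, 1 ≤ ‖x‖ :=
      tendsto_norm_cobounded_atTop.eventually (eventually_ge_atTop 1)
    filter_upwards [hev] with x hx
    have hk := kap_pos
    have hxp : 0 < ‖x‖ := by linarith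
    have h2 : ((1 : ℝ) + ‖x‖ ^ 2) ^ (-(7:ℝ) / 2) ≤ (‖x‖ ^ 2) ^ (-(7:ℝ)/2) := by
      apply Real.rpow_le_rpow_of_nonpos (by positivity) (by linarith) (by norm_num)
    have h3 : (‖x‖ ^ 2) ^ (-(7:ℝ)/2) = (‖x‖ ^ 7)⁻¹ := by
      rw [← Real.rpow_natCast, ← Real.rpow_mul hxp.le]
      norm_num
    rw [h3] at h2
    simp only [finrank_euclideanSpace, Fintype.card_fin, Function.comp]
    calc ‖x‖ ^ 3 * (kap⁻¹ * ((1 : ℝ) + ‖x‖ ^ 2) ^ (-(7:ℝ) / 2))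
        ≤ ‖x‖ ^ 3 * (kap⁻¹ * (‖x‖ ^ 7)⁻¹) := by gcongr
      _ = kap⁻¹ * (‖x‖⁻¹ * (‖x‖ ^ 3)⁻¹) := by field_simp
      _ ≤ kap⁻¹ * (‖x‖⁻¹ * 1) := by
        gcongr
        exact inv_le_one_of_one_le₀ (one_le_pow₀ hx)
      _ = _ := by simp

lemma rep {f : E3 → ℝ} (hf : ContDiff ℝ ∞ f) (hc : HasCompactSupport f) (a : E3) :
    ∫ y, ‖y - a‖ * lap3 (lap3 f) y = -15 * kap * f a := by
  have hk := kap_pos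
  set g := lap3 (lap3 f) with hg
  have hgc : Continuous g := (lap3_contDiff (lap3_contDiff hf)).continuous
  have hgs : HasCompactSupport g := hcs_lap3 (hcs_lap3 hc)
  have L : Tendsto (fun c : ℝ => ∫ y, Qp a c⁻¹ (1/2) y * g y) atTop (𝓝 (∫ y, ‖y - a‖ * g y)) := by
    apply tendsto_integral_filter_of_dominated_convergence (fun y => Qp a 1 (1/2) y * |g y|)
    · filter_upwards [eventually_gt_atTop 0] with c hc0
      exact ((Qp_contDiff a (inv_pos.2 hc0) _).continuous.mul hgc).aestronglyMeasurable
    · filter_upwards [eventually_ge_atTop 1] with c hc1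
      refine Eventually.of_forall fun y => ?_
      have hc0 : 0 < c := by linarith
      have : 0 ≤ Qp a c⁻¹ (1/2) y := by unfold Qp; positivity
      rw [norm_mul, Real.norm_eq_abs, Real.norm_eq_abs, abs_of_nonneg this]
      gcongr
      unfold Qp
      have : c⁻¹ ≤ 1 := inv_le_one_of_one_le₀ hc1
      gcongr
    · apply Continuous.integrable_of_hasCompactSupport
      · exact (Qp_contDiff a one_pos _).continuous.mul hgc.abs
      · exact (hgs.comp_left (g := fun t : ℝ => |t|) abs_zero).mul_left
    · refine Eventually.of_forall fun y => ?_
      refine Tendsto.mul_const _ ?_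
      have h1 : Tendsto (fun c : ℝ => ‖y - a‖ ^ 2 + (c⁻¹) ^ 2) atTop (𝓝 (‖y - a‖ ^ 2 + 0 ^ 2)) :=
        (tendsto_inv_atTop_zero.pow 2).const_add _
      have h2 := h1.rpow_const (p := 1/2) (Or.inr (by norm_num))
      unfold Qp
      convert h2 using 2
      rw [zero_pow two_ne_zero, add_zero, ← Real.sqrt_eq_rpow, Real.sqrt_sq (norm_nonneg _)]
  have hfi : Integrable f := hf.continuous.integrable_of_hasCompactSupport hc
  have R := (tendsto_integral_comp_smul_smul_of_integrable' (μ := volume) (g := f) (x₀ := a)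
    (φ := fun x : E3 => kap⁻¹ * ((1 : ℝ) + ‖x‖ ^ 2) ^ (-(7:ℝ) / 2))
    (fun x => by positivity) (by rw [integral_const_mul]; exact inv_mul_cancel₀ hk.ne')
    decay_aux hfi hf.continuous.continuousAt).const_mul (-15 * kap)
  refine tendsto_nhds_unique L (R.congr' ?_)
  filter_upwards [eventually_gt_atTop 0] with c hc0
  rw [hg, rep_eps hf hc a (inv_pos.2 hc0), ← integral_const_mul]
  congr 1
  funext y
  simp only [finrank_euclideanSpace, Fintype.card_fin, smul_eq_mul, Qp]
  have : ((1 : ℝ) + ‖c • (a - y)‖ ^ 2) = c ^ 2 * (‖y - a‖ ^ 2 + c⁻¹ ^ 2) := by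
    rw [norm_smul, norm_sub_rev, Real.norm_eq_abs, mul_pow, sq_abs]; field_simp; ring
  rw [this, Real.mul_rpow (by positivity) (by positivity)]
  have h3 : (c ^ 2) ^ (-(7:ℝ)/2) = (c ^ 7)⁻¹ := by
    rw [← Real.rpow_natCast, ← Real.rpow_mul hc0.le]
    norm_num
  rw [h3]
  field_simp

end

section
open Filter Topology
open scoped ContDiff

lemma pd_congr {f g : E3 → ℝ} {x : E3} (h : f =ᶠ[𝓝 x] g) (k : Fin 3) : pd f k =ᶠ[𝓝 x] pd g k := by
  unfold pd
  filter_upwards [h.fderiv (𝕜 := ℝ)] with y hy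
  rw [hy]

lemma lap3_congr {f g : E3 → ℝ} {x : E3} (h : f =ᶠ[𝓝 x] g) : lap3 f =ᶠ[𝓝 x] lap3 g := by
  unfold lap3
  have : ∀ k, pd (pd f k) k =ᶠ[𝓝 x] pd (pd g k) k := fun k => pd_congr (pd_congr h k) k
  filter_upwards [this 0, this 1, this 2] with y h0 h1 h2
  simp [Fin.sum_univ_three, h0, h1, h2]

/-- complexified squared distance -/
def qC (z v : E3) (t : ℂ) (y : E3) : ℂ :=
  ((‖y - z‖ ^ 2 : ℝ) : ℂ) - 2 * t * ((inner ℝ (y - z) v : ℝ) : ℂ) + t ^ 2 * ((‖v‖ ^ 2 : ℝ) : ℂ)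

lemma qC_real (z v : E3) (t : ℝ) (y : E3) :
    qC z v t y = ((‖y - (z + t • v)‖ ^ 2 : ℝ) : ℂ) := by
  have : ‖y - (z + t • v)‖ ^ 2 = ‖y - z‖ ^ 2 - 2 * t * inner ℝ (y - z) v + t ^ 2 * ‖v‖ ^ 2 := by
    rw [← sub_sub, norm_sub_sq_real, inner_smul_right, norm_smul, mul_pow, Real.norm_eq_abs, sq_abs]
    ring
  rw [this, qC]
  push_cast
  ring

lemma qC_re (z v : E3) (t : ℂ) (y : E3) {R : ℝ} (hR : 0 < R) (ht : ‖t‖ * ‖v‖ < R / 8)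
    (hy : R / 2 ≤ ‖y - z‖) : R ^ 2 / 16 ≤ (qC z v t y).re := by
  set d := ‖y - z‖
  have h1 : (qC z v t y).re = d ^ 2 - (2 * t * ((inner ℝ (y - z) v : ℝ) : ℂ)
      - t ^ 2 * ((‖v‖ ^ 2 : ℝ) : ℂ)).re := by
    simp [qC, d, -Complex.ofReal_pow]; ring
  have h2 : (2 * t * ((inner ℝ (y - z) v : ℝ) : ℂ) - t ^ 2 * ((‖v‖ ^ 2 : ℝ) : ℂ)).re
      ≤ 2 * ‖t‖ * (d * ‖v‖) + ‖t‖ ^ 2 * ‖v‖ ^ 2 := by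
    refine (Complex.re_le_norm _).trans ((norm_sub_le _ _).trans ?_)
    rw [norm_mul, norm_mul, norm_mul, norm_pow, Complex.norm_real, Complex.norm_real]
    have := norm_inner_le_norm (𝕜 := ℝ) (y - z) v
    simp only [Complex.norm_ofNat, norm_pow, norm_norm]
    gcongr
  have h3 : 0 ≤ ‖t‖ * ‖v‖ := by positivity
  rw [h1]
  nlinarith

lemma qC_hasDeriv (z v : E3) (t : ℂ) (y : E3) :
    HasDerivAt (fun t => qC z v t y) (- 2 * ((inner ℝ (y - z) v : ℝ) : ℂ)
      + 2 * t * ((‖v‖ ^ 2 : ℝ) : ℂ)) t := by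
  unfold qC
  have h1 := (((hasDerivAt_id t).const_mul 2).mul_const ((inner ℝ (y - z) v : ℝ) : ℂ)).const_sub
    ((‖y - z‖ ^ 2 : ℝ) : ℂ)
  have h2 := ((hasDerivAt_pow 2 t).mul_const ((‖v‖ ^ 2 : ℝ) : ℂ))
  refine (h1.add h2).congr_deriv ?_
  simp

lemma qC_cont (z v : E3) (t : ℂ) : Continuous (qC z v t) := by
  unfold qC; fun_prop

lemma uc_smooth {U : E3 → ℝ} (hU : ContDiff ℝ ∞ U) {z : E3} {R : ℝ} (hR : 0 < R)
    (hb : ∀ x ∈ ball z R, lap3 (lap3 U) x = 0) (hz : U =ᶠ[𝓝 z] 0) :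
    ∀ x ∈ ball z (R / 8), U x = 0 := by
  intro x hx
  let χ : ContDiffBump z := ⟨R / 2, 3 * R / 4, by positivity, by linarith⟩
  set f : E3 → ℝ := fun y => χ y * U y with hf
  have hfs : ContDiff ℝ ∞ f := χ.contDiff.mul hU
  have hfc : HasCompactSupport f := χ.hasCompactSupport.mul_right
  set g := lap3 (lap3 f) with hg
  have hgcont : Continuous g := (lap3_contDiff (lap3_contDiff hfs)).continuous
  have hgc : HasCompactSupport g := hcs_lap3 (hcs_lap3 hfc)
  have hfU : ∀ y ∈ ball z (R / 2), f =ᶠ[𝓝 y] U := by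
    intro y hy
    filter_upwards [isOpen_ball.mem_nhds hy] with w hw
    simp [hf, χ.one_of_mem_closedBall (ball_subset_closedBall hw)]
  have hg0 : ∀ y, ‖y - z‖ < R / 2 → g y = 0 := by
    intro y hy
    have hy' : y ∈ ball z (R / 2) := by simpa [dist_eq_norm] using hy
    have := (lap3_congr (lap3_congr (hfU y hy'))).eq_of_nhds
    rw [hg, this]
    exact hb y (ball_subset_ball (by linarith) hy')
  have hg1 : ∀ y, R < ‖y - z‖ → g y = 0 := by
    intro y hy
    apply image_eq_zero_of_notMem_tsupport
    intro hm
    have h1 := (tsupport_lap3 _).trans (tsupport_lap3 f) hm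
    have h2 : tsupport f ⊆ closedBall z (3 * R / 4) := by
      rw [← χ.tsupport_eq]; exact closure_mono (Function.support_mul_subset_left _ _)
    have h3 := h2 h1
    rw [mem_closedBall, dist_eq_norm] at h3
    linarith
  by_cases hxz : x = z
  · rw [hxz]; exact hz.eq_of_nhds
  set v := x - z with hv
  have hv0 : 0 < ‖v‖ := norm_pos_iff.2 (sub_ne_zero.2 hxz)
  have hvR : ‖v‖ < R / 8 := by simpa [dist_eq_norm] using hx
  set r := R / (8 * ‖v‖) with hr
  have hr1 : 1 < r := by rw [hr, lt_div_iff₀ (by positivity)]; linarith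
  have htr : ∀ t : ℂ, t ∈ ball (0:ℂ) r → ‖t‖ * ‖v‖ < R / 8 := by
    intro t ht
    rw [mem_ball_zero_iff, hr, lt_div_iff₀ (by positivity)] at ht
    linarith
  let F : ℂ → E3 → ℂ := fun t y => (qC z v t y) ^ (1/2 : ℂ) * (g y : ℂ)
  let F' : ℂ → E3 → ℂ := fun t y => ((1/2 : ℂ) * (qC z v t y) ^ ((1/2 : ℂ) - 1) *
    (- 2 * ((inner ℝ (y - z) v : ℝ) : ℂ) + 2 * t * ((‖v‖ ^ 2 : ℝ) : ℂ))) * (g y : ℂ)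
  let h : ℂ → ℂ := fun t => ∫ y, F t y
  have hslit : ∀ t ∈ ball (0:ℂ) r, ∀ y, R / 2 ≤ ‖y - z‖ → qC z v t y ∈ Complex.slitPlane := by
    intro t ht y hy
    left
    have := qC_re z v t y hR (htr t ht) hy
    have : 0 < R ^ 2 / 16 := by positivity
    linarith
  have hFmeas : ∀ t, AEStronglyMeasurable (F t) volume := by
    intro t
    apply Measurable.aestronglyMeasurable
    have := (qC_cont z v t).measurable
    have := hgcont.measurable
    fun_prop
  have hF'meas : ∀ t, AEStronglyMeasurable (F' t) volume := by
    intro t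
    apply Measurable.aestronglyMeasurable
    have := (qC_cont z v t).measurable
    have := hgcont.measurable
    fun_prop
  have hgi : Integrable g := hgcont.integrable_of_hasCompactSupport hgc
  have hdiff : ∀ t ∈ ball (0:ℂ) r, DifferentiableAt ℂ h t := by
    intro t ht
    have key := hasDerivAt_integral_of_dominated_loc_of_deriv_le (μ := volume) (F := F) (F' := F')
      (x₀ := t) (s := ball 0 r)
      (bound := fun y => ((1/2) * (R ^ 2 / 16) ^ (-(1/2) : ℝ) * (2 * (R * ‖v‖) + 2 * r * ‖v‖ ^ 2)) * |g y|)
      (isOpen_ball.mem_nhds ht) (Eventually.of_forall hFmeas) ?_ (hF'meas t) ?_ ?_ ?_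
    · exact key.2.differentiableAt
    · refine (hgi.norm.const_mul (((R ^ 2 + 2 * r * (R * ‖v‖) + r ^ 2 * ‖v‖ ^ 2)) ^ (1/2 : ℝ))).mono' (hFmeas t)
        (Eventually.of_forall fun y => ?_)
      simp only [F, norm_mul, Complex.norm_real]
      by_cases h1 : ‖y - z‖ < R / 2
      · simp [hg0 y h1]
      by_cases h2 : R < ‖y - z‖
      · simp [hg1 y h2]
      push Not at h1 h2
      gcongr
      rw [Complex.norm_cpow_of_ne_zero (Complex.slitPlane_ne_zero (hslit t ht y h1))]
      norm_num
      gcongr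
      unfold qC
      have := norm_inner_le_norm (𝕜 := ℝ) (y - z) v
      have ht' : ‖t‖ ≤ r := by simpa using (mem_ball_zero_iff.1 ht).le
      refine (norm_add_le _ _).trans (add_le_add ((norm_sub_le _ _).trans (add_le_add ?_ ?_)) ?_)
      · rw [Complex.norm_real]; simp only [norm_pow, norm_norm]; gcongr
      · rw [norm_mul, norm_mul, Complex.norm_real]; simp only [Complex.norm_ofNat]
        have h5 : ‖(inner ℝ (y - z) v : ℝ)‖ ≤ R * ‖v‖ := this.trans (by gcongr)
        gcongr
      · rw [norm_mul, norm_pow, Complex.norm_real]; simp only [norm_pow, norm_norm]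
        gcongr
    · refine Eventually.of_forall fun y t ht => ?_
      simp only [F', norm_mul, Complex.norm_real]
      by_cases h1 : ‖y - z‖ < R / 2
      · simp [hg0 y h1]
      by_cases h2 : R < ‖y - z‖
      · simp [hg1 y h2]
      push Not at h1 h2
      rw [← Real.norm_eq_abs (g y)]
      have ht' : ‖t‖ ≤ r := by simpa using (mem_ball_zero_iff.1 ht).le
      have := norm_inner_le_norm (𝕜 := ℝ) (y - z) v
      gcongr
      · norm_num
      · have hre := qC_re z v t y hR (htr t ht) h1
        rw [Complex.norm_cpow_of_ne_zero (Complex.slitPlane_ne_zero (hslit t ht y h1))]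
        norm_num
        have hnn : R ^ 2 / 16 ≤ ‖qC z v t y‖ := hre.trans (Complex.re_le_norm _)
        exact Real.rpow_le_rpow_of_nonpos (by positivity) hnn (by norm_num)
      · refine (norm_add_le _ _).trans (add_le_add ?_ ?_)
        · rw [norm_mul, Complex.norm_real]; simp only [norm_neg, Complex.norm_ofNat]
          have h5 : ‖(inner ℝ (y - z) v : ℝ)‖ ≤ R * ‖v‖ := this.trans (by gcongr)
          gcongr
        · rw [norm_mul, norm_mul, Complex.norm_real]
          simp only [norm_pow, norm_norm, Complex.norm_ofNat]
          gcongr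
    · exact hgi.norm.const_mul _
    · refine Eventually.of_forall fun y t ht => ?_
      by_cases h1 : ‖y - z‖ < R / 2
      · simp only [F, F', hg0 y h1, Complex.ofReal_zero, mul_zero]
        exact hasDerivAt_const _ _
      push Not at h1
      exact ((qC_hasDeriv z v t y).cpow_const (hslit t ht y h1)).mul_const _
  have hreal : ∀ t : ℝ, h t = ((-15 * kap * f (z + t • v) : ℝ) : ℂ) := by
    intro t
    rw [← rep hfs hfc (z + t • v), ← integral_complex_ofReal]
    refine integral_congr_ae (Eventually.of_forall fun y => ?_)
    simp only [F]
    rw [qC_real]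
    have h1 : (((‖y - (z + t • v)‖ ^ 2 : ℝ) : ℂ)) ^ (1/2 : ℂ) = ((‖y - (z + t • v)‖ : ℝ) : ℂ) := by
      have := Complex.ofReal_cpow (x := ‖y - (z + t • v)‖ ^ 2) (by positivity) (1/2)
      have h2 : (‖y - (z + t • v)‖ ^ 2) ^ (1/2 : ℝ) = ‖y - (z + t • v)‖ := by
        rw [← Real.sqrt_eq_rpow, Real.sqrt_sq (norm_nonneg _)]
      rw [h2] at this
      rw [this]
      norm_num
    rw [h1]
    push_cast
    rfl
  have han : AnalyticOnNhd ℂ h (ball 0 r) :=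
    DifferentiableOn.analyticOnNhd (fun t ht => (hdiff t ht).differentiableWithinAt) isOpen_ball
  have hfz : f =ᶠ[𝓝 z] 0 := (hfU z (mem_ball_self (by positivity))).trans hz
  have hfr : ∃ᶠ t in 𝓝[≠] (0:ℂ), h t = 0 := by
    have hcont : Tendsto (fun t : ℝ => z + t • v) (𝓝[≠] 0) (𝓝 z) := by
      have : Continuous (fun t : ℝ => z + t • v) := by fun_prop
      have := this.tendsto 0
      simp only [zero_smul, add_zero] at this
      exact this.mono_left nhdsWithin_le_nhds
    have hev : ∀ᶠ t : ℝ in 𝓝[≠] 0, h t = 0 := by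
      filter_upwards [hcont.eventually hfz] with t ht
      rw [hreal, ht]; simp
    have hmap : Tendsto (fun t : ℝ => (t : ℂ)) (𝓝[≠] 0) (𝓝[≠] 0) := by
      apply tendsto_nhdsWithin_of_tendsto_nhds_of_eventually_within
      · have := Complex.continuous_ofReal.tendsto 0
        simp only [Complex.ofReal_zero] at this
        exact this.mono_left nhdsWithin_le_nhds
      · filter_upwards [self_mem_nhdsWithin] with t ht
        simpa using ht
    exact hmap.frequently hev.frequently
  have h0 := han.eqOn_zero_of_preconnected_of_frequently_eq_zero
    (convex_ball (0:ℂ) r).isPreconnected (mem_ball_self (by linarith)) hfr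
  have h1 : h ((1:ℝ):ℂ) = 0 := h0 (by simpa using hr1)
  rw [hreal] at h1
  have h2 : -15 * kap * f (z + (1:ℝ) • v) = 0 := by exact_mod_cast h1
  have h3 : f x = 0 := by
    have := kap_pos
    have e : z + (1:ℝ) • v = x := by simp [hv]
    rw [e] at h2
    have : (-15 * kap) ≠ 0 := by nlinarith
    exact (mul_eq_zero.1 h2).resolve_left this
  rw [← (hfU x (ball_subset_ball (by linarith) hx)).eq_of_nhds]
  exact h3

end

section
open Filter Topology
open scoped ContDiff

/-- convolution -/
def cv (u ρ : E3 → ℝ) (x : E3) : ℝ := ∫ t, u t * ρ (x - t)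

lemma cv_eq (u ρ : E3 → ℝ) : cv u ρ = convolution u ρ (ContinuousLinearMap.mul ℝ ℝ) volume := by
  ext x; simp [cv, convolution]

lemma cv_contDiff {u ρ : E3 → ℝ} (hu : LocallyIntegrable u) (hρ : ContDiff ℝ ∞ ρ)
    (hc : HasCompactSupport ρ) : ContDiff ℝ ∞ (cv u ρ) := by
  rw [cv_eq]
  exact hc.contDiff_convolution_right _ hu hρ

lemma pd_cv {u ρ : E3 → ℝ} (hu : LocallyIntegrable u) (hρ : ContDiff ℝ ∞ ρ)
    (hc : HasCompactSupport ρ) (k : Fin 3) : pd (cv u ρ) k = cv u (pd ρ k) := by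
  ext x
  have h := hc.hasFDerivAt_convolution_right (ContinuousLinearMap.mul ℝ ℝ) hu (hρ.of_le (by norm_cast)) x
  unfold pd
  rw [cv_eq, h.fderiv]
  have hi : ConvolutionExistsAt u (fderiv ℝ ρ) x ((ContinuousLinearMap.mul ℝ ℝ).precompR E3) volume :=
    ((hc.fderiv ℝ).convolutionExists_right _ hu (hρ.continuous_fderiv (by simp))) x
  unfold convolution
  rw [ContinuousLinearMap.integral_apply hi]
  simp [cv]

lemma cv_integrable {u ρ : E3 → ℝ} (hu : LocallyIntegrable u) (hρ : Continuous ρ)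
    (hc : HasCompactSupport ρ) (x : E3) : Integrable (fun t => u t * ρ (x - t)) :=
  (hc.convolutionExists_right (ContinuousLinearMap.mul ℝ ℝ) hu hρ) x

lemma lap3_cv {u ρ : E3 → ℝ} (hu : LocallyIntegrable u) (hρ : ContDiff ℝ ∞ ρ)
    (hc : HasCompactSupport ρ) : lap3 (cv u ρ) = cv u (lap3 ρ) := by
  ext x
  unfold lap3
  simp_rw [pd_cv hu hρ hc, pd_cv hu (pd_contDiff hρ _) (hcs_pd hc _)]
  unfold cv
  rw [← integral_finsetSum]
  · simp [Finset.mul_sum]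
  · intro k _
    exact cv_integrable hu (pd_contDiff (pd_contDiff hρ k) k).continuous (hcs_pd (hcs_pd hc k) k) x

lemma pd_refl {f : E3 → ℝ} (hf : ContDiff ℝ ∞ f) (x : E3) (k : Fin 3) :
    pd (fun t => f (x - t)) k = fun t => - pd f k (x - t) := by
  ext t
  unfold pd
  have h1 : HasFDerivAt (fun t => x - t) (-(ContinuousLinearMap.id ℝ E3)) t := by
    simpa using (hasFDerivAt_id t).const_sub x
  have h2 : HasFDerivAt f (fderiv ℝ f (x - t)) (x - t) :=
    (hf.differentiable (by simp) _).hasFDerivAt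
  have := (HasFDerivAt.comp t h2 h1).fderiv
  simp only [Function.comp_def] at this
  rw [this]; simp

lemma pd_neg (f : E3 → ℝ) (k : Fin 3) : pd (fun t => - f t) k = fun t => - pd f k t := by
  ext t; unfold pd; rw [fderiv_fun_neg]; simp

lemma lap3_refl {f : E3 → ℝ} (hf : ContDiff ℝ ∞ f) (x : E3) :
    lap3 (fun t => f (x - t)) = fun t => lap3 f (x - t) := by
  ext t
  unfold lap3
  congr 1; ext k
  rw [pd_refl hf, pd_neg, pd_refl (pd_contDiff hf k)]
  simp

/-- standard bump -/
def mo (δ : ℝ) (hδ : 0 < δ) : ContDiffBump (0 : E3) := ⟨δ / 2, δ, by positivity, by linarith⟩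

lemma uc_ball {u : E3 → ℝ} {z : E3} {R : ℝ} (hR : 0 < R) (hu : ContinuousOn u (closedBall z R))
    (hw : ∀ φ : E3 → ℝ, ContDiff ℝ ∞ φ → HasCompactSupport φ → tsupport φ ⊆ ball z R →
      ∫ t, u t * lap3 (lap3 φ) t = 0) (hz : u =ᶠ[𝓝 z] 0) :
    ∀ x ∈ ball z (R / 16), u x = 0 := by
  intro x hx
  set u' := (closedBall z R).indicator u with hu'
  have hint : Integrable u' := by
    rw [hu', integrable_indicator_iff measurableSet_closedBall]
    exact hu.integrableOn_compact (isCompact_closedBall z R)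
  have hli := hint.locallyIntegrable
  have heq : ∀ y ∈ ball z R, u' =ᶠ[𝓝 y] u := by
    intro y hy
    filter_upwards [isOpen_ball.mem_nhds hy] with t ht
    simp [hu', indicator_of_mem (ball_subset_closedBall ht)]
  have hz' : u' =ᶠ[𝓝 z] 0 := (heq z (mem_ball_self hR)).trans hz
  obtain ⟨ε, hε, hz0⟩ := Metric.eventually_nhds_iff_ball.1 hz'
  have key : ∀ δ : ℝ, ∀ hδ : 0 < δ, δ < R / 2 → δ < ε / 2 →
      cv u' ((mo δ hδ).normed volume) x = 0 := by
    intro δ hδ h1 h2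
    set ρ := (mo δ hδ).normed volume
    have hρ : ContDiff ℝ ∞ ρ := (mo δ hδ).contDiff_normed
    have hρc : HasCompactSupport ρ := (mo δ hδ).hasCompactSupport_normed
    have hρs : ∀ y, ρ y ≠ 0 → ‖y‖ < δ := by
      intro y hy
      have : y ∈ Function.support ρ := hy
      rw [(mo δ hδ).support_normed_eq] at this
      simpa [mo] using this
    have hρt : ∀ y, y ∈ tsupport ρ → ‖y‖ ≤ δ := by
      intro y hy
      rw [(mo δ hδ).tsupport_normed_eq] at hy
      simpa [mo] using hy
    refine uc_smooth (U := cv u' ρ) (R := R / 2) (z := z) (cv_contDiff hli hρ hρc) (by linarith) ?_ ?_ x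
      (by convert hx using 2; ring)
    · intro y hy
      rw [lap3_cv hli hρ hρc, lap3_cv hli (lap3_contDiff hρ) (hcs_lap3 hρc)]
      have e : (fun t => lap3 (lap3 ρ) (y - t)) = lap3 (lap3 (fun t => ρ (y - t))) := by
        rw [lap3_refl hρ, lap3_refl (lap3_contDiff hρ)]
      have hs : tsupport (fun t => ρ (y - t)) ⊆ closedBall y δ := by
        refine closure_minimal ?_ isClosed_closedBall
        intro t ht
        rw [mem_closedBall, dist_comm, dist_eq_norm]
        exact (hρs _ ht).le
      have hs2 : closedBall y δ ⊆ ball z R := by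
        intro t ht
        rw [mem_closedBall] at ht
        rw [mem_ball] at hy ⊢
        have := dist_triangle t y z
        linarith
      have hcs : HasCompactSupport (fun t => ρ (y - t)) :=
        (isCompact_closedBall y δ).of_isClosed_subset (isClosed_tsupport _) hs
      have := hw (fun t => ρ (y - t)) (hρ.comp (contDiff_const.sub contDiff_id)) hcs (hs.trans hs2)
      rw [← e] at this
      rw [← this]
      unfold cv
      refine integral_congr_ae (Eventually.of_forall fun t => ?_)
      by_cases ht : t ∈ ball z R
      · simp only [(heq t ht).self_of_nhds]
      · have h0 : lap3 (lap3 ρ) (y - t) = 0 := by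
          have : t ∉ tsupport (lap3 (lap3 (fun t => ρ (y - t)))) := fun h =>
            ht (hs2 (hs (tsupport_lap3 _ (tsupport_lap3 _ h))))
          rw [← e] at this
          exact image_eq_zero_of_notMem_tsupport (f := fun t => lap3 (lap3 ρ) (y - t)) this
        simp [h0]
    · filter_upwards [ball_mem_nhds z (show 0 < ε / 2 by positivity)] with y hy
      unfold cv
      rw [integral_eq_zero_of_ae]
      · rfl
      refine Eventually.of_forall fun t => ?_
      by_cases ht : t ∈ ball z ε
      · simp [hz0 t ht]
      · have : ρ (y - t) = 0 := by
          by_contra h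
          have := hρs _ h
          rw [mem_ball] at hy ht
          have h3 := dist_triangle t y z
          rw [dist_comm t y, dist_eq_norm y t] at h3
          linarith
        simp [this]
  have hxR : x ∈ ball z R := ball_subset_ball (by linarith) hx
  have hc : ContinuousAt u' x :=
    ((hu.continuousAt (closedBall_mem_nhds_of_mem hxR))).congr (heq x hxR).symm
  have hδ : ∀ n : ℕ, 0 < 1 / ((n : ℝ) + 1) := fun n => by positivity
  have ht : Tendsto (fun n : ℕ => cv u' ((mo (1 / ((n : ℝ) + 1)) (hδ n)).normed volume) x) atTop (𝓝 (u' x)) := by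
    have hh := ContDiffBump.convolution_tendsto_right (G := E3) (l := atTop) (g := fun _ => u')
      (φ := fun n : ℕ => mo (1 / ((n : ℝ) + 1)) (hδ n)) (μ := volume) (k := fun _ => x) (x₀ := x)
      (z₀ := u' x) (by simpa [mo] using tendsto_one_div_add_atTop_nhds_zero_nat (𝕜 := ℝ))
      (Eventually.of_forall fun _ => hint.aestronglyMeasurable)
      (hc.tendsto.comp tendsto_snd) tendsto_const_nhds
    refine hh.congr fun n => ?_
    rw [cv_eq, ← convolution_flip]
    congr 1
    ext
    simp
  have h0 : ∀ᶠ n : ℕ in atTop, cv u' ((mo (1 / ((n : ℝ) + 1)) (hδ n)).normed volume) x = 0 := by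
    have hl := tendsto_one_div_add_atTop_nhds_zero_nat (𝕜 := ℝ)
    filter_upwards [hl.eventually_lt_const (show 0 < R / 2 by positivity),
      hl.eventually_lt_const (show 0 < ε / 2 by positivity)] with n h1 h2
    exact key _ _ h1 h2
  have := tendsto_nhds_unique ht (tendsto_const_nhds.congr' (h0.mono fun _ h => h.symm))
  rw [← (heq x hxR).self_of_nhds, this]

lemma uc_conn {u : E3 → ℝ} {W : Set E3} (hW : IsOpen W) (hWc : IsPreconnected W)
    (hu : ContinuousOn u W)
    (hw : ∀ φ : E3 → ℝ, ContDiff ℝ ∞ φ → HasCompactSupport φ → tsupport φ ⊆ W →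
      ∫ t, u t * lap3 (lap3 φ) t = 0) {z : E3} (hzW : z ∈ W) (hz : u =ᶠ[𝓝 z] 0) :
    ∀ x ∈ W, u =ᶠ[𝓝 x] 0 := by
  have hop : IsOpen {x | u =ᶠ[𝓝 x] 0} := isOpen_setOfPred_eventually_nhds
  refine hWc.subset_of_closure_inter_subset (u := {x | u =ᶠ[𝓝 x] 0}) hop ⟨z, hzW, hz⟩ ?_
  rintro x ⟨hx, hxW⟩
  obtain ⟨R, hR, hRW⟩ := Metric.isOpen_iff.1 hW x hxW
  obtain ⟨y, hy, hyx⟩ := Metric.mem_closure_iff.1 hx (R / 34) (by positivity)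
  have hsub : closedBall y (R / 2) ⊆ W := by
    refine Subset.trans ?_ hRW
    intro t ht
    rw [mem_closedBall] at ht
    rw [mem_ball]
    have := dist_triangle t y x
    rw [dist_comm y x] at this
    linarith
  have := uc_ball (u := u) (z := y) (R := R / 2) (by positivity) (hu.mono hsub)
    (fun φ h1 h2 h3 => hw φ h1 h2 (h3.trans (ball_subset_closedBall.trans hsub))) hy
  filter_upwards [isOpen_ball.mem_nhds (show x ∈ ball y (R / 2 / 16) by rw [mem_ball]; linarith)] with t ht
  exact this t ht

end

section
open Filter Topology
open scoped ContDiff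

abbrev ME := E3 →L[ℝ] E3

instance iME1 : NormedAddCommGroup ME := ContinuousLinearMap.toNormedAddCommGroup
instance iME2 : NormedSpace ℝ ME := ContinuousLinearMap.toNormedSpace
instance iME3 : NormedAddCommGroup (ME →L[ℝ] ℝ) := ContinuousLinearMap.toNormedAddCommGroup
instance iME4 : NormedSpace ℝ (ME →L[ℝ] ℝ) := ContinuousLinearMap.toNormedSpace
instance iME5 : NormedAddCommGroup (ME →L[ℝ] ME →L[ℝ] ℝ) := ContinuousLinearMap.toNormedAddCommGroup
instance iME6 : NormedSpace ℝ (ME →L[ℝ] ME →L[ℝ] ℝ) := ContinuousLinearMap.toNormedSpace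

/-- basis vector -/
abbrev bv (k : Fin 3) : E3 := EuclideanSpace.single k 1

/-- entry functional -/
def ent (i j : Fin 3) : ME →L[ℝ] ℝ :=
  (EuclideanSpace.proj (𝕜 := ℝ) i : E3 →L[ℝ] ℝ) ∘L (ContinuousLinearMap.apply ℝ E3 (bv j))

lemma ent_apply (i j : Fin 3) (S : ME) : ent i j S = S (bv j) i := rfl

def trc : ME →L[ℝ] ℝ := ∑ i, ent i i
def sye (i j : Fin 3) : ME →L[ℝ] ℝ := (1 / 2 : ℝ) • (ent i j + ent j i)

/-- the elasticity form -/
def bA (lam mu : ℝ) : ME →L[ℝ] ME →L[ℝ] ℝ :=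
  lam • trc.smulRight trc + (2 * mu) • ∑ i, ∑ j, (sye i j).smulRight (sye i j)

lemma bA_apply (lam mu : ℝ) (S T : ME) : bA lam mu S T =
    lam * trc S * trc T + 2 * mu * ∑ i, ∑ j, sye i j S * sye i j T := by
  simp [bA, mul_assoc]

lemma bA_comm (lam mu : ℝ) (S T : ME) : bA lam mu S T = bA lam mu T S := by
  rw [bA_apply, bA_apply]
  simp only [mul_comm (sye _ _ S)]
  ring

lemma integrand_eq (lam mu : ℝ) (w v : E3 → E3) (x : E3) :
    (lam * divg w x * divg v x + 2 * mu * ∑ i, ∑ j, strain w x i j * strain v x i j)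
      = bA lam mu (fderiv ℝ w x) (fderiv ℝ v x) := by
  rw [bA_apply]
  have : ∀ u : E3 → E3, ∀ i j, strain u x i j = sye i j (fderiv ℝ u x) := by
    intro u i j; simp [strain, sye, jac, ent_apply]; ring
  simp only [this]
  simp [divg, trc, jac, ent_apply]

lemma bA_lower (lam mu : ℝ) (hmu : 0 < mu) (S : ME) :
    (lam + 2 * mu / 3) * trc S ^ 2 ≤ bA lam mu S S := by
  rw [bA_apply]
  simp only [trc, sye, Fin.sum_univ_three, add_apply, smul_apply, smul_eq_mul]
  set a := ent 0 0 S
  set b := ent 1 1 S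
  set c := ent 2 2 S
  have : 0 ≤ mu * ((a - b) ^ 2 + (b - c) ^ 2 + (a - c) ^ 2 + (ent 0 1 S + ent 1 0 S) ^ 2
    + (ent 0 2 S + ent 2 0 S) ^ 2 + (ent 1 2 S + ent 2 1 S) ^ 2) := by positivity
  have h2 : 0 ≤ mu * ((ent 0 1 S + ent 1 0 S) ^ 2
    + (ent 0 2 S + ent 2 0 S) ^ 2 + (ent 1 2 S + ent 2 1 S) ^ 2) := by positivity
  have h3 : 0 ≤ mu * ((a - b) ^ 2 + (b - c) ^ 2 + (a - c) ^ 2) := by positivity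
  nlinarith

lemma bA_nonneg {lam mu : ℝ} (hmu : 0 < mu) (hlam : 0 < 3 * lam + 2 * mu) (S : ME) :
    0 ≤ bA lam mu S S := by
  refine le_trans ?_ (bA_lower lam mu hmu S)
  have : 0 ≤ lam + 2 * mu / 3 := by linarith
  positivity

lemma bA_zero {lam mu : ℝ} (hmu : 0 < mu) (hlam : 0 < 3 * lam + 2 * mu) {S : ME}
    (h : bA lam mu S S = 0) : S (bv 0) 0 = 0 := by
  have h1 := bA_lower lam mu hmu S
  have h2 : trc S = 0 := by
    have : 0 < lam + 2 * mu / 3 := by linarith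
    have h3 : trc S ^ 2 ≤ 0 := by
      by_contra hh
      push Not at hh
      have := mul_pos this hh
      linarith
    nlinarith
  rw [bA_apply, h2] at h
  have h3 : ∑ i, ∑ j, sye i j S * sye i j S = 0 := by
    have : 2 * mu ≠ 0 := by positivity
    simpa [this] using h
  have h4 : sye 0 0 S * sye 0 0 S = 0 := by
    have h5 := (Finset.sum_eq_zero_iff_of_nonneg (fun i _ => Finset.sum_nonneg fun j _ => mul_self_nonneg _)).1 h3 0
      (Finset.mem_univ _)
    exact (Finset.sum_eq_zero_iff_of_nonneg (fun j _ => mul_self_nonneg _)).1 h5 0 (Finset.mem_univ _)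
  have h5 : sye 0 0 S = 0 := by simpa using h4
  simp [sye, ent_apply] at h5
  linarith

lemma bA_amgm {lam mu : ℝ} (hmu : 0 < mu) (hlam : 0 < 3 * lam + 2 * mu) (S T : ME) :
    2 * bA lam mu S T ≤ bA lam mu S S + bA lam mu T T := by
  have := bA_nonneg hmu hlam (S - T)
  simp only [map_sub, sub_apply] at this
  rw [bA_comm lam mu T S] at this
  linarith

lemma bA_bound (lam mu : ℝ) : ∃ K : ℝ, 0 < K ∧ ∀ S T, |bA lam mu S T| ≤ K * ‖S‖ * ‖T‖ :=
  ⟨‖bA lam mu‖ + 1, by positivity, fun S T => ((bA lam mu).le_opNorm₂ S T).trans (by gcongr; linarith)⟩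

/-- stress form: `bA S T = ∑ S_jk σ_jk(T)` -/
lemma bA_stress (lam mu : ℝ) (S T : ME) : bA lam mu S T =
    ∑ j, ∑ k, S (bv k) j * (lam * (if j = k then trc T else 0) + mu * (ent j k T + ent k j T)) := by
  rw [bA_apply]
  simp only [trc, sye, Fin.sum_univ_three, add_apply, smul_apply, smul_eq_mul,
    ent_apply]
  simp
  ring

lemma pd_lin {f g : E3 → ℝ} (hf : ContDiff ℝ ∞ f) (hg : ContDiff ℝ ∞ g) (a b : ℝ) (k : Fin 3) :
    pd (fun x => a * f x + b * g x) k = fun x => a * pd f k x + b * pd g k x := by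
  ext x
  have h1 := (hf.differentiable (by simp) x).const_mul a
  have h2 := (hg.differentiable (by simp) x).const_mul b
  unfold pd
  rw [fderiv_fun_add h1 h2, fderiv_const_mul (hf.differentiable (by simp) x), fderiv_const_mul (hg.differentiable (by simp) x)]
  simp

lemma pd_sum {f : Fin 3 → E3 → ℝ} (hf : ∀ l, ContDiff ℝ ∞ (f l)) (k : Fin 3) :
    pd (fun x => ∑ l, f l x) k = fun x => ∑ l, pd (f l) k x := by
  ext x
  unfold pd
  rw [fderiv_fun_sum (fun l _ => (hf l).differentiable (by simp) x)]
  simp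

lemma pd_comm {f : E3 → ℝ} (hf : ContDiff ℝ ∞ f) (i j : Fin 3) : pd (pd f i) j = pd (pd f j) i := by
  ext x
  have hd : Differentiable ℝ (fderiv ℝ f) := (hf.fderiv_right (m := 1) (by norm_cast)).differentiable (by simp)
  have key : ∀ a b : Fin 3, pd (pd f a) b x = fderiv ℝ (fderiv ℝ f) x (bv b) (bv a) := by
    intro a b
    unfold pd
    rw [fderiv_clm_apply (hd x) (differentiableAt_const _)]
    simp
  rw [key, key]
  exact (hf.contDiffAt.isSymmSndFDerivAt (by simp; norm_cast)) _ _

lemma lap3_pd {f : E3 → ℝ} (hf : ContDiff ℝ ∞ f) (i : Fin 3) : lap3 (pd f i) = pd (lap3 f) i := by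
  have : lap3 f = fun x => ∑ k, pd (pd f k) k x := rfl
  rw [this, pd_sum (fun l => pd_contDiff (pd_contDiff hf l) l)]
  ext x
  unfold lap3
  congr 1; ext k
  rw [pd_comm hf i k, pd_comm (pd_contDiff hf k) i k]

/-- vector field from components -/
def vec (v : Fin 3 → E3 → ℝ) (x : E3) : E3 := WithLp.toLp 2 (fun j => v j x)

lemma vec_contDiff {v : Fin 3 → E3 → ℝ} {n : WithTop ℕ∞} (hv : ∀ j, ContDiff ℝ n (v j)) : ContDiff ℝ n (vec v) := by
  rw [contDiff_euclidean]
  exact hv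

lemma fderiv_coord {u : E3 → E3} {x : E3} (hu : DifferentiableAt ℝ u x) (j : Fin 3) (e : E3) :
    fderiv ℝ (fun y => u y j) x e = fderiv ℝ u x e j := by
  have h := ((EuclideanSpace.proj (𝕜 := ℝ) j : E3 →L[ℝ] ℝ).hasFDerivAt.comp x hu.hasFDerivAt).fderiv
  have h2 : (fun y => u y j) = (EuclideanSpace.proj (𝕜 := ℝ) j : E3 →L[ℝ] ℝ) ∘ u := rfl
  rw [h2, h]; rfl

lemma fderiv_vec {v : Fin 3 → E3 → ℝ} (hv : ∀ j, ContDiff ℝ ∞ (v j)) (x : E3) (j k : Fin 3) :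
    fderiv ℝ (vec v) x (bv k) j = pd (v j) k x := by
  rw [← fderiv_coord ((vec_contDiff hv).differentiable (by simp) x)]
  rfl

lemma lame_biharm (lam mu : ℝ) (hmu : 0 < mu) (hlam : 0 < 3 * lam + 2 * mu) {V U : Set E3} {u : E3 → E3}
    (ha : ∀ v : E3 → E3, ContDiff ℝ ∞ v → HasCompactSupport v → tsupport v ⊆ U →
      ∫ x in V, bA lam mu (fderiv ℝ u x) (fderiv ℝ v x) = 0)
    (hb : ∀ g : E3 → ℝ, ContDiff ℝ ∞ g → HasCompactSupport g → tsupport g ⊆ U → ∀ j k,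
      IntegrableOn (fun x => fderiv ℝ u x (bv k) j * g x) V ∧
      IntegrableOn (fun x => u x j * g x) V ∧
      ∫ x in V, fderiv ℝ u x (bv k) j * g x = - ∫ x in V, u x j * pd g k x)
    (i : Fin 3) (φ : E3 → ℝ) (hφ : ContDiff ℝ ∞ φ) (hc : HasCompactSupport φ) (hs : tsupport φ ⊆ U) :
    ∫ x in V, u x i * lap3 (lap3 φ) x = 0 := by
  set v : Fin 3 → E3 → ℝ := fun j x =>
    ((lam + 2 * mu) * (if i = j then 1 else 0)) * lap3 φ x + (-(lam + mu)) * pd (pd φ i) j x with hv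
  have hvs : ∀ j, ContDiff ℝ ∞ (v j) := fun j =>
    (contDiff_const.mul (lap3_contDiff hφ)).add (contDiff_const.mul (pd_contDiff (pd_contDiff hφ i) j))
  have hvt : ∀ j, tsupport (v j) ⊆ tsupport φ := by
    intro j
    refine closure_minimal ?_ (isClosed_tsupport _)
    intro x hx
    by_contra h
    apply hx
    have h1 : lap3 φ x = 0 := image_eq_zero_of_notMem_tsupport (fun h' => h (tsupport_lap3 _ h'))
    have h2 : pd (pd φ i) j x = 0 :=
      image_eq_zero_of_notMem_tsupport (fun h' => h (tsupport_pd _ _ (tsupport_pd _ _ h')))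
    simp [hv, h1, h2]
  have hvt' : tsupport (vec v) ⊆ tsupport φ := by
    refine closure_minimal ?_ (isClosed_tsupport _)
    intro x hx
    by_contra h
    apply hx
    ext j
    exact image_eq_zero_of_notMem_tsupport (f := v j) (fun h' => h (hvt j h'))
  have hpv : ∀ j k, pd (v j) k = fun x => ((lam + 2 * mu) * (if i = j then 1 else 0)) * pd (lap3 φ) k x
      + (-(lam + mu)) * pd (pd (pd φ i) j) k x := fun j k =>
    pd_lin (lap3_contDiff hφ) (pd_contDiff (pd_contDiff hφ i) j) _ _ k
  have hdiv : (fun x => ∑ l, pd (v l) l x) = fun x => mu * pd (lap3 φ) i x := by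
    ext x
    simp only [hpv, Finset.sum_add_distrib, ← Finset.mul_sum]
    have : ∑ l, pd (pd (pd φ i) l) l x = pd (lap3 φ) i x := by
      rw [← lap3_pd hφ]; rfl
    rw [this]
    have h2 : ∑ l, (lam + 2 * mu) * (if i = l then (1:ℝ) else 0) * pd (lap3 φ) l x = (lam + 2 * mu) * pd (lap3 φ) i x := by
      simp
    rw [h2]; ring
  set σ : Fin 3 → Fin 3 → E3 → ℝ := fun j k x =>
    lam * (if j = k then mu * pd (lap3 φ) i x else 0) + mu * (pd (v j) k x + pd (v k) j x) with hσ
  have hσs : ∀ j k, ContDiff ℝ ∞ (σ j k) := by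
    intro j k
    refine ContDiff.add (contDiff_const.mul ?_) (contDiff_const.mul ((pd_contDiff (hvs j) k).add (pd_contDiff (hvs k) j)))
    split_ifs
    · exact contDiff_const.mul (pd_contDiff (lap3_contDiff hφ) i)
    · exact contDiff_const
  have hσt : ∀ j k, tsupport (σ j k) ⊆ tsupport φ := by
    intro j k
    refine closure_minimal ?_ (isClosed_tsupport _)
    intro x hx
    by_contra h
    apply hx
    have h1 : pd (lap3 φ) i x = 0 :=
      image_eq_zero_of_notMem_tsupport (fun h' => h (tsupport_lap3 _ (tsupport_pd _ _ h')))
    have h2 : ∀ a b, pd (v a) b x = 0 := fun a b =>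
      image_eq_zero_of_notMem_tsupport (fun h' => h (hvt a (tsupport_pd _ _ h')))
    simp [hσ, h1, h2]
  have hσc : ∀ j k, HasCompactSupport (σ j k) := fun j k => hc.of_isClosed_subset (isClosed_tsupport _) (hσt j k)
  have hdσ : ∀ j x, ∑ k, pd (σ j k) k x = if i = j then mu * (lam + 2 * mu) * lap3 (lap3 φ) x else 0 := by
    intro j x
    have e1 : ∀ k, pd (σ j k) k x = (if j = k then lam * mu * pd (pd (lap3 φ) i) k x else 0)
        + mu * (pd (pd (v j) k) k x + pd (pd (v k) k) j x) := by
      intro k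
      have e2 : σ j k = fun x => (lam * (if j = k then mu else 0)) * pd (lap3 φ) i x + mu *
          (fun x => 1 * pd (v j) k x + 1 * pd (v k) j x) x := by
        ext x; simp only [hσ]; split_ifs <;> ring
      rw [e2, pd_lin (pd_contDiff (lap3_contDiff hφ) i)
        ((contDiff_const.mul (pd_contDiff (hvs j) k)).add (contDiff_const.mul (pd_contDiff (hvs k) j))),
        pd_lin (pd_contDiff (hvs j) k) (pd_contDiff (hvs k) j), pd_comm (hvs k) j k]
      split_ifs <;> ring
    simp only [e1, Finset.sum_add_distrib, ← Finset.mul_sum, Finset.sum_ite_eq, Finset.mem_univ, if_true]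
    have e3 : ∑ k, pd (pd (v k) k) j x = mu * pd (pd (lap3 φ) i) j x := by
      have := congrFun (pd_sum (fun l => pd_contDiff (hvs l) l) j) x
      rw [← this, hdiv]
      have := congrFun (pd_lin (pd_contDiff (lap3_contDiff hφ) i) (pd_contDiff (lap3_contDiff hφ) i) mu 0 j) x
      simpa using this
    have e4 : ∑ k, pd (pd (v j) k) k x = ((lam + 2 * mu) * (if i = j then 1 else 0)) * lap3 (lap3 φ) x
      + (-(lam + mu)) * pd (pd (lap3 φ) i) j x := by
      have : ∑ k, pd (pd (v j) k) k x = lap3 (v j) x := rfl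
      rw [this, hv]
      have := lap3_lincomb (lap3_contDiff hφ) (pd_contDiff (pd_contDiff hφ i) j)
        ((lam + 2 * mu) * (if i = j then 1 else 0)) (-(lam + mu)) x
      rw [lap3_pd (pd_contDiff hφ i), lap3_pd hφ] at this
      exact this
    rw [e3, e4]
    split_ifs <;> ring
  have h0 := ha (vec v) (vec_contDiff hvs) (hc.of_isClosed_subset (isClosed_tsupport _) hvt') (hvt'.trans hs)
  have h1 : ∀ x, bA lam mu (fderiv ℝ u x) (fderiv ℝ (vec v) x) = ∑ j, ∑ k, fderiv ℝ u x (bv k) j * σ j k x := by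
    intro x
    rw [bA_stress]
    have ht : trc (fderiv ℝ (vec v) x) = mu * pd (lap3 φ) i x := by
      rw [← congrFun hdiv x]
      simp [trc, ent_apply, fderiv_vec hvs]
    simp only [ht, ent_apply, fderiv_vec hvs, hσ]
  simp only [h1] at h0
  have hB := fun j k => hb (σ j k) (hσs j k) (hσc j k) ((hσt j k).trans hs) j k
  have hB' := fun j k => hb (pd (σ j k) k) (pd_contDiff (hσs j k) k) (hcs_pd (hσc j k) k)
    ((tsupport_pd _ _).trans ((hσt j k).trans hs)) j k
  rw [integral_finsetSum _ (fun j _ => integrable_finsetSum _ fun k _ => (hB j k).1)] at h0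
  simp only [integral_finsetSum _ (fun k _ => (hB _ k).1), (hB _ _).2.2] at h0
  have h2 : ∀ j, ∑ k, - ∫ x in V, u x j * pd (σ j k) k x = - ∫ x in V, u x j * ∑ k, pd (σ j k) k x := by
    intro j
    rw [Finset.sum_neg_distrib, ← integral_finsetSum _ (fun k _ => (hB' j k).2.1)]
    simp [Finset.mul_sum]
  simp only [h2, hdσ] at h0
  rw [Finset.sum_eq_single i (by intro b _ hb; simp [Ne.symm hb]) (by simp)] at h0
  simp only [if_true] at h0
  have h3 : ∀ x, u x i * (mu * (lam + 2 * mu) * lap3 (lap3 φ) x) = (mu * (lam + 2 * mu)) * (u x i * lap3 (lap3 φ) x) := by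
    intro x; ring
  simp only [h3, integral_const_mul] at h0
  have : mu * (lam + 2 * mu) ≠ 0 := by
    have : 0 < lam + 2 * mu := by linarith
    positivity
  have h4 := neg_eq_zero.1 h0
  exact (mul_eq_zero.1 h4).resolve_left this

end

section
open Filter Topology
open scoped ContDiff

lemma unif_cont_cs {F : Type*} [NormedAddCommGroup F] {f : E3 → F} (hf : Continuous f)
    (hc : HasCompactSupport f) : UniformContinuous f :=
  hc.uniformContinuous_of_continuous hf

/-- mollification -/
def moll {F : Type*} [NormedAddCommGroup F] [NormedSpace ℝ F] (δ : ℝ) (hδ : 0 < δ) (f : E3 → F) : E3 → F :=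
  convolution ((mo δ hδ).normed volume) f (ContinuousLinearMap.lsmul ℝ ℝ) volume

section
set_option linter.unusedSectionVars false
variable {F : Type*} [NormedAddCommGroup F] [NormedSpace ℝ F] [CompleteSpace F] (δ : ℝ) (hδ : 0 < δ)

lemma moll_contDiff {f : E3 → F} (hf : LocallyIntegrable f) : ContDiff ℝ ∞ (moll δ hδ f) :=
  (mo δ hδ).hasCompactSupport_normed.contDiff_convolution_left _ (mo δ hδ).contDiff_normed hf

lemma moll_apply (f : E3 → F) (x : E3) : moll δ hδ f x = ∫ t, (mo δ hδ).normed volume t • f (x - t) := by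
  simp [moll, convolution]

lemma moll_dist {f : E3 → F} (hf : AEStronglyMeasurable f) {x : E3} {ε : ℝ}
    (h : ∀ y ∈ ball x δ, dist (f y) (f x) ≤ ε) : dist (moll δ hδ f x) (f x) ≤ ε :=
  (mo δ hδ).dist_normed_convolution_le hf h

lemma moll_eq {f : E3 → F} {x : E3} {c : F} (h : ∀ y ∈ ball x δ, f y = c) : moll δ hδ f x = c := by
  have h0 := h x (mem_ball_self hδ)
  rw [← h0]
  exact (mo δ hδ).normed_convolution_eq_right (μ := volume) (fun y hy => (h y hy).trans h0.symm)

lemma moll_fderiv {f : E3 → F} (hf : ContDiff ℝ 1 f) (hc : HasCompactSupport f) (x : E3) :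
    fderiv ℝ (moll δ hδ f) x = moll δ hδ (fderiv ℝ f) x := by
  have := hc.hasFDerivAt_convolution_right (ContinuousLinearMap.lsmul ℝ ℝ)
    ((mo δ hδ).contDiff_normed (μ := volume) (n := 0)).continuous.locallyIntegrable hf x (μ := volume)
  exact this.fderiv

lemma moll_lip {f : E3 → F} {K : NNReal} (hf : LipschitzWith K f) : LipschitzWith K (moll δ hδ f) := by
  refine LipschitzWith.of_dist_le_mul fun x y => ?_
  have hi : ∀ x, Integrable (fun t => (mo δ hδ).normed volume t • f (x - t)) := fun x =>
    ((mo δ hδ).hasCompactSupport_normed.convolutionExists_left (ContinuousLinearMap.lsmul ℝ ℝ)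
      (mo δ hδ).continuous_normed hf.continuous.locallyIntegrable) x
  rw [dist_eq_norm, moll_apply, moll_apply, ← integral_sub (hi x) (hi y)]
  have : ∀ t, ‖(mo δ hδ).normed volume t • f (x - t) - (mo δ hδ).normed volume t • f (y - t)‖
      ≤ (mo δ hδ).normed volume t * (K * dist x y) := by
    intro t
    rw [← smul_sub, norm_smul, Real.norm_of_nonneg ((mo δ hδ).nonneg_normed t)]
    have h1 := hf.dist_le_mul (x - t) (y - t)
    rw [dist_sub_right, dist_eq_norm] at h1
    exact mul_le_mul_of_nonneg_left h1 ((mo δ hδ).nonneg_normed t)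
  refine (norm_integral_le_of_norm_le ((mo δ hδ).integrable_normed.mul_const _) (Eventually.of_forall this)).trans ?_
  rw [integral_mul_const, (mo δ hδ).integral_normed, one_mul]

lemma moll_tsupport {f : E3 → F} : tsupport (moll δ hδ f) ⊆ cthickening δ (tsupport f) := by
  refine closure_minimal ?_ isClosed_cthickening
  intro x hx
  by_contra h
  apply hx
  refine moll_eq δ hδ fun y hy => ?_
  apply image_eq_zero_of_notMem_tsupport
  intro hy2
  apply h
  exact mem_cthickening_of_dist_le x y δ _ hy2 (by rw [dist_comm]; exact (mem_ball.1 hy).le)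
end

lemma approx_C1 {v : E3 → E3} (hv : ContDiff ℝ 1 v) (hc : HasCompactSupport v) {ε : ℝ} (hε : 0 < ε) :
    ∃ V : E3 → E3, ContDiff ℝ ∞ V ∧ tsupport V ⊆ cthickening ε (tsupport v) ∧
      ∀ x, ‖fderiv ℝ V x - fderiv ℝ v x‖ ≤ ε := by
  have hcont := hv.continuous_fderiv (by simp)
  obtain ⟨δ, hδ, h⟩ := Metric.uniformContinuous_iff.1 (unif_cont_cs hcont (hc.fderiv ℝ)) ε hε
  have hm : 0 < min δ ε := lt_min hδ hε
  refine ⟨moll (min δ ε) hm v, moll_contDiff _ _ hv.continuous.locallyIntegrable,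
    (moll_tsupport _ _).trans (cthickening_mono (min_le_right _ _) _), fun x => ?_⟩
  rw [moll_fderiv _ _ hv hc, ← dist_eq_norm]
  exact moll_dist _ _ hcont.aestronglyMeasurable fun y hy => (h (lt_of_lt_of_le hy (min_le_left _ _))).le

/-- Abstract local solution. -/
structure Sol (lam mu : ℝ) (Ω : Set E3) (w : E3 → E3) : Prop where
  op : IsOpen Ω
  sub : Ω ⊆ lowerHalf
  c1 : ContDiffOn ℝ 1 w Ω
  g2 : ∀ R, IntegrableOn (fun x => ‖fderiv ℝ w x‖ ^ 2) (Ω ∩ ball 0 R)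
  w2 : ∀ R, IntegrableOn (fun x => ‖w x‖ ^ 2) (Ω ∩ ball 0 R)
  wk : ∀ v : E3 → E3, ContDiff ℝ ∞ v → HasCompactSupport v → tsupport v ⊆ lowerHalf →
    ∫ x in Ω, bA lam mu (fderiv ℝ w x) (fderiv ℝ v x) = 0

lemma lowerHalf_open : IsOpen lowerHalf := by
  unfold lowerHalf; exact isOpen_lt (by fun_prop) continuous_const

lemma Sol.gcont {lam mu : ℝ} {Ω : Set E3} {w : E3 → E3} (h : Sol lam mu Ω w) : ContinuousOn (fderiv ℝ w) Ω :=
  h.c1.continuousOn_fderiv_of_isOpen h.op le_rfl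

lemma integrable_of_sq {F : Type*} [NormedAddCommGroup F] {f : E3 → F} {S : Set E3}
    (hS : volume S ≠ ⊤) (hm : AEStronglyMeasurable f (volume.restrict S))
    (h : IntegrableOn (fun x => ‖f x‖ ^ 2) S) : IntegrableOn f S := by
  have : IntegrableOn (fun x => 1 + ‖f x‖ ^ 2) S := (integrableOn_const hS).add h
  refine this.mono' hm (Eventually.of_forall fun x => ?_)
  nlinarith [sq_nonneg (‖f x‖ - 1)]

lemma vol_inter_ball (Ω : Set E3) (R : ℝ) : volume (Ω ∩ ball 0 R) ≠ ⊤ :=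
  ((measure_mono inter_subset_right).trans_lt measure_ball_lt_top).ne

lemma Sol.g1 {lam mu : ℝ} {Ω : Set E3} {w : E3 → E3} (h : Sol lam mu Ω w) (R : ℝ) :
    IntegrableOn (fderiv ℝ w) (Ω ∩ ball 0 R) :=
  integrable_of_sq (vol_inter_ball _ _) ((h.gcont.mono inter_subset_left).aestronglyMeasurable
    (h.op.inter isOpen_ball).measurableSet) (h.g2 R)

lemma Sol.w1 {lam mu : ℝ} {Ω : Set E3} {w : E3 → E3} (h : Sol lam mu Ω w) (R : ℝ) :
    IntegrableOn w (Ω ∩ ball 0 R) :=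
  integrable_of_sq (vol_inter_ball _ _) ((h.c1.continuousOn.mono inter_subset_left).aestronglyMeasurable
    (h.op.inter isOpen_ball).measurableSet) (h.w2 R)

lemma hcs_sub_ball {F : Type*} [NormedAddCommGroup F] {f : E3 → F} (hc : HasCompactSupport f) :
    ∃ R : ℝ, 0 < R ∧ tsupport f ⊆ ball 0 R := by
  obtain ⟨R, hR⟩ := hc.isBounded.subset_ball 0
  exact ⟨max R 1, by positivity, hR.trans (ball_subset_ball (le_max_left _ _))⟩

/-- products of a bounded-ball-integrable function with bounded functions vanishing outside a ball -/
lemma int_bA {lam mu : ℝ} {Ω : Set E3} (_hΩ : MeasurableSet Ω) {S T : E3 → ME} {R K : ℝ}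
    (hS : IntegrableOn S (Ω ∩ ball 0 R)) (hT : AEStronglyMeasurable T (volume.restrict Ω))
    (hK : ∀ x, ‖T x‖ ≤ K) (h0 : ∀ x ∉ ball (0 : E3) R, T x = 0) :
    IntegrableOn (fun x => bA lam mu (S x) (T x)) Ω := by
  have h1 : IntegrableOn (fun x => bA lam mu (S x) (T x)) (Ω ∩ ball 0 R) := by
    have hb : IntegrableOn (fun x => (‖bA lam mu‖ * K) * ‖S x‖) (Ω ∩ ball 0 R) := hS.norm.const_mul _
    refine hb.mono' ?_ (Eventually.of_forall fun x => ?_)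
    · have := hT.mono_measure (Measure.restrict_mono inter_subset_left le_rfl : volume.restrict (Ω ∩ ball 0 R) ≤ _)
      have h3 := hS.aestronglyMeasurable
      exact ((bA lam mu).aestronglyMeasurable_comp₂ h3 this)
    · refine ((bA lam mu).le_opNorm₂ _ _).trans ?_
      have := hK x
      have h2 : 0 ≤ ‖bA lam mu‖ * ‖S x‖ := by positivity
      nlinarith
  have : (fun x => bA lam mu (S x) (T x)) = (ball (0:E3) R).indicator (fun x => bA lam mu (S x) (T x)) := by
    ext x
    by_cases hx : x ∈ ball (0:E3) R
    · simp [indicator_of_mem hx]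
    · simp [indicator_of_notMem hx, h0 x hx]
  rw [this, IntegrableOn, integrable_indicator_iff measurableSet_ball, IntegrableOn, Measure.restrict_restrict measurableSet_ball]
  rw [inter_comm]; exact h1

lemma bdd_cs {F : Type*} [NormedAddCommGroup F] {f : E3 → F} (hf : Continuous f) (hc : HasCompactSupport f) :
    ∃ K : ℝ, 0 ≤ K ∧ ∀ x, ‖f x‖ ≤ K := by
  obtain ⟨K, hK⟩ := hc.exists_bound_of_continuous hf
  exact ⟨K, (norm_nonneg _).trans (hK 0), hK⟩

lemma Sol.int_test {lam mu : ℝ} {Ω : Set E3} {w : E3 → E3} (h : Sol lam mu Ω w) {V : Set E3} (hV : V ⊆ Ω)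
    (hVm : MeasurableSet V) {v : E3 → E3}
    (hv : ContDiff ℝ 1 v) (hc : HasCompactSupport v) :
    IntegrableOn (fun x => bA lam mu (fderiv ℝ w x) (fderiv ℝ v x)) V := by
  have hcont := hv.continuous_fderiv (by simp)
  obtain ⟨K, -, hK⟩ := bdd_cs hcont (hc.fderiv ℝ)
  obtain ⟨R, -, hR⟩ := hcs_sub_ball (hc.fderiv (𝕜 := ℝ))
  exact int_bA hVm ((h.g1 R).mono_set (inter_subset_inter_left _ hV)) hcont.aestronglyMeasurable hK
    (fun x hx => image_eq_zero_of_notMem_tsupport fun h' => hx (hR h'))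

/-- extension of a vanishing functional from smooth to `C¹` test fields. -/
lemma ext_C1 {lam mu : ℝ} {Ω : Set E3} {w : E3 → E3} (h : Sol lam mu Ω w) {V : Set E3} (hV : V ⊆ Ω)
    (hVm : MeasurableSet V) {U : Set E3} (hU : IsOpen U)
    (hwk : ∀ v : E3 → E3, ContDiff ℝ ∞ v → HasCompactSupport v → tsupport v ⊆ U →
      ∫ x in V, bA lam mu (fderiv ℝ w x) (fderiv ℝ v x) = 0)
    {v : E3 → E3} (hv : ContDiff ℝ 1 v) (hc : HasCompactSupport v) (hs : tsupport v ⊆ U) :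
    ∫ x in V, bA lam mu (fderiv ℝ w x) (fderiv ℝ v x) = 0 := by
  obtain ⟨δ, hδ, hδU⟩ := hc.exists_cthickening_subset_open hU hs
  obtain ⟨R, hR⟩ := (hc.isBounded.cthickening (δ := δ)).subset_ball 0
  set M := ‖bA lam mu‖ * ∫ x in Ω ∩ ball 0 R, ‖fderiv ℝ w x‖ with hM
  have key : ∀ ε, 0 < ε → ε ≤ δ → |∫ x in V, bA lam mu (fderiv ℝ w x) (fderiv ℝ v x)| ≤ M * ε := by
    intro ε hε hεδ
    obtain ⟨W, hW, hWs, hWd⟩ := approx_C1 hv hc hε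
    have hWs' : tsupport W ⊆ cthickening δ (tsupport v) := hWs.trans (cthickening_mono hεδ _)
    have hWc : HasCompactSupport W := (hc.cthickening (r := δ)).of_isClosed_subset (isClosed_tsupport _) hWs'
    have h0 := hwk W hW hWc (hWs'.trans hδU)
    have i1 := h.int_test hV hVm hv hc
    have i2 := h.int_test hV hVm (hW.of_le (by norm_cast)) hWc
    have : ∫ x in V, bA lam mu (fderiv ℝ w x) (fderiv ℝ v x)
        = ∫ x in V, bA lam mu (fderiv ℝ w x) (fderiv ℝ v x - fderiv ℝ W x) := by
      simp only [map_sub]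
      rw [integral_sub i1 i2, h0, sub_zero]
    rw [this]
    have hb : ∀ x, ‖bA lam mu (fderiv ℝ w x) (fderiv ℝ v x - fderiv ℝ W x)‖ ≤
        (ball (0:E3) R).indicator (fun x => (‖bA lam mu‖ * ε) * ‖fderiv ℝ w x‖) x := by
      intro x
      by_cases hx : x ∈ ball (0:E3) R
      · rw [indicator_of_mem hx]
        refine ((bA lam mu).le_opNorm₂ _ _).trans ?_
        have := hWd x
        rw [norm_sub_rev] at this
        have h2 : 0 ≤ ‖bA lam mu‖ * ‖fderiv ℝ w x‖ := by positivity
        nlinarith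
      · have e1 : fderiv ℝ v x = 0 := image_eq_zero_of_notMem_tsupport fun h' => hx (hR
          (self_subset_cthickening _ (tsupport_fderiv_subset ℝ h')))
        have e2 : fderiv ℝ W x = 0 := image_eq_zero_of_notMem_tsupport fun h' => hx (hR
          (hWs' (tsupport_fderiv_subset ℝ h')))
        simp [indicator_of_notMem hx, e1, e2]
    rw [← Real.norm_eq_abs]
    have hint : IntegrableOn (fun x => (‖bA lam mu‖ * ε) * ‖fderiv ℝ w x‖) (Ω ∩ ball 0 R) :=
      (h.g1 R).norm.const_mul _
    have hint2 : IntegrableOn (fun x => (‖bA lam mu‖ * ε) * ‖fderiv ℝ w x‖) (V ∩ ball 0 R) :=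
      hint.mono_set (inter_subset_inter_left _ hV)
    refine (norm_integral_le_of_norm_le ?_ (Eventually.of_forall hb)).trans ?_
    · rw [integrable_indicator_iff measurableSet_ball, IntegrableOn, Measure.restrict_restrict measurableSet_ball, inter_comm]
      exact hint2
    · rw [integral_indicator measurableSet_ball, Measure.restrict_restrict measurableSet_ball, inter_comm]
      refine (setIntegral_mono_set hint (Eventually.of_forall fun x => by positivity)
        (LE.le.eventuallyLE (inter_subset_inter_left _ hV))).trans ?_
      rw [integral_const_mul, hM]
      apply le_of_eq; ring
  have hM0 : 0 ≤ M := by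
    rw [hM]; exact mul_nonneg (norm_nonneg _) (integral_nonneg fun x => norm_nonneg _)
  by_contra hne
  have hpos := abs_pos.2 hne
  set A := |∫ x in V, bA lam mu (fderiv ℝ w x) (fderiv ℝ v x)|
  have h1 := key (min δ (A / (2 * (M + 1)))) (lt_min hδ (by positivity)) (min_le_left _ _)
  have h2 : M * min δ (A / (2 * (M + 1))) ≤ (M + 1) * (A / (2 * (M + 1))) := by
    gcongr
    · linarith
    · exact min_le_right _ _
  have h3 : (M + 1) * (A / (2 * (M + 1))) = A / 2 := by field_simp
  linarith

end

section
open Filter Topology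
open scoped ContDiff

lemma proj12_0 (x : E3) : proj12 x 0 = x 0 := by simp [proj12]
lemma proj12_1 (x : E3) : proj12 x 1 = x 1 := by simp [proj12]

lemma mp_split : MeasurePreserving (fun x : E3 => ((proj12 x, x 2) : E2 × ℝ)) volume (volume.prod volume) := by
  have h1 := EuclideanSpace.volume_preserving_symm_measurableEquiv_toLp (Fin 3)
  have h2 := volume_preserving_piFinSuccAbove (fun _ : Fin 3 => ℝ) (2 : Fin 3)
  have h3 := (MeasurePreserving.id (volume : Measure ℝ)).prod (EuclideanSpace.volume_preserving_symm_measurableEquiv_toLp (Fin 2)).symm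
  have h4 := (Measure.measurePreserving_swap (μ := (volume : Measure ℝ)) (ν := (volume : Measure E2)))
  have := h4.comp (h3.comp (h2.comp h1))
  refine (?_ : (fun x : E3 => ((proj12 x, x 2) : E2 × ℝ)) = _) ▸ this
  funext x
  refine Prod.ext ?_ rfl
  ext i
  fin_cases i
  · exact proj12_0 x
  · exact proj12_1 x

lemma vol_strip {A : Set E2} (hA : MeasurableSet A) {f : E2 → ℝ} (hf : Measurable f) (ε : ℝ) :
    volume {x : E3 | proj12 x ∈ A ∧ x 2 ∈ Ioo (f (proj12 x)) (f (proj12 x) + ε)} = ENNReal.ofReal ε * volume A := by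
  have hr := volume_regionBetween_eq_lintegral' (μ := (volume : Measure E2)) hf (hf.add_const ε) hA
  have hm : MeasurableSet (regionBetween f (fun x => f x + ε) A) :=
    measurableSet_regionBetween hf (hf.add_const ε) hA
  have := mp_split.measure_preimage hm.nullMeasurableSet
  have e : (fun x : E3 => ((proj12 x, x 2) : E2 × ℝ)) ⁻¹' (regionBetween f (fun x => f x + ε) A) =
    {x : E3 | proj12 x ∈ A ∧ x 2 ∈ Ioo (f (proj12 x)) (f (proj12 x) + ε)} := rfl
  rw [← e, this, hr]
  simp

lemma opn (T : ME) : ‖T‖ ^ 2 ≤ 3 * ∑ i, ∑ j, (T (bv j) i) ^ 2 := by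
  have h1 : ‖T‖ ≤ ∑ j, ‖T (bv j)‖ := by
    refine T.opNorm_le_bound (Finset.sum_nonneg fun _ _ => norm_nonneg _) fun x => ?_
    have hx : x = ∑ j, x j • bv j := by
      ext i; fin_cases i <;> simp [Fin.sum_univ_three, bv]
    conv_lhs => rw [hx]
    rw [map_sum, Finset.sum_mul]
    refine norm_sum_le_of_le _ fun j _ => ?_
    rw [map_smul, norm_smul, mul_comm]
    gcongr
    exact PiLp.norm_apply_le x j
  have h2 : ∀ j, ‖T (bv j)‖ ^ 2 = ∑ i, (T (bv j) i) ^ 2 := fun j => EuclideanSpace.real_norm_sq_eq _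
  rw [Finset.sum_comm]
  simp only [← h2]
  have h3 : (∑ j, ‖T (bv j)‖) ^ 2 ≤ 3 * ∑ j, ‖T (bv j)‖ ^ 2 := by
    have := sq_sum_le_card_mul_sum_sq (s := Finset.univ) (f := fun j : Fin 3 => ‖T (bv j)‖)
    simpa using this
  refine le_trans ?_ h3
  gcongr

lemma emb2_2 (x : E2) : emb2 x 2 = 0 := by simp [emb2]

lemma sol_of_norm {lam mu p : ℝ} {C : Set E3} {w : E3 → E3} (h : IsNormalizedSolution lam mu p C w) :
    Sol lam mu (lowerHalf \ closure C) w := by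
  obtain ⟨-, hc1, hw, hg, hwk⟩ := h
  set Ω := lowerHalf \ closure C
  set c := p / (3 * lam + 2 * mu)
  have hop : IsOpen Ω := lowerHalf_open.sdiff isClosed_closure
  have hgc : ContinuousOn (fderiv ℝ w) Ω := hc1.continuousOn_fderiv_of_isOpen hop le_rfl
  refine ⟨hop, sdiff_subset, hc1, fun R => ?_, fun R => ?_, fun v hv hvc hvs => ?_⟩
  · have h1 := (((hg.mono_set (inter_subset_left (t := ball 0 R))).const_mul 6)).add
      (integrableOn_const (C := 2 * c ^ 2) (vol_inter_ball Ω R))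
    refine h1.mono' (((hgc.mono inter_subset_left).norm.pow 2).aestronglyMeasurable
      (hop.inter isOpen_ball).measurableSet) (Eventually.of_forall fun x => ?_)
    have h2 := opn (fderiv ℝ w x + c • ContinuousLinearMap.id ℝ E3)
    have h3 : ∑ i, ∑ j, ((fderiv ℝ w x + c • ContinuousLinearMap.id ℝ E3) (bv j) i) ^ 2 =
        frob2 (fun i j => jac w x i j + c * (if i = j then 1 else 0)) := by
      simp [frob2, jac, bv]
    rw [h3] at h2
    have h4 : ‖fderiv ℝ w x‖ ≤ ‖fderiv ℝ w x + c • ContinuousLinearMap.id ℝ E3‖ + |c| := by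
      have := norm_sub_le (fderiv ℝ w x + c • ContinuousLinearMap.id ℝ E3) (c • ContinuousLinearMap.id ℝ E3)
      rw [add_sub_cancel_right, norm_smul, ContinuousLinearMap.norm_id] at this
      simpa using this
    rw [Real.norm_of_nonneg (by positivity)]
    simp only [Pi.add_apply]
    set a := ‖fderiv ℝ w x + c • ContinuousLinearMap.id ℝ E3‖
    have h5 : ‖fderiv ℝ w x‖ ^ 2 ≤ (a + |c|) ^ 2 := by gcongr
    have h6 := sq_abs c
    nlinarith [sq_nonneg (a - |c|)]
  · have h1 := (((hw.mono_set (inter_subset_left (t := ball 0 R))).const_mul (2 * (1 + R ^ 2)))).add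
      (integrableOn_const (C := 2 * (c ^ 2 * R ^ 2)) (vol_inter_ball Ω R))
    refine IntegrableOn.congr_fun_ae (f := fun x => (ball (0:E3) R).indicator (fun x => ‖w x‖ ^ 2) x) ?_ ?_
    · refine h1.mono' ?_ (Eventually.of_forall fun x => ?_)
      · refine AEStronglyMeasurable.indicator ?_ measurableSet_ball
        exact ((hc1.continuousOn.mono inter_subset_left).norm.pow 2).aestronglyMeasurable
          (hop.inter isOpen_ball).measurableSet
      · by_cases hx : x ∈ ball (0:E3) R
        · rw [indicator_of_mem hx]
          rw [mem_ball_zero_iff] at hx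
          rw [Real.norm_of_nonneg (by positivity)]
          simp only [Pi.add_apply]
          set a := ‖w x + c • x‖
          have h4 : ‖w x‖ ≤ a + |c| * ‖x‖ := by
            have := norm_sub_le (w x + c • x) (c • x)
            rw [add_sub_cancel_right, norm_smul] at this
            simpa using this
          have hx2 : ‖x‖ ^ 2 ≤ R ^ 2 := by gcongr
          have h5 : ‖w x‖ ^ 2 ≤ (a + |c| * ‖x‖) ^ 2 := by gcongr
          have h6 : (a + |c| * ‖x‖) ^ 2 ≤ 2 * a ^ 2 + 2 * (c ^ 2 * ‖x‖ ^ 2) := by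
            have := sq_abs c
            have h7 : (|c| * ‖x‖) ^ 2 = c ^ 2 * ‖x‖ ^ 2 := by rw [mul_pow, this]
            nlinarith [sq_nonneg (a - |c| * ‖x‖)]
          have h8 : a ^ 2 ≤ (1 + R ^ 2) * (a ^ 2 / (1 + ‖x‖ ^ 2)) := by
            rw [mul_div_assoc', le_div_iff₀ (by positivity)]
            nlinarith [sq_nonneg a]
          have h9 : c ^ 2 * ‖x‖ ^ 2 ≤ c ^ 2 * R ^ 2 := by gcongr
          linarith
        · rw [indicator_of_notMem hx]
          simp only [Pi.add_apply, norm_zero]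
          positivity
    · rw [Filter.EventuallyEq, ae_restrict_iff' (hop.inter isOpen_ball).measurableSet]
      exact Eventually.of_forall fun x hx => indicator_of_mem hx.2 _
  · have := hwk v hv hvc
    simp only [integrand_eq] at this
    rw [this]
    have h0 : ∀ x' : E2, v (emb2 x') 2 = 0 := by
      intro x'
      have : v (emb2 x') = 0 := by
        apply image_eq_zero_of_notMem_tsupport
        intro h
        have := hvs h
        simp [lowerHalf, emb2_2] at this
      simp [this]
    simp [h0]

lemma int_pd_zero {F : E3 → ℝ} (hF : ContDiff ℝ 1 F) (hc : HasCompactSupport F) (k : Fin 3) :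
    ∫ x, pd F k x = 0 := by
  have hcont : Continuous (pd F k) := (hF.continuous_fderiv (by simp)).clm_apply continuous_const
  have hi : Integrable (pd F k) := hcont.integrable_of_hasCompactSupport (hcs_pd hc k)
  have := integral_mul_fderiv_eq_neg_fderiv_mul_of_integrable (𝕜 := ℝ) (μ := (volume : Measure E3)) (f := fun _ => (1:ℝ)) (g := F) (v := bv k)
    (by simp) (by simp only [one_mul]; exact hi) (by simpa using hF.continuous.integrable_of_hasCompactSupport hc)
    (by fun_prop) (fun x _ => hF.differentiable (by simp) x)
  simpa [pd] using this

lemma c1_cut {F : Type*} [NormedAddCommGroup F] [NormedSpace ℝ F] {u : E3 → F} {Ω : Set E3} (hΩ : IsOpen Ω) (hu : ContDiffOn ℝ 1 u Ω)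
    {g : E3 → ℝ} (hg : ContDiff ℝ 1 g) (hs : tsupport g ⊆ Ω) : ContDiff ℝ 1 (fun x => g x • u x) := by
  rw [contDiff_iff_contDiffAt]
  intro x
  by_cases hx : x ∈ tsupport g
  · exact hg.contDiffAt.smul (hu.contDiffAt (hΩ.mem_nhds (hs hx)))
  · have : (fun x => g x • u x) =ᶠ[𝓝 x] fun _ => 0 := by
      filter_upwards [(isClosed_tsupport g).isOpen_compl.mem_nhds hx] with y hy
      simp [image_eq_zero_of_notMem_tsupport hy]
    exact contDiffAt_const.congr_of_eventuallyEq this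

lemma ibp_open {u : E3 → E3} {Ω : Set E3} (hΩ : IsOpen Ω) (hu : ContDiffOn ℝ 1 u Ω)
    {g : E3 → ℝ} (hg : ContDiff ℝ 1 g) (hc : HasCompactSupport g) (hs : tsupport g ⊆ Ω) (j k : Fin 3) :
    IntegrableOn (fun x => fderiv ℝ u x (bv k) j * g x) Ω ∧
      IntegrableOn (fun x => u x j * g x) Ω ∧
      ∫ x in Ω, fderiv ℝ u x (bv k) j * g x = - ∫ x in Ω, u x j * pd g k x := by
  have huj : ContDiffOn ℝ 1 (fun x => u x j) Ω := (contDiffOn_euclidean.1 hu) j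
  have hF := c1_cut hΩ huj hg hs
  set F : E3 → ℝ := fun x => g x • u x j with hFd
  have hFc : HasCompactSupport F := hc.smul_right
  have h0 := int_pd_zero hF hFc k
  have hgcont : ContinuousOn (fderiv ℝ u) Ω := hu.continuousOn_fderiv_of_isOpen hΩ le_rfl
  -- continuity of products
  have hcts : ∀ f : E3 → ℝ, ContinuousOn f Ω → ∀ g : E3 → ℝ, Continuous g → tsupport g ⊆ Ω → HasCompactSupport g →
      Integrable (fun x => f x * g x) := by
    intro f hf g hg hs hc
    have : Continuous (fun x => f x * g x) := by
      rw [continuous_iff_continuousAt]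
      intro x
      by_cases hx : x ∈ tsupport g
      · exact (hf.continuousAt (hΩ.mem_nhds (hs hx))).mul hg.continuousAt
      · have : (fun x => f x * g x) =ᶠ[𝓝 x] fun _ => 0 := by
          filter_upwards [(isClosed_tsupport g).isOpen_compl.mem_nhds hx] with y hy
          simp [image_eq_zero_of_notMem_tsupport hy]
        exact continuousAt_const.congr this.symm
    exact this.integrable_of_hasCompactSupport hc.mul_left
  have hpdg : Continuous (pd g k) := (hg.continuous_fderiv (by simp)).clm_apply continuous_const
  have i1 := hcts (fun x => fderiv ℝ u x (bv k) j) (by fun_prop) g hg.continuous hs hc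
  have i2 := hcts (fun x => u x j) huj.continuousOn g hg.continuous hs hc
  have i3 := hcts (fun x => u x j) huj.continuousOn (pd g k) hpdg ((tsupport_pd _ _).trans hs) (hcs_pd hc k)
  refine ⟨i1.integrableOn, i2.integrableOn, ?_⟩
  have e1 : ∀ f : E3 → ℝ, ∀ g : E3 → ℝ, tsupport g ⊆ Ω → ∫ x in Ω, f x * g x = ∫ x, f x * g x := by
    intro f g hs
    refine setIntegral_eq_integral_of_forall_compl_eq_zero fun x hx => ?_
    simp [image_eq_zero_of_notMem_tsupport (fun h => hx (hs h))]
  rw [e1 _ _ hs, e1 _ _ ((tsupport_pd _ _).trans hs)]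
  have e2 : ∀ x, pd F k x = fderiv ℝ u x (bv k) j * g x + u x j * pd g k x := by
    intro x
    by_cases hx : x ∈ tsupport g
    · have hd := (hu.contDiffAt (hΩ.mem_nhds (hs hx))).differentiableAt (by simp)
      have hdj := (huj.contDiffAt (hΩ.mem_nhds (hs hx))).differentiableAt (by simp)
      rw [← fderiv_coord hd]
      unfold pd
      rw [hFd, fderiv_fun_smul (hg.differentiable (by simp) x) hdj]
      simp; ring
    · have h1 : pd F k x = 0 := image_eq_zero_of_notMem_tsupport fun h =>
        hx (tsupport_smul_subset_left _ _ (tsupport_pd _ _ h))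
      have h2 : pd g k x = 0 := image_eq_zero_of_notMem_tsupport fun h => hx (tsupport_pd _ _ h)
      rw [h1, h2, image_eq_zero_of_notMem_tsupport hx]; simp
  simp only [e2] at h0
  rw [integral_add i1 i3] at h0
  linarith

lemma Sol.biharm {lam mu : ℝ} (hmu : 0 < mu) (hlam : 0 < 3 * lam + 2 * mu) {Ω : Set E3} {w : E3 → E3}
    (h : Sol lam mu Ω w) (i : Fin 3) (φ : E3 → ℝ) (hφ : ContDiff ℝ ∞ φ) (hc : HasCompactSupport φ)
    (hs : tsupport φ ⊆ Ω) : ∫ x in Ω, w x i * lap3 (lap3 φ) x = 0 :=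
  lame_biharm lam mu hmu hlam (U := Ω) (fun v hv hvc hvs => h.wk v hv hvc (hvs.trans h.sub))
    (fun g hg hgc hgs j k => ibp_open h.op h.c1 (hg.of_le (by norm_cast)) hgc hgs j k) i φ hφ hc hs

lemma supp_int {Ω : Set E3} (f : E3 → ℝ) {φ : E3 → ℝ} (hs : tsupport φ ⊆ Ω) :
    ∫ x, f x * lap3 (lap3 φ) x = ∫ x in Ω, f x * lap3 (lap3 φ) x := by
  symm
  refine setIntegral_eq_integral_of_forall_compl_eq_zero fun x hx => ?_
  have : lap3 (lap3 φ) x = 0 := image_eq_zero_of_notMem_tsupport fun h =>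
    hx (hs (tsupport_lap3 _ (tsupport_lap3 _ h)))
  simp [this]

lemma Sol.biharm_jac {lam mu : ℝ} (hmu : 0 < mu) (hlam : 0 < 3 * lam + 2 * mu) {Ω : Set E3} {w : E3 → E3}
    (h : Sol lam mu Ω w) (φ : E3 → ℝ) (hφ : ContDiff ℝ ∞ φ) (hc : HasCompactSupport φ)
    (hs : tsupport φ ⊆ Ω) : ∫ x, fderiv ℝ w x (bv 0) 0 * lap3 (lap3 φ) x = 0 := by
  rw [supp_int _ hs, (ibp_open h.op h.c1 ((lap3_contDiff (lap3_contDiff hφ)).of_le (by norm_cast))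
    (hcs_lap3 (hcs_lap3 hc)) (((tsupport_lap3 _).trans (tsupport_lap3 _)).trans hs) 0 0).2.2,
    ← lap3_pd (lap3_contDiff hφ), ← lap3_pd hφ, neg_eq_zero]
  exact h.biharm hmu hlam 0 _ (pd_contDiff hφ 0) (hcs_pd hc 0) ((tsupport_pd _ _).trans hs)

end

section
open Filter Topology
open scoped ContDiff

lemma cutoff {s : E3 → ℝ} {M : NNReal} (hs : LipschitzWith M s) {ε : ℝ} (hε : 0 < ε) :
    ∃ η : E3 → ℝ, ContDiff ℝ ∞ η ∧ (∀ x, 0 ≤ η x ∧ η x ≤ 1) ∧ (∀ x, s x ≤ ε / 4 → η x = 0) ∧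
      (∀ x, ε ≤ s x → η x = 1) ∧ (∀ x, ‖fderiv ℝ η x‖ ≤ 4 * M / ε) := by
  set f : E3 → ℝ := fun x => max 0 (min 1 ((s x - ε / 2) * (4 / ε))) with hf
  have hlip : LipschitzWith (M * (4 / ε).toNNReal) f := by
    have h1 : LipschitzWith (M * (4 / ε).toNNReal) (fun x => (s x - ε / 2) * (4 / ε)) := by
      refine LipschitzWith.of_dist_le_mul fun x y => ?_
      have := hs.dist_le_mul x y
      rw [Real.dist_eq] at this ⊢
      rw [← sub_mul, sub_sub_sub_cancel_right, abs_mul, abs_of_pos (by positivity : 0 < 4 / ε)]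
      rw [NNReal.coe_mul, Real.coe_toNNReal _ (by positivity)]
      have h4 : 0 < 4 / ε := by positivity
      nlinarith
    exact (h1.const_min 1).const_max 0
  set δ := ε / (4 * (M + 1)) with hδd
  have hδ : 0 < δ := by positivity
  have hMδ : M * δ ≤ ε / 4 := by
    rw [hδd, mul_div_assoc', div_le_div_iff₀ (by positivity) (by positivity)]
    have := M.coe_nonneg
    nlinarith
  have hsd : ∀ x, ∀ y ∈ ball x δ, |s y - s x| ≤ ε / 4 := by
    intro x y hy
    have := hs.dist_le_mul y x
    rw [Real.dist_eq] at this
    have h3 : M * dist y x ≤ M * δ := by gcongr; exact (mem_ball.1 hy).le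
    linarith
  have hdist : ∀ x, 0 ≤ moll δ hδ f x ∧ moll δ hδ f x ≤ 1 := by
    intro x
    rw [moll_apply]
    have hb : ∀ y, 0 ≤ f y ∧ f y ≤ 1 := fun y => ⟨le_max_left _ _, max_le zero_le_one (min_le_left _ _)⟩
    have hn := (mo δ hδ).nonneg_normed (μ := volume)
    refine ⟨integral_nonneg fun t => mul_nonneg (hn t) (hb _).1, ?_⟩
    rw [← (mo δ hδ).integral_normed (μ := volume)]
    refine integral_mono_of_nonneg (Eventually.of_forall fun t => mul_nonneg (hn t) (hb _).1)
      (mo δ hδ).integrable_normed (Eventually.of_forall fun t => ?_)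
    exact mul_le_of_le_one_right (hn t) (hb _).2
  refine ⟨moll δ hδ f, moll_contDiff _ _ hlip.continuous.locallyIntegrable, hdist, ?_, ?_, ?_⟩
  · intro x hx
    refine moll_eq δ hδ fun y hy => ?_
    have := (abs_le.1 (hsd x y hy)).2
    refine max_eq_left (min_le_of_right_le (mul_nonpos_of_nonpos_of_nonneg (by linarith) (by positivity)))
  · intro x hx
    refine moll_eq δ hδ fun y hy => ?_
    have := (abs_le.1 (hsd x y hy)).1
    have h1 : 1 ≤ (s y - ε / 2) * (4 / ε) := by
      rw [mul_div_assoc', le_div_iff₀ hε]; linarith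
    simp [hf, min_eq_left h1]
  · intro x
    refine (norm_fderiv_le_of_lipschitz ℝ (moll_lip δ hδ hlip)).trans ?_
    rw [NNReal.coe_mul, Real.coe_toNNReal _ (by positivity)]
    apply le_of_eq; ring

lemma coord_lip (k : Fin 3) : LipschitzWith 1 (fun x : E3 => - x k) := by
  refine LipschitzWith.of_dist_le_mul fun x y => ?_
  rw [Real.dist_eq, dist_eq_norm]
  have := PiLp.norm_apply_le (x - y) k
  simp only [PiLp.sub_apply, Real.norm_eq_abs] at this
  rw [neg_sub_neg, abs_sub_comm]
  simpa using this

lemma vol_flat (r ε : ℝ) (hε : 0 < ε) :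
    volume.real {x : E3 | x ∈ ball 0 r ∧ -ε < x 2 ∧ x 2 < 0} ≤ ε * volume.real (ball (0 : E2) r) := by
  have h := vol_strip (A := ball (0 : E2) r) measurableSet_ball (f := fun _ => -ε) measurable_const ε
  have hsub : {x : E3 | x ∈ ball 0 r ∧ -ε < x 2 ∧ x 2 < 0} ⊆
      {x : E3 | proj12 x ∈ ball (0 : E2) r ∧ x 2 ∈ Ioo (-ε) (-ε + ε)} := by
    rintro x ⟨h1, h2, h3⟩
    refine ⟨?_, h2, by simpa using h3⟩
    rw [mem_ball_zero_iff] at h1 ⊢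
    refine lt_of_le_of_lt ?_ h1
    rw [← sq_le_sq₀ (norm_nonneg _) (norm_nonneg _), EuclideanSpace.real_norm_sq_eq, EuclideanSpace.real_norm_sq_eq,
      Fin.sum_univ_two, Fin.sum_univ_three, proj12_0, proj12_1]
    nlinarith [sq_nonneg (x 2)]
  have h2 := (measure_mono hsub).trans h.le
  have := ENNReal.toReal_mono (ENNReal.mul_ne_top ENNReal.ofReal_ne_top measure_ball_lt_top.ne) h2
  rw [ENNReal.toReal_mul, ENNReal.toReal_ofReal hε.le] at this
  exact this

lemma ibp_flat {u : E3 → E3} {r : ℝ} (hu : ContDiffOn ℝ 1 u (lowerHalf ∩ ball 0 r))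
    (hc : ContinuousOn u ({x | x 2 ≤ 0} ∩ ball 0 r)) (h0 : ∀ x ∈ ball (0 : E3) r, x 2 = 0 → u x = 0)
    (hg1 : IntegrableOn (fderiv ℝ u) (lowerHalf ∩ ball 0 r))
    {g : E3 → ℝ} (hg : ContDiff ℝ 1 g) (hgc : HasCompactSupport g) (hgs : tsupport g ⊆ ball 0 r) (j k : Fin 3) :
    IntegrableOn (fun x => fderiv ℝ u x (bv k) j * g x) (lowerHalf ∩ ball 0 r) ∧
      IntegrableOn (fun x => u x j * g x) (lowerHalf ∩ ball 0 r) ∧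
      ∫ x in lowerHalf ∩ ball 0 r, fderiv ℝ u x (bv k) j * g x
        = - ∫ x in lowerHalf ∩ ball 0 r, u x j * pd g k x := by
  set V := lowerHalf ∩ ball (0 : E3) r with hV
  have hVo : IsOpen V := lowerHalf_open.inter isOpen_ball
  have hVm := hVo.measurableSet
  have hVfin : volume V ≠ ⊤ := vol_inter_ball _ _
  have huj : ContinuousOn (fun x => u x j) ({x | x 2 ≤ 0} ∩ ball 0 r) := by fun_prop
  have hVsub : V ⊆ {x | x 2 ≤ 0} ∩ ball 0 r := fun x hx => ⟨le_of_lt (show x 2 < 0 from hx.1), hx.2⟩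
  have hclosed : IsClosed {x : E3 | x 2 ≤ 0} := isClosed_le (by fun_prop) continuous_const
  -- integrability of u_j * g
  have hint : ∀ g : E3 → ℝ, Continuous g → HasCompactSupport g → tsupport g ⊆ ball 0 r →
      IntegrableOn (fun x => u x j * g x) V := by
    intro g hg hgc hgs
    set K := {x : E3 | x 2 ≤ 0} ∩ tsupport g
    have hK : IsCompact K := hgc.inter_left hclosed
    have h1 : IntegrableOn (fun x => u x j * g x) K :=
      ((huj.mono (inter_subset_inter_right _ hgs)).mul hg.continuousOn).integrableOn_compact hK
    refine IntegrableOn.of_forall_sdiff_eq_zero h1 hVm fun x hx => ?_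
    have : x ∉ tsupport g := fun h => hx.2 ⟨le_of_lt (show x 2 < 0 from hx.1.1), h⟩
    simp [image_eq_zero_of_notMem_tsupport this]
  have hint1 : IntegrableOn (fun x => fderiv ℝ u x (bv k) j) V :=
    (ent j k).integrable_comp hg1
  obtain ⟨B, hB0, hB⟩ := bdd_cs hg.continuous hgc
  have hint2 : IntegrableOn (fun x => fderiv ℝ u x (bv k) j * g x) V :=
    hint1.mul_bdd (c := B) hg.continuous.aestronglyMeasurable (Eventually.of_forall hB)
  have hpdg : Continuous (pd g k) := (hg.continuous_fderiv (by simp)).clm_apply continuous_const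
  have hint3 := hint (pd g k) hpdg (hcs_pd hgc k) ((tsupport_pd _ _).trans hgs)
  refine ⟨hint2, hint g hg.continuous hgc hgs, ?_⟩
  have hεn : ∀ n : ℕ, 0 < 1 / ((n : ℝ) + 1) := fun n => by positivity
  choose η hη1 hη2 hη3 hη4 hη5 using fun n : ℕ => cutoff (coord_lip 2) (hεn n)
  have hdom : ∀ f : E3 → ℝ, IntegrableOn f V →
      Tendsto (fun n => ∫ x in V, f x * η n x) atTop (𝓝 (∫ x in V, f x)) := by
    intro f hf
    refine tendsto_integral_of_dominated_convergence (fun x => ‖f x‖) (fun n =>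
      hf.aestronglyMeasurable.mul (hη1 n).continuous.aestronglyMeasurable) hf.norm (fun n => Eventually.of_forall fun x => ?_) ?_
    · rw [norm_mul, Real.norm_of_nonneg (hη2 n x).1]
      exact mul_le_of_le_one_right (norm_nonneg _) (hη2 n x).2
    · rw [ae_restrict_iff' hVm]
      refine Eventually.of_forall fun x hx => ?_
      have hx2 : 0 < - x 2 := by have : x 2 < 0 := hx.1; linarith
      refine tendsto_const_nhds.congr' ?_
      filter_upwards [(tendsto_one_div_add_atTop_nhds_zero_nat (𝕜 := ℝ)).eventually_lt_const hx2] with n hn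
      rw [hη4 n x hn.le, mul_one]
  have hts : ∀ n, tsupport (fun x => η n x * g x) ⊆ V := by
    intro n x hx
    have h1 : x ∈ tsupport g := tsupport_smul_subset_right (η n) g hx
    refine ⟨?_, hgs h1⟩
    have h2 : tsupport (fun x => η n x * g x) ⊆ {x | 1 / ((n : ℝ) + 1) / 4 ≤ - x 2} := by
      refine closure_minimal ?_ (isClosed_le continuous_const (by fun_prop))
      intro y hy
      by_contra h
      apply hy
      have h : - y 2 < 1 / ((n : ℝ) + 1) / 4 := lt_of_not_ge h
      simp [hη3 n y h.le]
    have h3 : 1 / ((n : ℝ) + 1) / 4 ≤ - x 2 := h2 hx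
    have := hεn n
    change x 2 < 0
    linarith
  have hmain : ∀ n, ∫ x in V, (fderiv ℝ u x (bv k) j * g x) * η n x
      = (- ∫ x in V, (u x j * pd g k x) * η n x) - ∫ x in V, u x j * (g x * pd (η n) k x) := by
    intro n
    have hηC : ContDiff ℝ 1 (η n) := (hη1 n).of_le (by norm_cast)
    have := (ibp_open hVo hu (hηC.mul hg) hgc.mul_left (hts n) j k).2.2
    have e1 : ∀ x, pd (fun x => η n x * g x) k x = pd g k x * η n x + g x * pd (η n) k x := by
      intro x
      unfold pd
      rw [fderiv_fun_mul (hηC.differentiable (by simp) x) (hg.differentiable (by simp) x)]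
      simp; ring
    simp only [e1] at this
    have e2 : ∀ x, u x j * (pd g k x * η n x + g x * pd (η n) k x) = (u x j * pd g k x) * η n x + u x j * (g x * pd (η n) k x) := by
      intro x; ring
    have hpdη : Continuous (pd (η n) k) := (hηC.continuous_fderiv (by simp)).clm_apply continuous_const
    have i1 : IntegrableOn (fun x => (u x j * pd g k x) * η n x) V :=
      hint3.mul_bdd (c := 1) (hη1 n).continuous.aestronglyMeasurable
        (Eventually.of_forall fun x => by rw [Real.norm_of_nonneg (hη2 n x).1]; exact (hη2 n x).2)
    have i2 := hint (fun x => g x * pd (η n) k x) (hg.continuous.mul hpdη) hgc.mul_right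
      ((tsupport_smul_subset_left g _).trans hgs)
    simp only [e2] at this
    rw [integral_add i1 i2] at this
    rw [neg_add, ← sub_eq_add_neg] at this
    rw [← this]
    congr 1; ext x; ring
  have hlim3 : Tendsto (fun n => ∫ x in V, u x j * (g x * pd (η n) k x)) atTop (𝓝 0) := by
    rw [Metric.tendsto_atTop]
    intro ε hε
    set A := 4 * volume.real (ball (0 : E2) r) with hA
    have hA0 : 0 ≤ A := by positivity
    set ε' := ε / (2 * (A + 1)) with hε'
    have hε'0 : 0 < ε' := by positivity
    set K := ({x : E3 | x 2 ≤ 0} ∩ tsupport g) with hKd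
    have hK : IsCompact K := hgc.inter_left hclosed
    have hcK : ContinuousOn (fun x => |u x j * g x|) K :=
      (((huj.mono (inter_subset_inter_right _ hgs)).mul hg.continuous.continuousOn)).abs
    have hK' : IsCompact (K ∩ (fun x => |u x j * g x|) ⁻¹' Ici ε') :=
      hK.of_isClosed_subset (hcK.preimage_isClosed_of_isClosed hK.isClosed isClosed_Ici) inter_subset_left
    obtain ⟨m, hm, hmK⟩ : ∃ m > 0, ∀ x ∈ K, - x 2 < m → |u x j * g x| < ε' := by
      rcases (K ∩ (fun x => |u x j * g x|) ⁻¹' Ici ε').eq_empty_or_nonempty with he | hne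
      · refine ⟨1, one_pos, fun x hx _ => ?_⟩
        by_contra h
        have : x ∈ K ∩ (fun x => |u x j * g x|) ⁻¹' Ici ε' := ⟨hx, not_lt.1 h⟩
        rw [he] at this; exact this
      · obtain ⟨y, hy, hmin⟩ := hK'.exists_isMinOn hne (f := fun x : E3 => - x 2) (by fun_prop)
        have hy2 : y 2 ≤ 0 := hy.1.1
        refine ⟨- y 2, ?_, fun x hx hxm => ?_⟩
        · rcases hy2.lt_or_eq with h | h
          · simpa using h
          · exfalso
            have := hy.2
            simp [h0 y (hgs hy.1.2) h] at this
            linarith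
        · by_contra h
          have := hmin (⟨hx, not_lt.1 h⟩ : x ∈ K ∩ (fun x => |u x j * g x|) ⁻¹' Ici ε')
          have : - y 2 ≤ - x 2 := this
          linarith
    obtain ⟨N, hN⟩ := eventually_atTop.1 ((tendsto_one_div_add_atTop_nhds_zero_nat (𝕜 := ℝ)).eventually_lt_const hm)
    refine ⟨N, fun n hn => ?_⟩
    have hn := hN n hn
    set d := 1 / ((n : ℝ) + 1) with hd
    have hd0 : 0 < d := hεn n
    set S := {x : E3 | x ∈ ball 0 r ∧ -d < x 2 ∧ x 2 < 0} with hS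
    have hSm : MeasurableSet S := by
      refine MeasurableSet.inter measurableSet_ball (MeasurableSet.inter ?_ ?_)
      · exact (isOpen_lt continuous_const (by fun_prop : Continuous fun x : E3 => x 2)).measurableSet
      · exact (isOpen_lt (by fun_prop : Continuous fun x : E3 => x 2) continuous_const).measurableSet
    have hb : ∀ x ∈ V, ‖u x j * (g x * pd (η n) k x)‖ ≤ S.indicator (fun _ => ε' * (4 / d)) x := by
      intro x hx
      have hp : |pd (η n) k x| ≤ 4 / d := by
        have h1 := hη5 n x
        have h2 := (fderiv ℝ (η n) x).le_opNorm (bv k)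
        simp only [NNReal.coe_one, mul_one] at h1
        rw [show ‖bv k‖ = 1 by simp [bv], mul_one] at h2
        exact h2.trans h1
      by_cases hxS : x ∈ S
      · rw [indicator_of_mem hxS, ← mul_assoc, norm_mul]
        by_cases hxg : x ∈ tsupport g
        · have h3 := hmK x ⟨le_of_lt (show x 2 < 0 from hx.1), hxg⟩ (by have := hxS.2.1; linarith)
          gcongr
          · exact h3.le
          · exact hp
        · rw [image_eq_zero_of_notMem_tsupport hxg]; simp; positivity
      · rw [indicator_of_notMem hxS]
        have hx1 : x 2 < 0 := hx.1
        have h3 : x 2 ≤ -d := by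
          by_contra h
          exact hxS ⟨hx.2, by linarith, hx1⟩
        have hz : pd (η n) k x = 0 := by
          have hmx : IsLocalMax (η n) x := Eventually.of_forall fun y => by
            rw [hη4 n x (by rw [← hd]; linarith)]; exact (hη2 n y).2
          unfold pd; rw [hmx.fderiv_eq_zero]; simp
        simp [hz]
    rw [dist_zero_right]
    have hVS : volume S < ⊤ := lt_of_le_of_lt (measure_mono fun x hx => hx.1) (measure_ball_lt_top (x := (0:E3)) (r := r))
    calc ‖∫ x in V, u x j * (g x * pd (η n) k x)‖ ≤ ∫ x in V, S.indicator (fun _ => ε' * (4 / d)) x := by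
          refine norm_integral_le_of_norm_le ?_ ?_
          · exact (integrable_indicator_iff hSm).2 (integrableOn_const (by
              rw [Measure.restrict_apply hSm]; exact ((measure_mono inter_subset_left).trans_lt hVS).ne))
          · rw [ae_restrict_iff' hVm]; exact Eventually.of_forall hb
      _ ≤ ∫ x, S.indicator (fun _ => ε' * (4 / d)) x := by
          refine setIntegral_le_integral ((integrable_indicator_iff hSm).2 (integrableOn_const hVS.ne)) ?_
          exact Eventually.of_forall fun x => indicator_nonneg (fun _ _ => by positivity) x
      _ = volume.real S * (ε' * (4 / d)) := by
          rw [integral_indicator hSm]; simp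
      _ ≤ (d * volume.real (ball (0 : E2) r)) * (ε' * (4 / d)) := by
          gcongr; exact vol_flat r d hd0
      _ = A * ε' := by rw [hA]; field_simp
      _ < ε := by
          rw [hε', mul_div_assoc', div_lt_iff₀ (by positivity)]
          nlinarith
  have hl := hdom _ hint2
  have hr := ((hdom _ hint3).neg).sub hlim3
  rw [sub_zero] at hr
  exact tendsto_nhds_unique hl (hr.congr fun n => (hmain n).symm)

end

section
open Filter Topology
open scoped ContDiff

lemma fd_zero {v : E3 → E3} {x : E3} (hx : x ∉ tsupport v) : fderiv ℝ v x = 0 :=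
  image_eq_zero_of_notMem_tsupport fun h => hx (tsupport_fderiv_subset ℝ h)

lemma bint_restrict {lam mu : ℝ} {A B : Set E3} {w v : E3 → E3} (hA : MeasurableSet A) (hB : B ⊆ A)
    (h : ∀ x ∈ A, x ∈ tsupport v → x ∈ B) :
    ∫ x in A, bA lam mu (fderiv ℝ w x) (fderiv ℝ v x) = ∫ x in B, bA lam mu (fderiv ℝ w x) (fderiv ℝ v x) := by
  refine setIntegral_eq_of_subset_of_forall_sdiff_eq_zero hA hB fun x hx => ?_
  rw [fd_zero fun h' => hx.2 (h x hx.1 h')]; simp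

lemma strip_eq {lam mu p s₀ : ℝ} (hmu : 0 < mu) (hlam : 0 < 3*lam + 2*mu) (hs₀ : 0 < s₀)
    {C₁ C₂ : Set E3} {w₁ w₂ : E3 → E3}
    (hw₁ : IsNormalizedSolution lam mu p C₁ w₁) (hw₂ : IsNormalizedSolution lam mu p C₂ w₂)
    (hC₁ : ∀ x ∈ closure C₁, x ∉ ball (0 : E3) s₀) (hC₂ : ∀ x ∈ closure C₂, x ∉ ball (0 : E3) s₀)
    (heq : ∀ x' : E2, ‖x'‖ < s₀ → w₁ (emb2 x') = w₂ (emb2 x')) :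
    ∀ x ∈ lowerHalf ∩ ball 0 s₀, w₁ x = w₂ x := by
  set V := lowerHalf ∩ ball (0 : E3) s₀ with hV
  have hVo : IsOpen V := lowerHalf_open.inter isOpen_ball
  have hVm := hVo.measurableSet
  have S₁ := sol_of_norm hw₁
  have S₂ := sol_of_norm hw₂
  have hV₁ : V ⊆ lowerHalf \ closure C₁ := fun x hx => ⟨hx.1, fun h => hC₁ x h hx.2⟩
  have hV₂ : V ⊆ lowerHalf \ closure C₂ := fun x hx => ⟨hx.1, fun h => hC₂ x h hx.2⟩
  set u := fun x => w₁ x - w₂ x with hu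
  have hd : ∀ x ∈ V, fderiv ℝ u x = fderiv ℝ w₁ x - fderiv ℝ w₂ x := fun x hx =>
    fderiv_fun_sub ((S₁.c1.differentiableOn (by simp)).differentiableAt (S₁.op.mem_nhds (hV₁ hx)))
      ((S₂.c1.differentiableOn (by simp)).differentiableAt (S₂.op.mem_nhds (hV₂ hx)))
  have huc : ContinuousOn u ({x | x 2 ≤ 0} ∩ ball 0 s₀) :=
    (hw₁.1.mono fun x hx => ⟨hx.1, fun h => hC₁ x h hx.2⟩).sub
      (hw₂.1.mono fun x hx => ⟨hx.1, fun h => hC₂ x h hx.2⟩)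
  have hu0 : ∀ x ∈ ball (0 : E3) s₀, x 2 = 0 → u x = 0 := by
    intro x hx hx2
    have he : emb2 (proj12 x) = x := by
      ext i
      fin_cases i <;> simp [emb2, proj12, hx2]
    have hn : ‖proj12 x‖ < s₀ := by
      rw [mem_ball_zero_iff] at hx
      refine lt_of_le_of_lt ?_ hx
      rw [← sq_le_sq₀ (norm_nonneg _) (norm_nonneg _), EuclideanSpace.real_norm_sq_eq, EuclideanSpace.real_norm_sq_eq,
        Fin.sum_univ_two, Fin.sum_univ_three, proj12_0, proj12_1]
      nlinarith [sq_nonneg (x 2)]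
    have := heq _ hn
    rw [he] at this
    simp [hu, this]
  have hbih := fun i φ (hφ : ContDiff ℝ ∞ φ) hc hs =>
    lame_biharm lam mu hmu hlam (V := V) (U := ball 0 s₀) (u := u) (by
      intro v hv hc hs
      have h1 := hw₁.2.2.2.2 v hv hc
      have h2 := hw₂.2.2.2.2 v hv hc
      simp only [integrand_eq] at h1 h2
      rw [bint_restrict S₁.op.measurableSet hV₁ fun x hx hxs => ⟨hx.1, hs hxs⟩] at h1
      rw [bint_restrict S₂.op.measurableSet hV₂ fun x hx hxs => ⟨hx.1, hs hxs⟩] at h2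
      have hv1 : ContDiff ℝ 1 v := hv.of_le (by norm_cast)
      have h3 := integral_sub (S₁.int_test hV₁ hVm hv1 hc) (S₂.int_test hV₂ hVm hv1 hc)
      rw [h1, h2, sub_self] at h3
      rw [← h3]
      refine setIntegral_congr_fun hVm fun x hx => ?_
      simp only [hd x hx, map_sub, sub_apply])
    (by
      intro g hg hgc hgs j k
      refine ibp_flat ((S₁.c1.mono hV₁).sub (S₂.c1.mono hV₂)) huc hu0 ?_ (hg.of_le (by norm_cast)) hgc hgs j k
      have := ((S₁.g1 s₀).mono_set (subset_inter hV₁ inter_subset_right)).sub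
        ((S₂.g1 s₀).mono_set (subset_inter hV₂ inter_subset_right))
      refine (this.congr ?_)
      rw [Filter.EventuallyEq, ae_restrict_iff' hVm]
      exact Eventually.of_forall fun x hx => (hd x hx).symm) i φ hφ hc hs
  intro x hx
  rw [← sub_eq_zero]
  change u x = 0
  ext i
  set U : E3 → ℝ := fun x => V.indicator (fun x => u x i) x with hU
  have hUc : ContinuousOn U (ball 0 s₀) := by
    have h1 : ContinuousOn (fun x => u x i) ({x | x 2 ≤ 0} ∩ ball 0 s₀) := by fun_prop
    have hpc : ContinuousOn (({x : E3 | x 2 ≤ 0}).piecewise (fun x => u x i) (fun _ => 0)) (ball 0 s₀) := by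
      have hcl : IsClosed {x : E3 | x 2 ≤ 0} := isClosed_le (by fun_prop) continuous_const
      refine ContinuousOn.piecewise ?_ ?_ continuousOn_const
      · rintro a ⟨ha, haf⟩
        have h2 : a 2 = 0 := frontier_le_subset_eq (f := fun x : E3 => x 2) (g := fun _ => (0:ℝ)) (by fun_prop) continuous_const haf
        simp [hu0 a ha h2]
      · rw [hcl.closure_eq, inter_comm]; exact h1
    refine hpc.congr fun y hy => ?_
    simp only [hU, piecewise]
    by_cases h : y ∈ V
    · rw [indicator_of_mem h, if_pos (show y ∈ {x : E3 | x 2 ≤ 0} from le_of_lt (show y 2 < 0 from h.1))]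
    · rw [indicator_of_notMem h]
      split_ifs with h2
      · have h2 : y 2 ≤ 0 := h2
        have h3 : y 2 = 0 := le_antisymm h2 (not_lt.1 fun h3 => h ⟨h3, hy⟩)
        simp [hu0 y hy h3]
      · rfl
  have key := uc_conn (u := U) isOpen_ball (convex_ball (0:E3) s₀).isPreconnected hUc (fun φ hφ hc hs => by
    have := hbih i φ hφ hc hs
    rw [← integral_indicator hVm] at this
    rw [← this]
    congr 1; ext y
    by_cases h : y ∈ V <;> simp [hU, h]) (z := EuclideanSpace.single 2 (s₀ / 2)) (by
      simp [abs_of_pos hs₀]; linarith) (by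
      have ho : IsOpen {x : E3 | 0 < x 2} := isOpen_lt continuous_const (by fun_prop)
      filter_upwards [ho.mem_nhds (show 0 < (EuclideanSpace.single 2 (s₀ / 2) : E3) 2 by simp [hs₀])] with y hy
      have : y ∉ V := fun h => absurd (show y 2 < 0 from h.1) (not_lt.2 (le_of_lt hy))
      simp [hU, this]) x hx.2
  have := key.self_of_nhds
  simpa [hU, hx] using this

end

section
open Filter Topology
open scoped ContDiff

lemma uc_sol {lam mu : ℝ} (hmu : 0 < mu) (hlam : 0 < 3*lam + 2*mu) {Ω₁ Ω₂ W : Set E3} {w₁ w₂ : E3 → E3}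
    (S₁ : Sol lam mu Ω₁ w₁) (S₂ : Sol lam mu Ω₂ w₂) (hW : IsOpen W) (hWc : IsPreconnected W)
    (hW₁ : W ⊆ Ω₁) (hW₂ : W ⊆ Ω₂) {z : E3} (hz : z ∈ W) (hzz : w₁ =ᶠ[𝓝 z] w₂) :
    ∀ x ∈ W, w₁ =ᶠ[𝓝 x] w₂ := by
  have key : ∀ i : Fin 3, ∀ x ∈ W, (fun x => w₁ x i - w₂ x i) =ᶠ[𝓝 x] 0 := by
    intro i
    have c1 : ContinuousOn (fun x => w₁ x i) W := by
      have := S₁.c1.continuousOn.mono hW₁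
      fun_prop
    have c2 : ContinuousOn (fun x => w₂ x i) W := by
      have := S₂.c1.continuousOn.mono hW₂
      fun_prop
    refine uc_conn hW hWc (c1.sub c2) (fun φ hφ hc hs => ?_) hz ?_
    · have e1 := S₁.biharm hmu hlam i φ hφ hc (hs.trans hW₁)
      have e2 := S₂.biharm hmu hlam i φ hφ hc (hs.trans hW₂)
      rw [← supp_int (fun x => w₁ x i) (hs.trans hW₁)] at e1
      rw [← supp_int (fun x => w₂ x i) (hs.trans hW₂)] at e2
      have hi : ∀ f : E3 → ℝ, ContinuousOn f W → Integrable (fun x => f x * lap3 (lap3 φ) x) := by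
        intro f hf
        have hsl : tsupport (lap3 (lap3 φ)) ⊆ W := ((tsupport_lap3 _).trans (tsupport_lap3 _)).trans hs
        have hcl : HasCompactSupport (lap3 (lap3 φ)) := hcs_lap3 (hcs_lap3 hc)
        have h1 : IntegrableOn (fun x => f x * lap3 (lap3 φ) x) (tsupport (lap3 (lap3 φ))) :=
          ((hf.mono hsl).mul (lap3_contDiff (lap3_contDiff hφ)).continuous.continuousOn).integrableOn_compact hcl
        refine h1.integrable_of_forall_notMem_eq_zero fun x hx => ?_
        rw [image_eq_zero_of_notMem_tsupport hx, mul_zero]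
      simp only [sub_mul]
      rw [integral_sub (hi _ c1) (hi _ c2), e1, e2, sub_zero]
    · filter_upwards [hzz] with x hx
      simp [hx]
  intro x hx
  filter_upwards [key 0 x hx, key 1 x hx, key 2 x hx] with y h0 h1 h2
  ext i
  have h0 : w₁ y 0 - w₂ y 0 = 0 := h0
  have h1 : w₁ y 1 - w₂ y 1 = 0 := h1
  have h2 : w₁ y 2 - w₂ y 2 = 0 := h2
  fin_cases i
  · simpa using sub_eq_zero.1 h0
  · simpa using sub_eq_zero.1 h1
  · simpa using sub_eq_zero.1 h2

lemma cav_cl {D₀ : ℝ} {C : Set E3} (h : IsCavity D₀ C) :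
    (∀ x ∈ closure C, x 2 ≤ -D₀) ∧ ∀ x ∈ closure C, ‖x‖ ≤ 2 * D₀ := by
  obtain ⟨-, -, -, -, h5, h6, -⟩ := h
  constructor
  · exact fun x hx => closure_minimal (t := {x : E3 | x 2 ≤ -D₀}) h6 (isClosed_le (by fun_prop) continuous_const) hx
  · exact fun x hx => closure_minimal (t := {x : E3 | ‖x‖ ≤ 2 * D₀}) (fun y hy => le_of_lt (h5 hy).1)
      (isClosed_le (by fun_prop) continuous_const) hx

/-- the set where the two solutions coincide -/
def Gset (Ω₁ Ω₂ : Set E3) (w₁ w₂ : E3 → E3) : Set E3 := (Ω₁ ∩ Ω₂) ∩ {x | w₁ =ᶠ[𝓝 x] w₂}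

lemma Gset_open {Ω₁ Ω₂ : Set E3} {w₁ w₂ : E3 → E3} (h1 : IsOpen Ω₁) (h2 : IsOpen Ω₂) :
    IsOpen (Gset Ω₁ Ω₂ w₁ w₂) := (h1.inter h2).inter isOpen_setOfPred_eventually_nhds

lemma coordle (x : E3) (k : Fin 3) : |x k| ≤ ‖x‖ := by
  simpa using PiLp.norm_apply_le x k

lemma Gset_big {lam mu D₀ s₀ : ℝ} (hmu : 0 < mu) (hlam : 0 < 3*lam + 2*mu) (hD : 0 < D₀) (hs₀ : 0 < s₀)
    {C₁ C₂ : Set E3} {w₁ w₂ : E3 → E3} (h₁ : IsCavity D₀ C₁) (h₂ : IsCavity D₀ C₂)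
    (S₁ : Sol lam mu (lowerHalf \ closure C₁) w₁) (S₂ : Sol lam mu (lowerHalf \ closure C₂) w₂)
    (heq : ∀ x ∈ lowerHalf ∩ ball 0 s₀, w₁ x = w₂ x) :
    ∀ x ∈ lowerHalf, (-D₀ < x 2 ∨ 4 * D₀ < ‖x‖) → x ∈ Gset (lowerHalf \ closure C₁) (lowerHalf \ closure C₂) w₁ w₂ := by
  set G := Gset (lowerHalf \ closure C₁) (lowerHalf \ closure C₂) w₁ w₂ with hG
  obtain ⟨a1, b1⟩ := cav_cl h₁
  obtain ⟨a2, b2⟩ := cav_cl h₂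
  have step : ∀ W : Set E3, IsOpen W → Convex ℝ W → W ⊆ lowerHalf →
      ((∀ x ∈ W, -D₀ < x 2) ∨ (∀ x ∈ W, 2 * D₀ < ‖x‖)) → (∃ z ∈ W, w₁ =ᶠ[𝓝 z] w₂) → W ⊆ G := by
    intro W hW hWc hWl hor ⟨z, hz, hzz⟩
    have hs1 : W ⊆ lowerHalf \ closure C₁ := fun x hx => ⟨hWl hx, fun h => by
      rcases hor with h' | h'
      · linarith [a1 x h, h' x hx]
      · linarith [b1 x h, h' x hx]⟩
    have hs2 : W ⊆ lowerHalf \ closure C₂ := fun x hx => ⟨hWl hx, fun h => by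
      rcases hor with h' | h'
      · linarith [a2 x h, h' x hx]
      · linarith [b2 x h, h' x hx]⟩
    exact fun x hx => ⟨⟨hs1 hx, hs2 hx⟩, uc_sol hmu hlam S₁ S₂ hW hWc.isPreconnected hs1 hs2 hz hzz x hx⟩
  have hlo : ∀ (k : Fin 3) (c : ℝ), IsOpen {x : E3 | x k < c} := fun k c => isOpen_lt (by fun_prop) continuous_const
  have hgo : ∀ (k : Fin 3) (c : ℝ), IsOpen {x : E3 | c < x k} := fun k c => isOpen_lt continuous_const (by fun_prop)
  have hlc : ∀ (k : Fin 3) (c : ℝ), Convex ℝ {x : E3 | x k < c} := fun k c =>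
    convex_halfSpace_lt (EuclideanSpace.proj (𝕜 := ℝ) k : E3 →L[ℝ] ℝ).isLinear c
  have hgc : ∀ (k : Fin 3) (c : ℝ), Convex ℝ {x : E3 | c < x k} := fun k c =>
    convex_halfSpace_gt (EuclideanSpace.proj (𝕜 := ℝ) k : E3 →L[ℝ] ℝ).isLinear c
  have hstrip : lowerHalf ∩ {x | -D₀ < x 2} ⊆ G := by
    refine step _ (lowerHalf_open.inter (hgo 2 _)) ((hlc 2 0).inter (hgc 2 _)) inter_subset_left
      (Or.inl fun x hx => hx.2) ?_
    set d := min D₀ s₀ / 2 with hd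
    have hd0 : 0 < d := by positivity
    have hd1 : d < D₀ := by have := min_le_left D₀ s₀; linarith
    have hd2 : d < s₀ := by have := min_le_right D₀ s₀; linarith
    have hz : EuclideanSpace.single 2 (-d) ∈ lowerHalf ∩ ball (0 : E3) s₀ := by
      constructor
      · change (EuclideanSpace.single 2 (-d) : E3) 2 < 0
        simpa using hd0
      · simp [abs_of_pos hd0, hd2]
    refine ⟨EuclideanSpace.single 2 (-d), ⟨hz.1, ?_⟩, ?_⟩
    · change -D₀ < (EuclideanSpace.single 2 (-d) : E3) 2
      simpa using hd1
    · filter_upwards [(lowerHalf_open.inter isOpen_ball).mem_nhds hz] with y hy using heq y hy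
  have hside : ∀ k : Fin 3, k ≠ 2 → lowerHalf ∩ {x | 2 * D₀ < x k} ⊆ G := by
    intro k hk
    refine step _ (lowerHalf_open.inter (hgo k _)) ((hlc 2 0).inter (hgc k _)) inter_subset_left
      (Or.inr fun x hx => lt_of_lt_of_le hx.2 ((le_abs_self _).trans (coordle x k))) ?_
    set z : E3 := EuclideanSpace.single 2 (-(D₀ / 2)) + EuclideanSpace.single k (3 * D₀) with hz
    have hz2 : z 2 = -(D₀ / 2) := by simp [hz, hk.symm]
    have hzk : z k = 3 * D₀ := by simp [hz, hk]
    have hzl : z ∈ lowerHalf := by change z 2 < 0; linarith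
    refine ⟨z, ⟨hzl, ?_⟩, (hstrip ⟨hzl, ?_⟩).2⟩
    · change 2 * D₀ < z k; linarith
    · change -D₀ < z 2; linarith
  have hside' : ∀ k : Fin 3, k ≠ 2 → lowerHalf ∩ {x | x k < - (2 * D₀)} ⊆ G := by
    intro k hk
    refine step _ (lowerHalf_open.inter (hlo k _)) ((hlc 2 0).inter (hlc k _)) inter_subset_left
      (Or.inr fun x hx => lt_of_lt_of_le (lt_neg_of_lt_neg hx.2) ((neg_le_abs _).trans (coordle x k))) ?_
    set z : E3 := EuclideanSpace.single 2 (-(D₀ / 2)) + EuclideanSpace.single k (-(3 * D₀)) with hz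
    have hz2 : z 2 = -(D₀ / 2) := by simp [hz, hk.symm]
    have hzk : z k = -(3 * D₀) := by simp [hz, hk]
    have hzl : z ∈ lowerHalf := by change z 2 < 0; linarith
    refine ⟨z, ⟨hzl, ?_⟩, (hstrip ⟨hzl, ?_⟩).2⟩
    · change z k < - (2 * D₀); linarith
    · change -D₀ < z 2; linarith
  have hbot : {x : E3 | x 2 < - (2 * D₀)} ⊆ G := by
    refine step _ (hlo 2 _) (hlc 2 _) (fun x hx => by
      have : x 2 < - (2 * D₀) := hx
      change x 2 < 0; linarith)
      (Or.inr fun x hx => lt_of_lt_of_le (lt_neg_of_lt_neg hx) ((neg_le_abs _).trans (coordle x 2))) ?_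
    set z : E3 := EuclideanSpace.single 2 (-(3 * D₀)) + EuclideanSpace.single 0 (3 * D₀) with hz
    have hz2 : z 2 = -(3 * D₀) := by simp [hz]
    have hzk : z 0 = (3 * D₀) := by simp [hz]
    have hzl : z ∈ lowerHalf := by change z 2 < 0; linarith
    refine ⟨z, ?_, (hside 0 (by decide) ⟨hzl, ?_⟩).2⟩
    · change z 2 < - (2 * D₀); linarith
    · change 2 * D₀ < z 0; linarith
  intro x hx hor
  rcases hor with h | h
  · exact hstrip ⟨hx, h⟩
  by_contra hn
  have hx2 : x 2 < 0 := hx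
  have e0 : -(2 * D₀) ≤ x 0 := not_lt.1 fun h => hn (hside' 0 (by decide) ⟨hx, h⟩)
  have e0' : x 0 ≤ 2 * D₀ := not_lt.1 fun h => hn (hside 0 (by decide) ⟨hx, h⟩)
  have e1 : -(2 * D₀) ≤ x 1 := not_lt.1 fun h => hn (hside' 1 (by decide) ⟨hx, h⟩)
  have e1' : x 1 ≤ 2 * D₀ := not_lt.1 fun h => hn (hside 1 (by decide) ⟨hx, h⟩)
  have e2 : -(2 * D₀) ≤ x 2 := not_lt.1 fun h => hn (hbot h)
  have hsq : ‖x‖ ^ 2 = x 0 ^ 2 + x 1 ^ 2 + x 2 ^ 2 := by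
    rw [EuclideanSpace.real_norm_sq_eq, Fin.sum_univ_three]
  have hq0 : x 0 ^ 2 ≤ (2 * D₀) ^ 2 := sq_le_sq' e0 e0'
  have hq1 : x 1 ^ 2 ≤ (2 * D₀) ^ 2 := sq_le_sq' e1 e1'
  have hq2 : x 2 ^ 2 ≤ (2 * D₀) ^ 2 := sq_le_sq' e2 (by linarith)
  nlinarith

end

section
open Filter Topology
open scoped ContDiff

/-- Local graph coordinates for a set `C` near a boundary point. -/
structure Chart (C : Set E3) (P : E3) (r : ℝ) (e : E3) (M : NNReal) (s : E3 → ℝ) (pr : E3 → E2) (sg : E2 → E3) : Prop where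
  rpos : 0 < r
  ne : ‖e‖ = 1
  lip : LipschitzWith M s
  tr : ∀ x t, s (x + t • e) = s x + t
  sP : s P = 0
  inC : ∀ x ∈ ball P r, (x ∈ C ↔ s x < 0)
  clC : ∀ x ∈ ball P r, (x ∈ closure C ↔ s x ≤ 0)
  prlip : LipschitzWith 1 pr
  prsm : ContDiff ℝ ∞ pr
  prtr : ∀ x (t : ℝ), pr (x + t • e) = pr x
  sglip : LipschitzWith M sg
  prsg : ∀ p, pr (sg p) = p
  ssg : ∀ p, s (sg p) = 0
  rec' : ∀ x, x = sg (pr x) + s x • e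
  vol : ∀ A : Set E2, MeasurableSet A → ∀ ε : ℝ,
    volume {x | pr x ∈ A ∧ 0 < s x ∧ s x < ε} = ENNReal.ofReal ε * volume A

lemma proj12_add (x y : E3) : proj12 (x + y) = proj12 x + proj12 y := by
  ext i; fin_cases i <;> simp [proj12]

lemma proj12_smul (t : ℝ) (x : E3) : proj12 (t • x) = t • proj12 x := by
  ext i; fin_cases i <;> simp [proj12]

lemma proj12_norm (x : E3) : ‖proj12 x‖ ≤ ‖x‖ := by
  rw [← sq_le_sq₀ (norm_nonneg _) (norm_nonneg _), EuclideanSpace.real_norm_sq_eq, EuclideanSpace.real_norm_sq_eq,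
    Fin.sum_univ_two, Fin.sum_univ_three, proj12_0, proj12_1]
  nlinarith [sq_nonneg (x 2)]

lemma emb2_norm (x y : E2) : ‖emb2 x - emb2 y‖ ≤ ‖x - y‖ := by
  rw [← sq_le_sq₀ (norm_nonneg _) (norm_nonneg _), EuclideanSpace.real_norm_sq_eq, EuclideanSpace.real_norm_sq_eq,
    Fin.sum_univ_two, Fin.sum_univ_three]
  simp [emb2]

lemma exists_chart {r₀ E₀ : ℝ} (hr₀ : 0 < r₀) {C : Set E3} (h : HasLipschitzBoundary r₀ E₀ C) {P : E3}
    (hP : P ∈ frontier C) : ∃ e M s pr sg, Chart C P r₀ e M s pr sg := by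
  obtain ⟨φ, ψ, hφP, hψ0, hψl, hset⟩ := h P hP
  obtain ⟨f, hfl, hfe⟩ := hψl.extend_real
  set K := Real.toNNReal E₀
  set T := φ.toRealAffineIsometryEquiv with hT
  have hTφ : ∀ x, T x = φ x := fun x => by rw [hT, IsometryEquiv.coeFn_toRealAffineIsometryEquiv]
  set L := T.linearIsometryEquiv with hL
  have hadd : ∀ x v, φ (x + v) = φ x + L v := by
    intro x v
    have := T.map_vadd x v
    rw [hTφ, hTφ, vadd_eq_add, vadd_eq_add] at this
    rw [add_comm x v, this, add_comm]
  set e : E3 := - L.symm (bv 2) with he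
  have hLe : L e = - bv 2 := by simp [he]
  have hφe : ∀ x (t : ℝ), φ (x + t • e) = φ x - t • bv 2 := by
    intro x t; rw [hadd, map_smul, hLe, smul_neg, sub_eq_add_neg]
  have hφ0 : ∀ x, φ x = L x + φ 0 := by intro x; have := hadd 0 x; rw [zero_add] at this; rw [this, add_comm]
  set s : E3 → ℝ := fun x => f (proj12 (φ x)) - (φ x) 2 with hs
  set pr : E3 → E2 := fun x => proj12 (φ x) with hpr
  set sg : E2 → E3 := fun p => φ.symm (emb2 p + f p • bv 2) with hsg
  have hpb : ∀ t : ℝ, proj12 (t • bv 2) = 0 := by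
    intro t; ext i; fin_cases i <;> simp [proj12, bv]
  have hprtr : ∀ x (t : ℝ), pr (x + t • e) = pr x := by
    intro x t
    simp only [hpr]
    rw [hφe, sub_eq_add_neg, ← neg_smul, proj12_add, hpb, add_zero]
  have hstr : ∀ x t, s (x + t • e) = s x + t := by
    intro x t
    have h1 := hprtr x t
    simp only [hpr] at h1
    simp only [hs, h1]
    rw [hφe]
    simp [bv]; ring
  have hlip : LipschitzWith (K + 1) s := by
    refine LipschitzWith.of_dist_le_mul fun x y => ?_
    have h1 := hfl.dist_le_mul (proj12 (φ x)) (proj12 (φ y))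
    have h2 : dist (proj12 (φ x)) (proj12 (φ y)) ≤ dist x y := by
      rw [← φ.dist_eq x y, dist_eq_norm, dist_eq_norm]
      have := proj12_norm (φ x - φ y)
      rwa [sub_eq_add_neg, proj12_add, ← neg_one_smul ℝ, proj12_smul, neg_one_smul, ← sub_eq_add_neg, neg_one_smul, ← sub_eq_add_neg] at this
    have h3 : |(φ x - φ y) 2| ≤ dist x y := by
      rw [← φ.dist_eq x y, dist_eq_norm]; exact coordle _ _
    rw [Real.dist_eq] at h1 ⊢
    have h4 : (K : ℝ) * dist (proj12 (φ x)) (proj12 (φ y)) ≤ K * dist x y := by gcongr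
    rw [PiLp.sub_apply] at h3
    simp only [hs]
    push_cast
    rw [abs_le] at *
    constructor <;> nlinarith
  have hprlip : LipschitzWith 1 pr := by
    refine LipschitzWith.of_dist_le_mul fun x y => ?_
    rw [← φ.dist_eq x y, dist_eq_norm, dist_eq_norm]
    have := proj12_norm (φ x - φ y)
    rw [sub_eq_add_neg, proj12_add, ← neg_one_smul ℝ, proj12_smul, neg_one_smul, ← sub_eq_add_neg, neg_one_smul, ← sub_eq_add_neg] at this
    simpa [hpr] using this
  have hsglip : LipschitzWith (K + 1) sg := by
    refine LipschitzWith.of_dist_le_mul fun x y => ?_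
    have h1 := hfl.dist_le_mul x y
    simp only [hsg]
    rw [φ.symm.dist_eq, dist_eq_norm]
    have h2 := emb2_norm x y
    rw [Real.dist_eq] at h1
    rw [dist_eq_norm] at *
    calc ‖emb2 x + f x • bv 2 - (emb2 y + f y • bv 2)‖ = ‖(emb2 x - emb2 y) + (f x - f y) • bv 2‖ := by
          congr 1; rw [sub_smul]; abel
      _ ≤ ‖emb2 x - emb2 y‖ + ‖(f x - f y) • bv 2‖ := norm_add_le _ _
      _ ≤ ‖x - y‖ + K * ‖x - y‖ := by
          gcongr
          rw [norm_smul]; simpa [bv] using h1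
      _ = _ := by push_cast; ring
  have hpe : ∀ p : E2, ∀ t : ℝ, proj12 (emb2 p + t • bv 2) = p := by
    intro p t
    rw [proj12_add, hpb, add_zero]
    ext i; fin_cases i <;> simp [proj12, emb2]
  have hprsg : ∀ p, pr (sg p) = p := by
    intro p; simp only [hpr, hsg, IsometryEquiv.apply_symm_apply, hpe]
  have hssg : ∀ p, s (sg p) = 0 := by
    intro p; simp only [hs, hsg, IsometryEquiv.apply_symm_apply, hpe]
    simp [emb2, bv]
  have hball : ∀ x ∈ ball P r₀, φ x ∈ ball (0 : E3) r₀ := by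
    intro x hx; rw [← hφP, mem_ball, φ.dist_eq]; exact hx
  have hinC : ∀ x ∈ ball P r₀, (x ∈ C ↔ s x < 0) := by
    intro x hx
    have h1 := hball x hx
    have h2 : proj12 (φ x) ∈ ball (0 : E2) r₀ := by
      rw [mem_ball_zero_iff] at *; exact (proj12_norm _).trans_lt h1
    have h3 := hfe h2
    have h4 : x ∈ C ↔ φ x ∈ (φ '' C) ∩ ball 0 r₀ := by
      constructor
      · exact fun h => ⟨mem_image_of_mem _ h, h1⟩
      · rintro ⟨⟨y, hy, hyx⟩, -⟩; rwa [← φ.injective hyx]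
    rw [h4, hset]
    simp only [hs, ← h3]
    constructor
    · rintro ⟨-, h⟩; linarith
    · intro h; exact ⟨h1, by linarith⟩
  refine ⟨e, K + 1, s, pr, sg, hr₀, ?_, hlip, hstr, ?_, hinC, ?_, hprlip, ?_, hprtr, hsglip, hprsg, hssg, ?_, ?_⟩
  · simp [he, bv]
  · simp [hs, hφP, hfe (mem_ball_self hr₀) ▸ hψ0, show proj12 0 = 0 by simp [proj12]]
  · intro x hx
    constructor
    · intro h
      have h1 : x ∈ closure (C ∩ ball P r₀) := by
        rw [mem_closure_iff_nhds] at h ⊢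
        intro t ht
        obtain ⟨y, hy⟩ := h (t ∩ ball P r₀) (inter_mem ht (isOpen_ball.mem_nhds hx))
        exact ⟨y, hy.1.1, hy.2, hy.1.2⟩
      exact closure_minimal (t := {x | s x ≤ 0}) (fun y hy => ((hinC y hy.2).1 hy.1).le)
        (isClosed_le hlip.continuous continuous_const) h1
    · intro h
      have hcont : Tendsto (fun t : ℝ => x + (-t) • e) (𝓝[>] 0) (𝓝 x) := by
        have : Continuous fun t : ℝ => x + (-t) • e := by fun_prop
        have := (this.tendsto 0).mono_left (nhdsWithin_le_nhds (s := Ioi 0))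
        simpa using this
      refine mem_closure_of_tendsto hcont ?_
      filter_upwards [hcont (isOpen_ball.mem_nhds hx), self_mem_nhdsWithin] with t ht ht0
      rw [hinC _ ht, hstr]
      have : 0 < t := ht0
      linarith
  · have h1 : ContDiff ℝ ∞ φ := by
      have : (φ : E3 → E3) = fun x => L x + φ 0 := funext hφ0
      rw [this]; exact L.contDiff.add contDiff_const
    simp only [hpr]
    have h2 : ContDiff ℝ ∞ proj12 := by unfold proj12; fun_prop
    exact h2.comp h1
  · intro x
    apply φ.injective
    rw [hφe]
    simp only [hsg, IsometryEquiv.apply_symm_apply, hpr, hs]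
    ext i; fin_cases i <;> simp [emb2, proj12, bv]
  · intro A hA ε
    have hmp : MeasurePreserving φ volume volume := by
      have h1 := (measurePreserving_add_right volume (φ 0)).comp (L.measurePreserving)
      have : (φ : E3 → E3) = (fun x => x + φ 0) ∘ L := funext hφ0
      rw [this]; exact h1
    have h := vol_strip hA (f := fun p => f p - ε) (hfl.continuous.measurable.sub_const ε) ε
    rw [← h]
    have hm : MeasurableSet {x : E3 | proj12 x ∈ A ∧ x 2 ∈ Ioo (f (proj12 x) - ε) (f (proj12 x) - ε + ε)} := by
      have h2 : Continuous proj12 := by unfold proj12; fun_prop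
      have h3 : Continuous fun x : E3 => x 2 := by fun_prop
      refine (h2.measurable hA).inter (MeasurableSet.inter ?_ ?_)
      · exact (isOpen_lt ((hfl.continuous.comp h2).sub continuous_const) h3).measurableSet
      · exact (isOpen_lt h3 (((hfl.continuous.comp h2).sub continuous_const).add continuous_const)).measurableSet
    rw [← hmp.measure_preimage hm.nullMeasurableSet]
    congr 1
    ext x
    simp only [hpr, hs, mem_ofPred_eq, mem_preimage, mem_Ioo]
    constructor
    · rintro ⟨h1, h2, h3⟩; exact ⟨h1, by linarith, by linarith⟩
    · rintro ⟨h1, h2, h3⟩; exact ⟨h1, by linarith, by linarith⟩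

end

section
open Filter Topology
open scoped ContDiff

variable {C : Set E3} {P e : E3} {r : ℝ} {M : NNReal} {s : E3 → ℝ} {pr : E3 → E2} {sg : E2 → E3}

lemma Chart.mono (c : Chart C P r e M s pr sg) {r' : ℝ} (h0 : 0 < r') (h : r' ≤ r) : Chart C P r' e M s pr sg :=
  { c with
    rpos := h0
    inC := fun x hx => c.inC x (ball_subset_ball h hx)
    clC := fun x hx => c.clC x (ball_subset_ball h hx) }

lemma Chart.sgP (c : Chart C P r e M s pr sg) : sg (pr P) = P := by
  have := c.rec' P
  rw [c.sP, zero_smul, add_zero] at this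
  exact this.symm

lemma open_sub_of_cl {r₀ E₀ : ℝ} (hr₀ : 0 < r₀) {C₁ C₂ : Set E3} (ho : IsOpen C₁) (h : HasLipschitzBoundary r₀ E₀ C₁)
    (ho2 : IsOpen C₂) (hs : C₂ ⊆ closure C₁) : C₂ ⊆ C₁ := by
  intro x hx
  by_contra hn
  have hf : x ∈ frontier C₁ := by rw [ho.frontier_eq]; exact ⟨hs hx, hn⟩
  obtain ⟨e, M, s, pr, sg, c⟩ := exists_chart hr₀ h hf
  have hcont : Tendsto (fun t : ℝ => x + t • e) (𝓝[>] 0) (𝓝 x) := by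
    have : Continuous fun t : ℝ => x + t • e := by fun_prop
    have := (this.tendsto 0).mono_left (nhdsWithin_le_nhds (s := Ioi 0))
    simpa using this
  have h1 := hcont (isOpen_ball.mem_nhds (mem_ball_self c.rpos : x ∈ ball x r₀))
  have h2 := hcont (ho2.mem_nhds hx)
  obtain ⟨t, ⟨ht1, ht2⟩, ht0⟩ := (nonempty_of_mem (f := 𝓝[>] (0:ℝ)) (inter_mem (inter_mem h1 h2) self_mem_nhdsWithin))
  have ht1 : x + t • e ∈ ball x r₀ := ht1
  have ht2 : x + t • e ∈ C₂ := ht2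
  have := (c.clC _ ht1).1 (hs ht2)
  rw [c.tr, c.sP] at this
  have ht0 : 0 < t := ht0
  linarith

/-- cylinder neighbourhoods -/
lemma Chart.cyl (c : Chart C P r e M s pr sg) {N : Set E3} (hN : N ∈ 𝓝 P) :
    ∃ U : Set E3, IsOpen U ∧ P ∈ U ∧ U ⊆ N ∧ IsPreconnected (U ∩ {x | 0 < s x}) := by
  obtain ⟨d, hd, hdN⟩ := Metric.mem_nhds_iff.1 hN
  set a := d / (2 * (M + 1)) with ha
  have ha0 : 0 < a := by positivity
  refine ⟨{x | dist (pr x) (pr P) < a ∧ |s x| < d / 2}, ?_, ?_, ?_, ?_⟩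
  · exact (isOpen_lt (c.prlip.continuous.dist continuous_const) continuous_const).inter
      (isOpen_lt c.lip.continuous.abs continuous_const)
  · exact ⟨by simpa using ha0, by rw [c.sP]; simpa using hd⟩
  · rintro x ⟨h1, h2⟩
    apply hdN
    rw [mem_ball]
    have hgoal : dist (sg (pr x) + s x • e) (sg (pr P)) < d → dist x P < d := by
      rw [← c.rec' x, c.sgP]; exact id
    apply hgoal
    have h3 := c.sglip.dist_le_mul (pr x) (pr P)
    have h4 : (M : ℝ) * dist (pr x) (pr P) ≤ M * a := by gcongr
    have h5 : M * a ≤ d / 2 := by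
      rw [ha, mul_div_assoc', div_le_div_iff₀ (by positivity) (by positivity)]
      have := M.coe_nonneg
      nlinarith
    rw [dist_eq_norm] at h3 ⊢
    calc ‖sg (pr x) + s x • e - sg (pr P)‖ = ‖(sg (pr x) - sg (pr P)) + s x • e‖ := by congr 1; abel
      _ ≤ ‖sg (pr x) - sg (pr P)‖ + ‖s x • e‖ := norm_add_le _ _
      _ = ‖sg (pr x) - sg (pr P)‖ + |s x| := by rw [norm_smul, c.ne, mul_one, Real.norm_eq_abs]
      _ < d := by linarith
  · have him : ({x | dist (pr x) (pr P) < a ∧ |s x| < d / 2} ∩ {x | 0 < s x}) =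
        (fun q : E2 × ℝ => sg q.1 + q.2 • e) '' (ball (pr P) a ×ˢ Ioo 0 (d / 2)) := by
      ext x
      constructor
      · rintro ⟨⟨h1, h2⟩, h3⟩
        exact ⟨(pr x, s x), ⟨h1, h3, lt_of_le_of_lt (le_abs_self _) h2⟩, (c.rec' x).symm⟩
      · rintro ⟨⟨p, t⟩, ⟨h1, h2, h3⟩, rfl⟩
        have e1 : s (sg p + t • e) = t := by rw [c.tr, c.ssg, zero_add]
        have e2 : pr (sg p + t • e) = p := by rw [c.prtr, c.prsg]
        have h1 : dist p (pr P) < a := h1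
        have h2 : 0 < t := h2
        have h3 : t < d / 2 := h3
        refine ⟨⟨?_, ?_⟩, ?_⟩
        · simpa only [e2] using h1
        · simp only [e1, abs_of_pos h2]; exact h3
        · change 0 < s (sg p + t • e); rw [e1]; exact h2
    rw [him]
    refine IsPreconnected.image ((convex_ball _ _).isPreconnected.prod (convex_Ioo _ _).isPreconnected) _ ?_
    have := c.sglip.continuous
    fun_prop

/-- standing data: two cavities with the two solutions. -/
structure Two (lam mu r₀ E₀ D₀ : ℝ) (C₁ C₂ : Set E3) (w₁ w₂ : E3 → E3) : Prop where
  mu0 : 0 < mu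
  lam0 : 0 < 3 * lam + 2 * mu
  r0 : 0 < r₀
  D0 : 0 < D₀
  c1 : IsLipschitzCavity r₀ E₀ D₀ C₁
  c2 : IsLipschitzCavity r₀ E₀ D₀ C₂
  s1 : Sol lam mu (lowerHalf \ closure C₁) w₁
  s2 : Sol lam mu (lowerHalf \ closure C₂) w₂
  big : ∀ x ∈ lowerHalf, (-D₀ < x 2 ∨ 4 * D₀ < ‖x‖) → x ∈ Gset (lowerHalf \ closure C₁) (lowerHalf \ closure C₂) w₁ w₂

def Dset (C₁ C₂ : Set E3) (w₁ w₂ : E3 → E3) : Set E3 :=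
  (lowerHalf \ closure C₁) \ Gset (lowerHalf \ closure C₁) (lowerHalf \ closure C₂) w₁ w₂

variable {lam mu r₀ E₀ D₀ : ℝ} {C₁ C₂ : Set E3} {w₁ w₂ : E3 → E3}

lemma Two.Gopen (T : Two lam mu r₀ E₀ D₀ C₁ C₂ w₁ w₂) :
    IsOpen (Gset (lowerHalf \ closure C₁) (lowerHalf \ closure C₂) w₁ w₂) := Gset_open T.s1.op T.s2.op

lemma Two.Dmeas (T : Two lam mu r₀ E₀ D₀ C₁ C₂ w₁ w₂) : MeasurableSet (Dset C₁ C₂ w₁ w₂) :=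
  T.s1.op.measurableSet.diff T.Gopen.measurableSet

lemma Dsub : Dset C₁ C₂ w₁ w₂ ⊆ lowerHalf \ closure C₁ := sdiff_subset

/-- open preconnected subsets of both domains are inside or outside `G`. -/
lemma Two.dich (T : Two lam mu r₀ E₀ D₀ C₁ C₂ w₁ w₂) {W : Set E3} (hW : IsOpen W) (hc : IsPreconnected W)
    (h1 : W ⊆ lowerHalf \ closure C₁) (h2 : W ⊆ lowerHalf \ closure C₂) :
    W ⊆ Gset (lowerHalf \ closure C₁) (lowerHalf \ closure C₂) w₁ w₂ ∨ W ⊆ Dset C₁ C₂ w₁ w₂ := by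
  by_cases h : ∃ z ∈ W, w₁ =ᶠ[𝓝 z] w₂
  · obtain ⟨z, hz, hzz⟩ := h
    left
    exact fun x hx => ⟨⟨h1 hx, h2 hx⟩, uc_sol T.mu0 T.lam0 T.s1 T.s2 hW hc h1 h2 hz hzz x hx⟩
  · right
    exact fun x hx => ⟨h1 hx, fun hg => h ⟨x, hx, hg.2⟩⟩

/-- away from the second boundary, `D` is locally all or nothing. -/
lemma Two.locconst (T : Two lam mu r₀ E₀ D₀ C₁ C₂ w₁ w₂) {x : E3} (hx : x ∈ lowerHalf \ closure C₁)
    (hxf : x ∉ frontier C₂) : Dset C₁ C₂ w₁ w₂ ∈ 𝓝 x ∨ (Dset C₁ C₂ w₁ w₂)ᶜ ∈ 𝓝 x := by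
  by_cases hx2 : x ∈ C₂
  · left
    filter_upwards [T.s1.op.mem_nhds hx, T.c2.1.1.mem_nhds hx2] with y hy hy2
    exact ⟨hy, fun h => h.1.2.2 (subset_closure hy2)⟩
  · have hx3 : x ∈ lowerHalf \ closure C₂ := ⟨hx.1, fun h => hxf (by rw [T.c2.1.1.frontier_eq]; exact ⟨h, hx2⟩)⟩
    obtain ⟨d, hd, hds⟩ := Metric.isOpen_iff.1 (T.s1.op.inter T.s2.op) x ⟨hx, hx3⟩
    rcases T.dich isOpen_ball (convex_ball x d).isPreconnected (hds.trans inter_subset_left) (hds.trans inter_subset_right) with h | h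
    · right
      filter_upwards [ball_mem_nhds x hd] with y hy hyD
      exact hyD.2 (h hy)
    · left
      filter_upwards [ball_mem_nhds x hd] with y hy using h hy

/-- the functional -/
def LD (lam mu : ℝ) (C₁ C₂ : Set E3) (w₁ w₂ : E3 → E3) (v : E3 → E3) : ℝ :=
  ∫ x in Dset C₁ C₂ w₁ w₂, bA lam mu (fderiv ℝ w₁ x) (fderiv ℝ v x)

lemma Two.stepA_in (T : Two lam mu r₀ E₀ D₀ C₁ C₂ w₁ w₂) {U : Set E3} (hU : U ⊆ Dset C₁ C₂ w₁ w₂)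
    {v : E3 → E3} (hv : ContDiff ℝ ∞ v) (hc : HasCompactSupport v) (hs : tsupport v ⊆ U) :
    LD lam mu C₁ C₂ w₁ w₂ v = 0 := by
  unfold LD
  rw [← bint_restrict T.s1.op.measurableSet Dsub fun x _ hx => hU (hs hx)]
  exact T.s1.wk v hv hc ((hs.trans (hU.trans Dsub)).trans sdiff_subset)

lemma LD_out {U : Set E3} (hU : ∀ x ∈ U, x ∉ Dset C₁ C₂ w₁ w₂)
    {v : E3 → E3} (hs : tsupport v ⊆ U) :
    LD lam mu C₁ C₂ w₁ w₂ v = 0 := by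
  unfold LD
  refine setIntegral_eq_zero_of_forall_eq_zero fun x hx => ?_
  rw [fd_zero fun h => hU x (hs h) hx]; simp

lemma Two.stepA (T : Two lam mu r₀ E₀ D₀ C₁ C₂ w₁ w₂) {P : E3} (hP : P ∈ lowerHalf \ closure C₁) :
    ∃ U : Set E3, IsOpen U ∧ P ∈ U ∧ ∀ v : E3 → E3, ContDiff ℝ ∞ v → HasCompactSupport v → tsupport v ⊆ U →
      LD lam mu C₁ C₂ w₁ w₂ v = 0 := by
  by_cases hf : P ∈ frontier C₂
  · obtain ⟨e, M, s, pr, sg, c⟩ := exists_chart T.r0 T.c2.2 hf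
    obtain ⟨U, hUo, hPU, hUN, hUc⟩ := c.cyl (inter_mem (T.s1.op.mem_nhds hP) (ball_mem_nhds P c.rpos))
    refine ⟨U, hUo, hPU, fun v hv hc hs => ?_⟩
    have hU2 : ∀ x ∈ U, (x ∈ lowerHalf \ closure C₂ ↔ 0 < s x) := by
      intro x hx
      have h1 := c.clC x (hUN hx).2
      constructor
      · intro h; by_contra h'; exact h.2 (h1.2 (not_lt.1 h'))
      · intro h; exact ⟨(hUN hx).1.1, fun h' => absurd (h1.1 h') (not_le.2 h)⟩
    rcases T.dich (hUo.inter (isOpen_lt continuous_const c.lip.continuous)) hUc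
      (fun x hx => (hUN hx.1).1) (fun x hx => (hU2 x hx.1).2 hx.2) with h | h
    · -- the exterior part is inside G
      set Ω₁ := lowerHalf \ closure C₁
      set Ω₂ := lowerHalf \ closure C₂
      set V := U ∩ {x | 0 < s x} with hV
      have hVm : MeasurableSet V := (hUo.inter (isOpen_lt continuous_const c.lip.continuous)).measurableSet
      have hv1 : ContDiff ℝ 1 v := hv.of_le (by norm_cast)
      have i1 := T.s1.wk v hv hc (hs.trans fun x hx => (hUN hx).1.1)
      have i2 := T.s2.wk v hv hc (hs.trans fun x hx => (hUN hx).1.1)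
      rw [bint_restrict (B := V) T.s2.op.measurableSet (fun x hx => (hU2 x hx.1).2 hx.2)
        (fun x hx hxs => ⟨hs hxs, (hU2 x (hs hxs)).1 hx⟩)] at i2
      have i3 : ∫ x in V, bA lam mu (fderiv ℝ w₁ x) (fderiv ℝ v x) = 0 := by
        rw [← i2]
        refine setIntegral_congr_fun hVm fun x hx => ?_
        have : fderiv ℝ w₁ x = fderiv ℝ w₂ x := (h hx).2.fderiv_eq
        simp only [this]
      have hVΩ : V ⊆ Ω₁ := fun x hx => (hUN hx.1).1
      have i4 : ∫ x in Ω₁ \ V, bA lam mu (fderiv ℝ w₁ x) (fderiv ℝ v x) = 0 := by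
        have := setIntegral_sdiff hVm (T.s1.int_test subset_rfl T.s1.op.measurableSet hv1 hc) hVΩ
        rw [this, i1, i3, sub_zero]
      unfold LD
      rw [← i4]
      symm
      rw [bint_restrict (B := U ∩ (Ω₁ \ V)) (T.s1.op.measurableSet.diff hVm) inter_subset_right (fun x hx hxs => ⟨hs hxs, hx⟩)]
      rw [bint_restrict (B := U ∩ (Ω₁ \ V)) T.Dmeas ?_ ?_]
      · rintro x ⟨hxU, hx1, hxV⟩
        refine ⟨hx1, fun hg => hxV ⟨hxU, (hU2 x hxU).1 hg.1.2⟩⟩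
      · intro x hx hxs
        exact ⟨hs hxs, hx.1, fun hxV => hx.2 (h hxV)⟩
    · refine T.stepA_in (U := U) ?_ hv hc hs
      intro x hx
      by_cases hsx : 0 < s x
      · exact h ⟨hx, hsx⟩
      · exact ⟨(hUN hx).1, fun hg => hsx ((hU2 x hx).1 hg.1.2)⟩
  · rcases T.locconst hP hf with h | h
    · obtain ⟨U, hU, hUo, hPU⟩ := _root_.mem_nhds_iff.1 h
      exact ⟨U, hUo, hPU, fun v hv hc hs => T.stepA_in hU hv hc hs⟩
    · obtain ⟨U, hU, hUo, hPU⟩ := _root_.mem_nhds_iff.1 h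
      exact ⟨U, hUo, hPU, fun v hv hc hs => LD_out hU hs⟩

end

section
open Filter Topology
open scoped ContDiff Manifold

lemma loc_glob {F : Type*} [NormedAddCommGroup F] [NormedSpace ℝ F] (Λ : (E3 → F) → ℝ) (h0 : Λ 0 = 0)
    (hadd : ∀ f g : E3 → F, ContDiff ℝ ∞ f → HasCompactSupport f → ContDiff ℝ ∞ g → HasCompactSupport g →
      Λ (f + g) = Λ f + Λ g) {O : Set E3}
    (hloc : ∀ P ∈ O, ∃ U : Set E3, IsOpen U ∧ P ∈ U ∧ ∀ v : E3 → F, ContDiff ℝ ∞ v → HasCompactSupport v →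
      tsupport v ⊆ U → Λ v = 0) {v : E3 → F} (hv : ContDiff ℝ ∞ v) (hc : HasCompactSupport v) (hs : tsupport v ⊆ O) :
    Λ v = 0 := by
  choose! U hUo hPU hU using hloc
  obtain ⟨t, htc⟩ := hc.elim_nhds_subcover' (fun P _ => U P) (fun P hP => (hUo P (hs hP)).mem_nhds (hPU P (hs hP)))
  obtain ⟨f, hf⟩ := SmoothPartitionOfUnity.exists_isSubordinate 𝓘(ℝ, E3) (isClosed_tsupport v)
    (fun i : t => U i.1.1) (fun i => hUo _ (hs i.1.2)) (fun x hx => by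
      obtain ⟨P, hP, hxP⟩ := mem_iUnion₂.1 (htc hx)
      exact mem_iUnion.2 ⟨⟨P, hP⟩, hxP⟩)
  have hsm : ∀ i, ContDiff ℝ ∞ (fun x => f i x • v x) := fun i => (f i).contMDiff.contDiff.smul hv
  have hcs : ∀ i, HasCompactSupport (fun x => f i x • v x) := fun i => hc.smul_left
  have hz : ∀ i, Λ (fun x => f i x • v x) = 0 := by
    intro i
    exact hU _ (hs i.1.2) _ (hsm i) (hcs i) ((tsupport_smul_subset_left (f i) v).trans (hf i))
  have hsum : ∀ S : Finset t, Λ (∑ i ∈ S, fun x => f i x • v x) = 0 ∧ ContDiff ℝ ∞ (∑ i ∈ S, fun x => f i x • v x)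
      ∧ HasCompactSupport (∑ i ∈ S, fun x => f i x • v x) := by
    intro S
    induction S using Finset.induction_on with
    | empty => exact ⟨by simpa using h0, by rw [Finset.sum_empty]; exact contDiff_const, by simpa using (HasCompactSupport.zero : HasCompactSupport (0 : E3 → F))⟩
    | insert a S ha ih =>
      rw [Finset.sum_insert ha]
      refine ⟨?_, (hsm a).add ih.2.1, (hcs a).add ih.2.2⟩
      rw [hadd _ _ (hsm a) (hcs a) ih.2.1 ih.2.2, hz, ih.1, add_zero]
  have : v = ∑ i : t, fun x => f i x • v x := by
    ext x
    rw [Finset.sum_apply, ← Finset.sum_smul]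
    by_cases hx : x ∈ tsupport v
    · have := f.sum_eq_one hx
      rw [finsum_eq_sum_of_fintype] at this
      rw [this, one_smul]
    · rw [image_eq_zero_of_notMem_tsupport hx, smul_zero]
  rw [this]
  exact (hsum Finset.univ).1

lemma trans_L2 {X : Type*} [NormedAddCommGroup X] [NormedSpace ℝ X] {F : E3 → X} (hF : MemLp F 2 (volume : Measure E3)) (e : E3) :
    Tendsto (fun t : ℝ => eLpNorm (fun x => F (x + t • e) - F x) 2 volume) (𝓝 0) (𝓝 0) := by
  have hmp : ∀ t : ℝ, MeasurePreserving (fun x : E3 => x + t • e) volume volume := fun t =>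
    measurePreserving_add_right volume (t • e)
  set g : ℝ → C(E3, E3) := fun t => ⟨fun x => x + t • e, by fun_prop⟩ with hg
  have hgc : Continuous g := by
    refine ContinuousMap.continuous_of_continuous_uncurry _ ?_
    change Continuous fun q : ℝ × E3 => q.2 + q.1 • e
    fun_prop
  have h1 := Filter.Tendsto.compMeasurePreservingLp (μ := volume) (ν := volume) (p := 2)
    (f := fun _ : ℝ => hF.toLp F) tendsto_const_nhds (hgc.tendsto 0) (fun t => hmp t) (hmp 0) (by norm_num)
  rw [tendsto_iff_edist_tendsto_0] at h1
  refine h1.congr fun t => ?_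
  rw [Lp.edist_def]
  refine eLpNorm_congr_ae ?_
  have a1 := Lp.coeFn_compMeasurePreserving (hF.toLp F) (hmp t)
  have a2 := Lp.coeFn_compMeasurePreserving (hF.toLp F) (hmp 0)
  have a3 := (hmp t).quasiMeasurePreserving.ae_eq_comp hF.coeFn_toLp
  have a4 := (hmp 0).quasiMeasurePreserving.ae_eq_comp hF.coeFn_toLp
  filter_upwards [a1, a2, a3, a4] with x b1 b2 b3 b4
  simp only [Function.comp] at b1 b2 b3 b4
  rw [Pi.sub_apply]
  refine (congrArg₂ (· - ·) (b1.trans b3) (b2.trans b4)).trans ?_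
  simp only [zero_smul, add_zero]

end

section
open Filter Topology
open scoped ContDiff

lemma fd_zero1 {v : E3 → ℝ} {x : E3} (hx : x ∉ tsupport v) : fderiv ℝ v x = 0 :=
  image_eq_zero_of_notMem_tsupport fun h => hx (tsupport_fderiv_subset ℝ h)

structure Loc (lam mu : ℝ) (Ω : Set E3) (w : E3 → E3) (C : Set E3) (P : E3) (r : ℝ) (e : E3) (M : NNReal) (s : E3 → ℝ) (pr : E3 → E2) (sg : E2 → E3) : Prop where
  c : Chart C P r e M s pr sg
  S : Sol lam mu Ω w
  iff : ∀ x ∈ ball P r, (x ∈ Ω ↔ 0 < s x)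
  lh : ball P r ⊆ lowerHalf
  mu0 : 0 < mu
  lam0 : 0 < 3 * lam + 2 * mu

/-- the translated energy density -/
def Edens (lam mu : ℝ) (w : E3 → E3) (χ : E3 → ℝ) (e : E3) (t : ℝ) (x : E3) : ℝ :=
  χ x * bA lam mu (fderiv ℝ w x) (fderiv ℝ w (x + t • e)) +
    bA lam mu (fderiv ℝ w x) ((fderiv ℝ χ x).smulRight (w (x + t • e)))

variable {lam mu : ℝ} {Ω : Set E3} {w : E3 → E3} {C : Set E3} {P : E3} {r : ℝ} {e : E3} {M : NNReal} {s : E3 → ℝ} {pr : E3 → E2} {sg : E2 → E3}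

lemma Loc.shift (L : Loc lam mu Ω w C P r e M s pr sg) {t : ℝ} (ht : 0 ≤ t) (htr : t < r / 2) {x : E3} (hx : x ∈ ball P (r / 2)) :
    x + t • e ∈ ball P r := by
  rw [mem_ball, dist_eq_norm] at hx ⊢
  have : ‖x + t • e - P‖ ≤ ‖x - P‖ + ‖t • e‖ := by
    rw [show x + t • e - P = (x - P) + t • e by abel]; exact norm_add_le _ _
  rw [norm_smul, L.c.ne, Real.norm_eq_abs, abs_of_nonneg ht] at this
  linarith

lemma Loc.shiftΩ (L : Loc lam mu Ω w C P r e M s pr sg) {t : ℝ} (ht : 0 ≤ t) (htr : t < r / 2) {x : E3} (hx : x ∈ ball P (r / 2))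
    (hxΩ : x ∈ Ω) : x + t • e ∈ Ω := by
  have h0 := L.c.rpos
  rw [L.iff _ (L.shift ht htr hx), L.c.tr]
  have := (L.iff x (ball_subset_ball (by linarith) hx)).1 hxΩ
  linarith

lemma Loc.T (L : Loc lam mu Ω w C P r e M s pr sg) {V : Set E3} (hVΩ : V ⊆ Ω) (hVm : MeasurableSet V)
    (hV : ∀ v : E3 → E3, ContDiff ℝ 1 v → HasCompactSupport v → tsupport v ⊆ ball P r →
      ∫ x in V, bA lam mu (fderiv ℝ w x) (fderiv ℝ v x) = 0) {χ : E3 → ℝ} (hχ : ContDiff ℝ ∞ χ)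
    (hs : tsupport χ ⊆ ball P (r / 2)) {t : ℝ} (ht : 0 < t) (htr : t < r / 2) :
    IntegrableOn (Edens lam mu w χ e t) V ∧ ∫ x in V, Edens lam mu w χ e t x = 0 := by
  have hr := L.c.rpos
  have hcχ : HasCompactSupport χ := (isCompact_closedBall P (r/2)).of_isClosed_subset (isClosed_tsupport _)
    (hs.trans ball_subset_closedBall)
  have hlip : LipschitzWith M (fun x => s x + t) := by
    refine LipschitzWith.of_dist_le_mul fun x y => ?_
    rw [dist_add_right]; exact L.c.lip.dist_le_mul x y
  obtain ⟨κ, κs, κ01, κ0, κ1, -⟩ := cutoff hlip ht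
  set g : E3 → ℝ := fun x => κ x * χ x with hg
  have hgs : ContDiff ℝ ∞ g := κs.mul hχ
  have htg : tsupport g ⊆ tsupport χ ∩ {x | - (3 * t / 4) ≤ s x} := by
    refine subset_inter (tsupport_mul_subset_right) ?_
    refine closure_minimal ?_ (isClosed_le continuous_const L.c.lip.continuous)
    intro x hx
    by_contra hn
    have : s x + t ≤ t / 4 := by
      have : ¬ (- (3 * t / 4) ≤ s x) := hn
      push Not at this; linarith
    exact hx (by simp [hg, κ0 x this])
  set Ω' : Set E3 := (fun x => x + t • e) ⁻¹' Ω with hΩ'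
  have hΩo : IsOpen Ω' := L.S.op.preimage (by fun_prop)
  have hu : ContDiffOn ℝ 1 (fun x => w (x + t • e)) Ω' :=
    L.S.c1.comp (contDiff_id.add contDiff_const).contDiffOn (fun x hx => hx)
  have htg2 : tsupport g ⊆ Ω' := by
    intro x hx
    obtain ⟨h1, h2⟩ := htg hx
    change x + t • e ∈ Ω
    rw [L.iff _ (L.shift ht.le htr (hs h1)), L.c.tr]
    have : - (3 * t / 4) ≤ s x := h2
    linarith
  set v : E3 → E3 := fun x => g x • w (x + t • e) with hv
  have hv1 : ContDiff ℝ 1 v := c1_cut hΩo hu (hgs.of_le (by norm_cast)) htg2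
  have hvs : tsupport v ⊆ tsupport χ := (tsupport_smul_subset_left g _).trans (htg.trans inter_subset_left)
  have hvc : HasCompactSupport v := hcχ.of_isClosed_subset (isClosed_tsupport _) hvs
  have h0 := hV v hv1 hvc (hvs.trans (hs.trans (ball_subset_ball (by linarith))))
  have hi := L.S.int_test hVΩ hVm hv1 hvc
  have heq : EqOn (fun x => bA lam mu (fderiv ℝ w x) (fderiv ℝ v x)) (Edens lam mu w χ e t) V := by
    intro x hx
    simp only [Edens]
    by_cases hxs : x ∈ tsupport χ
    · have hxb := hs hxs
      have hxs0 := (L.iff x (ball_subset_ball (by linarith) hxb)).1 (hVΩ hx)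
      have hev : v =ᶠ[𝓝 x] fun y => χ y • w (y + t • e) := by
        filter_upwards [(isOpen_lt continuous_const L.c.lip.continuous).mem_nhds hxs0] with y hy
        have : κ y = 1 := κ1 y (by have : 0 < s y := hy; linarith)
        simp [hv, hg, this]
      rw [hev.fderiv_eq]
      have d1 : DifferentiableAt ℝ χ x := (hχ.differentiable (by simp)) x
      have hmem := L.shiftΩ ht.le htr hxb (hVΩ hx)
      have d3 : DifferentiableAt ℝ w (x + t • e) := (L.S.c1.differentiableOn (by simp)).differentiableAt (L.S.op.mem_nhds hmem)
      have d2 : HasFDerivAt (fun y => w (y + t • e)) (fderiv ℝ w (x + t • e)) x := by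
        have := d3.hasFDerivAt.comp x ((hasFDerivAt_id x).add_const (t • e))
        rw [ContinuousLinearMap.comp_id] at this
        exact this
      have d4 : fderiv ℝ (fun y => χ y • w (y + t • e)) x = χ x • fderiv ℝ w (x + t • e) + (fderiv ℝ χ x).smulRight (w (x + t • e)) :=
        (d1.hasFDerivAt.smul d2).fderiv
      rw [d4]
      simp
    · rw [fd_zero fun h => hxs (hvs h), fd_zero1 hxs, image_eq_zero_of_notMem_tsupport hxs]
      have : ((0 : E3 →L[ℝ] ℝ).smulRight (w (x + t • e))) = 0 := by ext; simp
      rw [this]; simp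
  exact ⟨hi.congr_fun heq hVm, by rw [← setIntegral_congr_fun hVm heq]; exact h0⟩

end

section
open Filter Topology
open scoped ContDiff

lemma lint_mul {X Y : Type*} [NormedAddCommGroup X] [NormedAddCommGroup Y] {f : E3 → X} {g : E3 → Y}
    (hf : AEStronglyMeasurable f volume) (hg : AEStronglyMeasurable g volume) :
    ∫⁻ x, ‖f x‖ₑ * ‖g x‖ₑ ≤ eLpNorm f 2 volume * eLpNorm g 2 volume := by
  have := ENNReal.lintegral_mul_le_Lp_mul_Lq (volume : Measure E3) (p := 2) (q := 2) ⟨by norm_num, by norm_num, by norm_num⟩ hf.enorm hg.enorm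
  rw [eLpNorm_eq_lintegral_rpow_enorm_toReal (by norm_num) (by norm_num), eLpNorm_eq_lintegral_rpow_enorm_toReal (by norm_num) (by norm_num)]
  simpa using this

variable {lam mu : ℝ} {Ω : Set E3} {w : E3 → E3} {C : Set E3} {P : E3} {r : ℝ} {e : E3} {M : NNReal} {s : E3 → ℝ} {pr : E3 → E2} {sg : E2 → E3}

lemma ball_inter (P : E3) (r : ℝ) : ∃ R, ball P r ⊆ ball 0 R := by
  obtain ⟨R, hR⟩ := (isBounded_ball (x := P) (r := r)).subset_ball 0
  exact ⟨R, hR⟩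

lemma memLp_ind {X : Type*} [NormedAddCommGroup X] {f : E3 → X} {A : Set E3} (hA : MeasurableSet A)
    (hm : AEStronglyMeasurable f (volume.restrict A)) (h : IntegrableOn (fun x => ‖f x‖ ^ 2) A) :
    MemLp (A.indicator f) 2 volume := by
  rw [memLp_indicator_iff_restrict hA]
  exact (memLp_two_iff_integrable_sq_norm hm).2 h

lemma Sol.memLp_D (h : Sol lam mu Ω w) (P : E3) (r : ℝ) : MemLp ((Ω ∩ ball P r).indicator (fderiv ℝ w)) 2 volume := by
  obtain ⟨R, hR⟩ := ball_inter P r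
  exact memLp_ind (h.op.inter isOpen_ball).measurableSet
    ((h.gcont.mono inter_subset_left).aestronglyMeasurable (h.op.inter isOpen_ball).measurableSet)
    ((h.g2 R).mono_set (inter_subset_inter_right _ hR))

lemma Sol.memLp_w (h : Sol lam mu Ω w) (P : E3) (r : ℝ) : MemLp ((Ω ∩ ball P r).indicator w) 2 volume := by
  obtain ⟨R, hR⟩ := ball_inter P r
  exact memLp_ind (h.op.inter isOpen_ball).measurableSet
    ((h.c1.continuousOn.mono inter_subset_left).aestronglyMeasurable (h.op.inter isOpen_ball).measurableSet)
    ((h.w2 R).mono_set (inter_subset_inter_right _ hR))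

lemma Loc.Tlim (L : Loc lam mu Ω w C P r e M s pr sg) {V : Set E3} (hVΩ : V ⊆ Ω) (hVm : MeasurableSet V)
    (hV : ∀ v : E3 → E3, ContDiff ℝ 1 v → HasCompactSupport v → tsupport v ⊆ ball P r →
      ∫ x in V, bA lam mu (fderiv ℝ w x) (fderiv ℝ v x) = 0) {χ : E3 → ℝ} (hχ : ContDiff ℝ ∞ χ)
    (hs : tsupport χ ⊆ ball P (r / 2)) :
    ∫ x in V, Edens lam mu w χ e 0 x = 0 := by
  have hr := L.c.rpos
  have hcχ : HasCompactSupport χ := (isCompact_closedBall P (r/2)).of_isClosed_subset (isClosed_tsupport _)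
    (hs.trans ball_subset_closedBall)
  obtain ⟨K1, hK1, hχ1⟩ := bdd_cs hχ.continuous hcχ
  obtain ⟨K2, hK2, hχ2⟩ := bdd_cs (hχ.continuous_fderiv (by simp)) (hcχ.fderiv ℝ)
  obtain ⟨K, hK, hbA⟩ := bA_bound lam mu
  set A := Ω ∩ ball P r with hA
  set F := A.indicator (fderiv ℝ w) with hF
  set H := A.indicator w with hH
  have mF := L.S.memLp_D P r
  have mH := L.S.memLp_w P r
  have tF := trans_L2 mF e
  have tH := trans_L2 mH e
  have hpt : ∀ t : ℝ, 0 < t → t < r / 2 → ∀ x ∈ V, ‖Edens lam mu w χ e t x - Edens lam mu w χ e 0 x‖ₑ ≤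
      ENNReal.ofReal (K * K1) * (‖F x‖ₑ * ‖F (x + t • e) - F x‖ₑ) + ENNReal.ofReal (K * K2) * (‖F x‖ₑ * ‖H (x + t • e) - H x‖ₑ) := by
    intro t ht htr x hx
    by_cases hxs : x ∈ tsupport χ
    · have hxb := hs hxs
      have hxb' : x ∈ ball P r := ball_subset_ball (by linarith) hxb
      have hxA : x ∈ A := ⟨hVΩ hx, hxb'⟩
      have hxA' : x + t • e ∈ A := ⟨L.shiftΩ ht.le htr hxb (hVΩ hx), L.shift ht.le htr hxb⟩
      simp only [hF, hH, indicator_of_mem hxA, indicator_of_mem hxA']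
      have e1 : Edens lam mu w χ e t x - Edens lam mu w χ e 0 x =
          χ x * bA lam mu (fderiv ℝ w x) (fderiv ℝ w (x + t • e) - fderiv ℝ w x) +
          bA lam mu (fderiv ℝ w x) ((fderiv ℝ χ x).smulRight (w (x + t • e) - w x)) := by
        have : (fderiv ℝ χ x).smulRight (w (x + t • e) - w x) = (fderiv ℝ χ x).smulRight (w (x + t • e)) - (fderiv ℝ χ x).smulRight (w x) := by
          ext y; simp [smul_sub]
        rw [this]
        simp only [Edens, zero_smul, add_zero, map_sub]
        ring
      have e2 : ‖Edens lam mu w χ e t x - Edens lam mu w χ e 0 x‖ ≤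
          (K * K1) * (‖fderiv ℝ w x‖ * ‖fderiv ℝ w (x + t • e) - fderiv ℝ w x‖) + (K * K2) * (‖fderiv ℝ w x‖ * ‖w (x + t • e) - w x‖) := by
        rw [e1]
        refine (norm_add_le _ _).trans (add_le_add ?_ ?_)
        · rw [norm_mul]
          have a := hbA (fderiv ℝ w x) (fderiv ℝ w (x + t • e) - fderiv ℝ w x)
          rw [← Real.norm_eq_abs] at a
          calc _ ≤ K1 * (K * ‖fderiv ℝ w x‖ * ‖fderiv ℝ w (x + t • e) - fderiv ℝ w x‖) :=
                mul_le_mul (hχ1 x) a (norm_nonneg _) hK1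
            _ = _ := by ring
        · have a := hbA (fderiv ℝ w x) ((fderiv ℝ χ x).smulRight (w (x + t • e) - w x))
          rw [← Real.norm_eq_abs, ContinuousLinearMap.norm_smulRight_apply] at a
          refine a.trans ?_
          have := hχ2 x
          have h3 : 0 ≤ K * ‖fderiv ℝ w x‖ * ‖w (x + t • e) - w x‖ := by positivity
          nlinarith
      rw [← ofReal_norm, ← ofReal_norm, ← ofReal_norm, ← ofReal_norm, ← ENNReal.ofReal_mul (norm_nonneg _), ← ENNReal.ofReal_mul (norm_nonneg _),
        ← ENNReal.ofReal_mul (by positivity), ← ENNReal.ofReal_mul (by positivity), ← ENNReal.ofReal_add (by positivity) (by positivity)]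
      exact ENNReal.ofReal_le_ofReal e2
    · have : ∀ t, Edens lam mu w χ e t x = 0 := by
        intro t
        have : ((0 : E3 →L[ℝ] ℝ).smulRight (w (x + t • e))) = 0 := by ext; simp
        simp only [Edens, image_eq_zero_of_notMem_tsupport hxs, fd_zero1 hxs, this, map_zero, zero_mul, add_zero]
      simp [this]
  have hsh : ∀ {X : Type} [NormedAddCommGroup X] (G : E3 → X), AEStronglyMeasurable G volume → ∀ t : ℝ, AEStronglyMeasurable (fun x => G (x + t • e) - G x) volume := by
    intro X _ G hG t
    exact (hG.comp_measurePreserving (measurePreserving_add_right volume (t • e))).sub hG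
  have hb : ∀ t : ℝ, 0 < t → t < r / 2 → eLpNorm (fun x => Edens lam mu w χ e t x - Edens lam mu w χ e 0 x) 1 (volume.restrict V) ≤
      ENNReal.ofReal (K * K1) * (eLpNorm F 2 volume * eLpNorm (fun x => F (x + t • e) - F x) 2 volume) +
      ENNReal.ofReal (K * K2) * (eLpNorm F 2 volume * eLpNorm (fun x => H (x + t • e) - H x) 2 volume) := by
    intro t ht htr
    rw [eLpNorm_one_eq_lintegral_enorm]
    refine (setLIntegral_mono' hVm (hpt t ht htr)).trans ?_
    refine (setLIntegral_le_lintegral _ _).trans ?_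
    rw [lintegral_add_left' , lintegral_const_mul' _ _ ENNReal.ofReal_ne_top, lintegral_const_mul' _ _ ENNReal.ofReal_ne_top]
    · gcongr
      · exact lint_mul mF.1 (hsh F mF.1 t)
      · exact lint_mul mF.1 (hsh H mH.1 t)
    · exact ((mF.1.enorm).mul (hsh F mF.1 t).enorm).const_mul _
  have hlim : Tendsto (fun t => eLpNorm (fun x => Edens lam mu w χ e t x - Edens lam mu w χ e 0 x) 1 (volume.restrict V)) (𝓝[>] 0) (𝓝 0) := by
    have hR : Tendsto (fun t : ℝ => ENNReal.ofReal (K * K1) * (eLpNorm F 2 volume * eLpNorm (fun x => F (x + t • e) - F x) 2 volume) +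
      ENNReal.ofReal (K * K2) * (eLpNorm F 2 volume * eLpNorm (fun x => H (x + t • e) - H x) 2 volume)) (𝓝[>] 0) (𝓝 0) := by
      have a1 := ENNReal.Tendsto.const_mul (ENNReal.Tendsto.const_mul (tF.mono_left (nhdsWithin_le_nhds (s := Ioi 0))) (Or.inr mF.2.ne)) (Or.inr (ENNReal.ofReal_ne_top (r := K * K1)))
      have a2 := ENNReal.Tendsto.const_mul (ENNReal.Tendsto.const_mul (tH.mono_left (nhdsWithin_le_nhds (s := Ioi 0))) (Or.inr mF.2.ne)) (Or.inr (ENNReal.ofReal_ne_top (r := K * K2)))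
      have := a1.add a2
      simpa using this
    refine tendsto_of_tendsto_of_tendsto_of_le_of_le' tendsto_const_nhds hR (Eventually.of_forall fun _ => zero_le) ?_
    filter_upwards [Ioo_mem_nhdsGT (show (0:ℝ) < r / 2 by linarith)] with t ht
    exact hb t ht.1 ht.2
  have hm0 : AEStronglyMeasurable (Edens lam mu w χ e 0) (volume.restrict V) := by
    have m1 : AEStronglyMeasurable (fderiv ℝ w) (volume.restrict V) :=
      (L.S.gcont.aestronglyMeasurable L.S.op.measurableSet).mono_measure (Measure.restrict_mono hVΩ le_rfl)
    have m2 : AEStronglyMeasurable w (volume.restrict V) :=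
      (L.S.c1.continuousOn.aestronglyMeasurable L.S.op.measurableSet).mono_measure (Measure.restrict_mono hVΩ le_rfl)
    have m3 : AEStronglyMeasurable (fun x => bA lam mu (fderiv ℝ w x) (fderiv ℝ w x)) (volume.restrict V) :=
      (bA lam mu).aestronglyMeasurable_comp₂ m1 m1
    have m4 : AEStronglyMeasurable (fun x => (fderiv ℝ χ x).smulRight (w x)) (volume.restrict V) :=
      (ContinuousLinearMap.smulRightL ℝ E3 E3).aestronglyMeasurable_comp₂ (hχ.continuous_fderiv (by simp)).aestronglyMeasurable m2
    have m5 : AEStronglyMeasurable (fun x => bA lam mu (fderiv ℝ w x) ((fderiv ℝ χ x).smulRight (w x))) (volume.restrict V) :=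
      (bA lam mu).aestronglyMeasurable_comp₂ m1 m4
    have := (hχ.continuous.aestronglyMeasurable.mul m3).add m5
    refine this.congr (Eventually.of_forall fun x => ?_)
    simp [Edens]
  have hfin := tendsto_integral_of_L1' (μ := volume.restrict V) (l := 𝓝[>] (0:ℝ)) (Edens lam mu w χ e 0) hm0 (F := fun t => Edens lam mu w χ e t)
    (by
      filter_upwards [Ioo_mem_nhdsGT (show (0:ℝ) < r / 2 by linarith)] with t ht
      exact (L.T hVΩ hVm hV hχ hs ht.1 ht.2).1) hlim
  refine tendsto_nhds_unique hfin ?_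
  refine tendsto_const_nhds.congr' ?_
  filter_upwards [Ioo_mem_nhdsGT (show (0:ℝ) < r / 2 by linarith)] with t ht
  exact (L.T hVΩ hVm hV hχ hs ht.1 ht.2).2.symm

end

section
open Filter Topology
open scoped ContDiff

variable {lam mu : ℝ} {Ω : Set E3} {w : E3 → E3} {C : Set E3} {P : E3} {r : ℝ} {e : E3} {M : NNReal} {s : E3 → ℝ} {pr : E3 → E2} {sg : E2 → E3}

lemma Sol.Edens_int (h : Sol lam mu Ω w) {V : Set E3} (hVΩ : V ⊆ Ω) (hVm : MeasurableSet V) {χ : E3 → ℝ}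
    (hχ : ContDiff ℝ ∞ χ) (hc : HasCompactSupport χ) :
    IntegrableOn (fun x => χ x * bA lam mu (fderiv ℝ w x) (fderiv ℝ w x)) V ∧
    IntegrableOn (fun x => bA lam mu (fderiv ℝ w x) ((fderiv ℝ χ x).smulRight (w x))) V := by
  obtain ⟨K1, hK1, hχ1⟩ := bdd_cs hχ.continuous hc
  obtain ⟨K2, hK2, hχ2⟩ := bdd_cs (hχ.continuous_fderiv (by simp)) (hc.fderiv ℝ)
  obtain ⟨K, hK, hbA⟩ := bA_bound lam mu
  obtain ⟨R, -, hR⟩ := hcs_sub_ball hc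
  have m1 : AEStronglyMeasurable (fderiv ℝ w) (volume.restrict V) :=
    (h.gcont.aestronglyMeasurable h.op.measurableSet).mono_measure (Measure.restrict_mono hVΩ le_rfl)
  have m2 : AEStronglyMeasurable w (volume.restrict V) :=
    (h.c1.continuousOn.aestronglyMeasurable h.op.measurableSet).mono_measure (Measure.restrict_mono hVΩ le_rfl)
  have m3 : AEStronglyMeasurable (fun x => bA lam mu (fderiv ℝ w x) (fderiv ℝ w x)) (volume.restrict V) :=
    (bA lam mu).aestronglyMeasurable_comp₂ m1 m1
  have m4 : AEStronglyMeasurable (fun x => (fderiv ℝ χ x).smulRight (w x)) (volume.restrict V) :=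
    (ContinuousLinearMap.smulRightL ℝ E3 E3).aestronglyMeasurable_comp₂ (hχ.continuous_fderiv (by simp)).aestronglyMeasurable m2
  have m5 : AEStronglyMeasurable (fun x => bA lam mu (fderiv ℝ w x) ((fderiv ℝ χ x).smulRight (w x))) (volume.restrict V) :=
    (bA lam mu).aestronglyMeasurable_comp₂ m1 m4
  have hb := h.op.inter (isOpen_ball (x := (0 : E3)) (ε := R))
  have i1 : Integrable ((Ω ∩ ball 0 R).indicator fun x => ‖fderiv ℝ w x‖ ^ 2) := (integrable_indicator_iff hb.measurableSet).2 (h.g2 R)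
  have i2 : Integrable ((Ω ∩ ball 0 R).indicator fun x => ‖w x‖ ^ 2) := (integrable_indicator_iff hb.measurableSet).2 (h.w2 R)
  constructor
  · refine ((i1.const_mul (K1 * K)).integrableOn (s := V)).mono' (hχ.continuous.aestronglyMeasurable.mul m3) ?_
    filter_upwards [ae_restrict_mem hVm] with x hx
    by_cases hxs : x ∈ tsupport χ
    · rw [indicator_of_mem (show x ∈ Ω ∩ ball 0 R from ⟨hVΩ hx, hR hxs⟩), norm_mul]
      have a := hbA (fderiv ℝ w x) (fderiv ℝ w x)
      rw [← Real.norm_eq_abs] at a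
      calc _ ≤ K1 * (K * ‖fderiv ℝ w x‖ * ‖fderiv ℝ w x‖) := mul_le_mul (hχ1 x) a (norm_nonneg _) hK1
        _ = _ := by ring
    · rw [image_eq_zero_of_notMem_tsupport hxs]
      simp only [zero_mul, norm_zero]
      exact mul_nonneg (by positivity) (indicator_nonneg (fun _ _ => by positivity) _)
  · refine (((i1.add i2).const_mul (K * K2)).integrableOn (s := V)).mono' m5 ?_
    filter_upwards [ae_restrict_mem hVm] with x hx
    by_cases hxs : x ∈ tsupport χ
    · rw [Pi.add_apply, indicator_of_mem (show x ∈ Ω ∩ ball 0 R from ⟨hVΩ hx, hR hxs⟩), indicator_of_mem (show x ∈ Ω ∩ ball 0 R from ⟨hVΩ hx, hR hxs⟩)]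
      have a := hbA (fderiv ℝ w x) ((fderiv ℝ χ x).smulRight (w x))
      rw [← Real.norm_eq_abs, ContinuousLinearMap.norm_smulRight_apply] at a
      refine a.trans ?_
      have := hχ2 x
      have h3 : 0 ≤ K * ‖fderiv ℝ w x‖ * ‖w x‖ := by positivity
      have h4 : 0 ≤ K * K2 := by positivity
      calc _ ≤ K * ‖fderiv ℝ w x‖ * (K2 * ‖w x‖) := by gcongr
        _ = (K * K2) * (‖fderiv ℝ w x‖ * ‖w x‖) := by ring
        _ ≤ _ := by
          gcongr
          nlinarith [sq_nonneg (‖fderiv ℝ w x‖ - ‖w x‖), sq_nonneg (‖fderiv ℝ w x‖), sq_nonneg (‖w x‖)]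
    · have : ((0 : E3 →L[ℝ] ℝ).smulRight (w x)) = 0 := by ext; simp
      rw [fd_zero1 hxs, this]
      simp only [map_zero, norm_zero]
      exact mul_nonneg (by positivity) (add_nonneg (indicator_nonneg (fun _ _ => by positivity) _) (indicator_nonneg (fun _ _ => by positivity) _))

lemma Loc.diff_bd (L : Loc lam mu Ω w C P r e M s pr sg) {t : ℝ} (ht : 0 < t) (htr : t < r / 2) :
    ∫⁻ x in Ω ∩ ball P (r / 2), ‖fderiv ℝ w x‖ₑ * ‖w (x + t • e) - w x‖ₑ ≤
      ENNReal.ofReal t * (2 * ∫⁻ x in Ω ∩ ball P r, ‖fderiv ℝ w x‖ₑ ^ 2) := by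
  have hr := L.c.rpos
  set A := Ω ∩ ball P r with hA
  have hAo : IsOpen A := L.S.op.inter isOpen_ball
  set f : E3 → ENNReal := A.indicator fun x => ‖fderiv ℝ w x‖ₑ with hf
  have hfm : Measurable f := by
    have hc : ContinuousOn (fun x => ‖fderiv ℝ w x‖ₑ) A := (L.S.gcont.mono inter_subset_left).enorm
    classical
    rw [hf, ← piecewise_eq_indicator]
    exact hc.measurable_piecewise continuousOn_const hAo.measurableSet
  have h1 : ∀ x ∈ Ω ∩ ball P (r / 2), ‖fderiv ℝ w x‖ₑ * ‖w (x + t • e) - w x‖ₑ ≤ ∫⁻ τ in Ioc 0 t, (f x ^ 2 + f (x + τ • e) ^ 2) := by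
    intro x hx
    have hfx : f x = ‖fderiv ℝ w x‖ₑ := indicator_of_mem (show x ∈ A from ⟨hx.1, ball_subset_ball (by linarith) hx.2⟩) _
    have hin : ∀ τ ∈ Icc 0 t, x + τ • e ∈ A := fun τ hτ =>
      ⟨L.shiftΩ hτ.1 (hτ.2.trans_lt htr) hx.2 hx.1, L.shift hτ.1 (hτ.2.trans_lt htr) hx.2⟩
    have hd : ∀ τ ∈ uIcc 0 t, HasDerivAt (fun τ : ℝ => w (x + τ • e)) (fderiv ℝ w (x + τ • e) e) τ := by
      intro τ hτ
      rw [uIcc_of_le ht.le] at hτ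
      have d3 : DifferentiableAt ℝ w (x + τ • e) := (L.S.c1.differentiableOn (by simp)).differentiableAt (L.S.op.mem_nhds (hin τ hτ).1)
      have d4 : HasDerivAt (fun τ : ℝ => x + τ • e) e τ := by
        simpa using ((hasDerivAt_id τ).smul_const e).const_add x
      exact d3.hasFDerivAt.comp_hasDerivAt τ d4
    have hcont : ContinuousOn (fun τ : ℝ => fderiv ℝ w (x + τ • e) e) (uIcc 0 t) := by
      rw [uIcc_of_le ht.le]
      have : ContinuousOn (fun τ : ℝ => fderiv ℝ w (x + τ • e)) (Icc 0 t) :=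
        L.S.gcont.comp (by fun_prop) (fun τ hτ => (hin τ hτ).1)
      exact this.clm_apply continuousOn_const
    have hftc := intervalIntegral.integral_eq_sub_of_hasDerivAt hd hcont.intervalIntegrable
    simp only [zero_smul, add_zero] at hftc
    rw [← hftc, intervalIntegral.integral_of_le ht.le]
    have h2 : ‖∫ τ in Ioc 0 t, fderiv ℝ w (x + τ • e) e‖ₑ ≤ ∫⁻ τ in Ioc 0 t, f (x + τ • e) := by
      refine (enorm_integral_le_lintegral_enorm _).trans ?_
      refine setLIntegral_mono' measurableSet_Ioc fun τ hτ => ?_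
      rw [hf, indicator_of_mem (hin τ ⟨hτ.1.le, hτ.2⟩), ← ofReal_norm, ← ofReal_norm]
      refine ENNReal.ofReal_le_ofReal ?_
      have := (fderiv ℝ w (x + τ • e)).le_opNorm e
      rwa [L.c.ne, mul_one] at this
    rw [← hfx]
    refine (mul_le_mul_right h2 _).trans ?_
    have hfm2 : Measurable fun τ : ℝ => f (x + τ • e) := hfm.comp (by fun_prop)
    rw [← lintegral_const_mul _ hfm2]
    refine lintegral_mono fun τ => ?_
    rcases le_total (f x) (f (x + τ • e)) with h | h
    · calc f x * f (x + τ • e) ≤ f (x + τ • e) * f (x + τ • e) := mul_le_mul_left h _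
        _ = f (x + τ • e) ^ 2 := by ring
        _ ≤ _ := le_add_self
    · calc f x * f (x + τ • e) ≤ f x * f x := mul_le_mul_right h _
        _ = f x ^ 2 := by ring
        _ ≤ _ := le_self_add
  have hmA : MeasurableSet (Ω ∩ ball P (r / 2)) := (L.S.op.inter isOpen_ball).measurableSet
  refine (setLIntegral_mono' hmA h1).trans ?_
  refine (setLIntegral_le_lintegral _ _).trans ?_
  rw [lintegral_lintegral_swap]
  · have : ∀ τ : ℝ, ∫⁻ x, (f x ^ 2 + f (x + τ • e) ^ 2) = 2 * ∫⁻ x in A, ‖fderiv ℝ w x‖ₑ ^ 2 := by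
      intro τ
      rw [lintegral_add_left (hfm.pow_const 2), lintegral_add_right_eq_self (fun x => f x ^ 2) (τ • e), two_mul]
      have : ∫⁻ x, f x ^ 2 = ∫⁻ x in A, ‖fderiv ℝ w x‖ₑ ^ 2 := by
        rw [← lintegral_indicator hAo.measurableSet]
        congr 1; ext x
        by_cases hx : x ∈ A <;> simp [hf, hx]
      rw [this]
    simp only [this]
    rw [setLIntegral_const, Real.volume_Ioc, sub_zero, mul_comm]
  · refine Measurable.aemeasurable ?_
    change Measurable fun q : E3 × ℝ => f q.1 ^ 2 + f (q.1 + q.2 • e) ^ 2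
    exact ((hfm.comp measurable_fst).pow_const 2).add ((hfm.comp (by fun_prop)).pow_const 2)

end

section
open Filter Topology
open scoped ContDiff

variable {lam mu : ℝ} {Ω : Set E3} {w : E3 → E3} {C : Set E3} {P : E3} {r : ℝ} {e : E3} {M : NNReal} {s : E3 → ℝ} {pr : E3 → E2} {sg : E2 → E3}

def qf (lam mu : ℝ) (A : Set E3) (w : E3 → E3) : E3 → ℝ := A.indicator fun x => bA lam mu (fderiv ℝ w x) (fderiv ℝ w x)

lemma Sol.qf_int (h : Sol lam mu Ω w) (P : E3) (r : ℝ) : Integrable (qf lam mu (Ω ∩ ball P r) w) := by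
  obtain ⟨R, hR⟩ := ball_inter P r
  obtain ⟨K, hK, hbA⟩ := bA_bound lam mu
  have ho : IsOpen (Ω ∩ ball P r) := h.op.inter isOpen_ball
  have m1 : AEStronglyMeasurable (fderiv ℝ w) (volume.restrict (Ω ∩ ball P r)) :=
    ((h.gcont.mono inter_subset_left).aestronglyMeasurable ho.measurableSet)
  refine (integrable_indicator_iff ho.measurableSet).2 ?_
  refine (((h.g2 R).mono_set (inter_subset_inter_right _ hR)).const_mul K).mono' ((bA lam mu).aestronglyMeasurable_comp₂ m1 m1) ?_
  refine Eventually.of_forall fun x => (hbA _ _).trans (le_of_eq (by ring))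

lemma Loc.qf_nonneg (L : Loc lam mu Ω w C P r e M s pr sg) (A : Set E3) (x : E3) : 0 ≤ qf lam mu A w x :=
  indicator_nonneg (fun _ _ => bA_nonneg L.mu0 L.lam0 _) _

lemma Loc.strip (L : Loc lam mu Ω w C P r e M s pr sg) : ∃ K : ℝ, 0 ≤ K ∧ ∀ t, 0 < t → t < r / 2 →
    ∫ x in ball P (r / 4) ∩ {x | 0 < s x ∧ s x ≤ t}, qf lam mu (Ω ∩ ball P r) w x ≤ K * t := by
  have hr := L.c.rpos
  let χ : ContDiffBump P := ⟨r / 4, 3 * r / 8, by positivity, by linarith⟩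
  have hχ : ContDiff ℝ ∞ χ := χ.contDiff
  have hs : tsupport χ ⊆ ball P (r / 2) := by
    rw [χ.tsupport_eq]; exact closedBall_subset_ball (by change 3 * r / 8 < r / 2; linarith)
  have hc : HasCompactSupport χ := χ.hasCompactSupport
  obtain ⟨K2, hK2, hχ2⟩ := bdd_cs (hχ.continuous_fderiv (by simp)) (hc.fderiv ℝ)
  obtain ⟨K, hK, hbA⟩ := bA_bound lam mu
  have hχlip : ∀ x (t : ℝ), 0 ≤ t → χ (x - t • e) ≤ χ x + K2 * t := by
    intro x t ht
    have := (convex_univ (𝕜 := ℝ) (E := E3)).norm_image_sub_le_of_norm_fderiv_le (f := χ) (C := K2)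
      (fun y _ => (hχ.differentiable (by simp)) y) (fun y _ => hχ2 y) (mem_univ x) (mem_univ (x - t • e))
    rw [show x - t • e - x = - (t • e) by abel, norm_neg, norm_smul, L.c.ne, mul_one, Real.norm_eq_abs, Real.norm_eq_abs, abs_of_nonneg ht] at this
    linarith [le_abs_self (χ (x - t • e) - χ x)]
  set A := Ω ∩ ball P r with hA
  set q := qf lam mu A w with hq
  have hqi : Integrable q := L.S.qf_int P r
  have hq0 : ∀ x, 0 ≤ q x := L.qf_nonneg A
  have hVm := L.S.op.measurableSet
  have hwk : ∀ v : E3 → E3, ContDiff ℝ 1 v → HasCompactSupport v → tsupport v ⊆ ball P r →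
      ∫ x in Ω, bA lam mu (fderiv ℝ w x) (fderiv ℝ v x) = 0 := fun v hv hvc hvs =>
    ext_C1 L.S subset_rfl hVm lowerHalf_open L.S.wk hv hvc (hvs.trans L.lh)
  have hE0 : ∫ x in Ω, Edens lam mu w χ e 0 x = 0 := L.Tlim subset_rfl hVm hwk hχ hs
  have hE0i : IntegrableOn (Edens lam mu w χ e 0) Ω := by
    have := L.S.Edens_int subset_rfl hVm hχ hc
    refine (this.1.add this.2).congr (Eventually.of_forall fun x => ?_)
    simp [Edens]
  set J : ENNReal := ∫⁻ x in A, ‖fderiv ℝ w x‖ₑ ^ 2 with hJ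
  have hJt : J ≠ ⊤ := by
    have hm := L.S.memLp_D P r
    have h1 : MemLp (fderiv ℝ w) 2 (volume.restrict A) := (memLp_indicator_iff_restrict (L.S.op.inter isOpen_ball).measurableSet).1 hm
    have h2 := (memLp_two_iff_integrable_sq_norm h1.1).1 h1
    have h3 := h2.2
    rw [hasFiniteIntegral_iff_enorm] at h3
    refine (lt_of_le_of_lt (le_of_eq ?_) h3).ne
    refine lintegral_congr fun x => ?_
    rw [enorm_pow, enorm_norm]
  have hqI : 0 ≤ ∫ x, q x := integral_nonneg fun x => hq0 x
  refine ⟨K2 * (∫ x, q x) + 4 * K * K2 * J.toReal, by positivity, fun t ht htr => ?_⟩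
  set c : E3 → ℝ := Ω.indicator χ with hcd
  have hcm : AEStronglyMeasurable c volume := (hχ.continuous.stronglyMeasurable.indicator hVm).aestronglyMeasurable
  have hc01 : ∀ x, 0 ≤ c x ∧ c x ≤ 1 := by
    intro x
    by_cases hx : x ∈ Ω
    · rw [hcd, indicator_of_mem hx]; exact ⟨χ.nonneg, χ.le_one⟩
    · rw [hcd, indicator_of_notMem hx]; norm_num
  have hqti : Integrable (fun x => q (x + t • e)) := hqi.comp_add_right (t • e)
  have hcqi : Integrable (fun x => c x * q x) :=
    hqi.bdd_mul (c := 1) hcm (Eventually.of_forall fun x => by rw [Real.norm_eq_abs, abs_of_nonneg (hc01 x).1]; exact (hc01 x).2)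
  have hcqti : Integrable (fun x => c x * q (x + t • e)) :=
    hqti.bdd_mul (c := 1) hcm (Eventually.of_forall fun x => by rw [Real.norm_eq_abs, abs_of_nonneg (hc01 x).1]; exact (hc01 x).2)
  -- the d function
  set B := Ω ∩ ball P (r / 2) with hB
  have hBm : MeasurableSet B := (L.S.op.inter isOpen_ball).measurableSet
  set d : E3 → ℝ := fun x => ‖fderiv ℝ w x‖ * ‖w (x + t • e) - w x‖ with hd
  have hdm : AEStronglyMeasurable d (volume.restrict B) := by
    refine ContinuousOn.aestronglyMeasurable ?_ hBm
    refine (L.S.gcont.mono inter_subset_left).norm.mul (ContinuousOn.norm (ContinuousOn.sub ?_ (L.S.c1.continuousOn.mono inter_subset_left)))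
    exact L.S.c1.continuousOn.comp (by fun_prop) (fun x hx => L.shiftΩ ht.le htr hx.2 hx.1)
  have hdl : ∫⁻ x in B, ‖d x‖ₑ ≤ ENNReal.ofReal t * (2 * J) := by
    refine (le_of_eq ?_).trans (L.diff_bd ht htr)
    refine lintegral_congr fun x => ?_
    rw [hd, enorm_mul, enorm_norm, enorm_norm]
  have hfin : ENNReal.ofReal t * (2 * J) ≠ ⊤ := ENNReal.mul_ne_top ENNReal.ofReal_ne_top (ENNReal.mul_ne_top (by norm_num) hJt)
  have hdi : IntegrableOn d B := ⟨hdm, lt_of_le_of_lt hdl hfin.lt_top⟩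
  have hdI : ∫ x in B, d x ≤ 2 * t * J.toReal := by
    have h0 : ∀ x, 0 ≤ d x := fun x => by positivity
    rw [integral_eq_lintegral_of_nonneg_ae (Eventually.of_forall h0) hdm]
    have : ∫⁻ x in B, ENNReal.ofReal (d x) = ∫⁻ x in B, ‖d x‖ₑ := lintegral_congr fun x => by
      rw [← ofReal_norm, Real.norm_of_nonneg (h0 x)]
    rw [this]
    refine (ENNReal.toReal_mono hfin hdl).trans (le_of_eq ?_)
    rw [ENNReal.toReal_mul, ENNReal.toReal_mul, ENNReal.toReal_ofReal ht.le]
    norm_num; ring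
  have hTt := L.T subset_rfl hVm hwk hχ hs ht htr
  have hpt : ∀ x ∈ Ω, Edens lam mu w χ e t x - Edens lam mu w χ e 0 x ≤
      (1 / 2) * (c x * q (x + t • e) - c x * q x) + K * K2 * B.indicator d x := by
    intro x hx
    by_cases hxs : x ∈ tsupport χ
    · have hxb := hs hxs
      have hxb' : x ∈ ball P r := ball_subset_ball (by linarith) hxb
      have hxA : x ∈ A := ⟨hx, hxb'⟩
      have hxA' : x + t • e ∈ A := ⟨L.shiftΩ ht.le htr hxb hx, L.shift ht.le htr hxb⟩
      have e1 : Edens lam mu w χ e t x - Edens lam mu w χ e 0 x =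
          χ x * (bA lam mu (fderiv ℝ w x) (fderiv ℝ w (x + t • e)) - bA lam mu (fderiv ℝ w x) (fderiv ℝ w x)) +
          bA lam mu (fderiv ℝ w x) ((fderiv ℝ χ x).smulRight (w (x + t • e) - w x)) := by
        have : (fderiv ℝ χ x).smulRight (w (x + t • e) - w x) = (fderiv ℝ χ x).smulRight (w (x + t • e)) - (fderiv ℝ χ x).smulRight (w x) := by
          ext y; simp [smul_sub]
        rw [this]
        simp only [Edens, zero_smul, add_zero, map_sub]
        ring
      rw [e1, hcd, hq, qf, indicator_of_mem hx, indicator_of_mem hxA, indicator_of_mem hxA', indicator_of_mem (show x ∈ B from ⟨hx, hxb⟩)]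
      have a1 := bA_amgm L.mu0 L.lam0 (fderiv ℝ w x) (fderiv ℝ w (x + t • e))
      have a := (le_abs_self _).trans (hbA (fderiv ℝ w x) ((fderiv ℝ χ x).smulRight (w (x + t • e) - w x)))
      rw [ContinuousLinearMap.norm_smulRight_apply] at a
      have a2 : K * ‖fderiv ℝ w x‖ * (‖fderiv ℝ χ x‖ * ‖w (x + t • e) - w x‖) ≤ K * K2 * d x := by
        rw [hd]
        have := hχ2 x
        calc _ ≤ K * ‖fderiv ℝ w x‖ * (K2 * ‖w (x + t • e) - w x‖) := by gcongr
          _ = _ := by ring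
      have a3 : (0:ℝ) ≤ χ x := χ.nonneg
      have a4 := mul_le_mul_of_nonneg_left a1 a3
      linarith
    · have : ∀ t, Edens lam mu w χ e t x = 0 := by
        intro t
        have : ((0 : E3 →L[ℝ] ℝ).smulRight (w (x + t • e))) = 0 := by ext; simp
        simp only [Edens, image_eq_zero_of_notMem_tsupport hxs, fd_zero1 hxs, this, map_zero, zero_mul, add_zero]
      rw [this, this]
      have h1 : c x = 0 := by rw [hcd, indicator_of_mem hx, image_eq_zero_of_notMem_tsupport hxs]
      rw [h1]
      have : 0 ≤ B.indicator d x := indicator_nonneg (fun x _ => by positivity) x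
      have h3 : 0 ≤ K * K2 := by positivity
      nlinarith
  have hBd : Integrable (B.indicator d) := (integrable_indicator_iff hBm).2 hdi
  have hG : Integrable (fun x => (1 / 2) * (c x * q (x + t • e) - c x * q x) + K * K2 * B.indicator d x) :=
    ((hcqti.sub hcqi).const_mul _).add (hBd.const_mul _)
  have hI : 0 ≤ ∫ x in Ω, ((1 / 2) * (c x * q (x + t • e) - c x * q x) + K * K2 * B.indicator d x) := by
    have h1 := setIntegral_mono_on (hTt.1.sub hE0i) hG.integrableOn hVm hpt
    have h2 : ∫ x in Ω, (Edens lam mu w χ e t - Edens lam mu w χ e 0) x = 0 := by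
      simp only [Pi.sub_apply]
      rw [integral_sub hTt.1 hE0i, hTt.2, hE0, sub_zero]
    exact h2.symm.le.trans h1
  have hsupp : ∫ x in Ω, ((1 / 2) * (c x * q (x + t • e) - c x * q x) + K * K2 * B.indicator d x) =
      ∫ x, ((1 / 2) * (c x * q (x + t • e) - c x * q x) + K * K2 * B.indicator d x) := by
    refine setIntegral_eq_integral_of_forall_compl_eq_zero fun x hx => ?_
    rw [hcd, indicator_of_notMem hx, indicator_of_notMem (fun h : x ∈ B => hx h.1)]; ring
  have hsb : Integrable (fun x => (1 / 2) * (c x * q (x + t • e) - c x * q x)) := (hcqti.sub hcqi).const_mul _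
  rw [hsupp, integral_add hsb (hBd.const_mul _), integral_const_mul, integral_const_mul,
    integral_sub hcqti hcqi, integral_indicator hBm] at hI
  have hsh : ∫ x, c x * q (x + t • e) = ∫ x, c (x - t • e) * q x := by
    rw [← integral_sub_right_eq_self (fun x => c x * q (x + t • e)) (t • e)]
    simp
  have hcqsi : Integrable (fun x => c (x - t • e) * q x) := by
    have := hcqti.comp_sub_right (t • e)
    simpa using this
  set St := ball P (r / 4) ∩ {x | 0 < s x ∧ s x ≤ t} with hSt
  have hStm : MeasurableSet St := by
    refine measurableSet_ball.inter ?_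
    exact (measurableSet_lt measurable_const L.c.lip.continuous.measurable).inter (measurableSet_le L.c.lip.continuous.measurable measurable_const)
  have hmain : ∀ x, St.indicator q x - K2 * t * q x ≤ c x * q x - c (x - t • e) * q x := by
    intro x
    by_cases hxA : x ∈ A
    · have hcx : c x = χ x := indicator_of_mem hxA.1 _
      by_cases hst : s x ≤ t
      · have h0 : c (x - t • e) = 0 := by
          by_contra hne
          have hm : x - t • e ∈ Ω := by
            by_contra h; exact hne (indicator_of_notMem h _)
          have hs' : x - t • e ∈ tsupport χ := by
            by_contra h
            exact hne (by rw [hcd, indicator_of_mem hm, image_eq_zero_of_notMem_tsupport h])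
          have := (L.iff _ (ball_subset_ball (by linarith) (hs hs'))).1 hm
          have h2 := L.c.tr x (-t)
          rw [neg_smul, ← sub_eq_add_neg] at h2
          linarith
        rw [h0, hcx, zero_mul, sub_zero]
        have hq1 := hq0 x
        have : St.indicator q x ≤ χ x * q x := by
          by_cases hxS : x ∈ St
          · rw [indicator_of_mem hxS, χ.one_of_mem_closedBall (ball_subset_closedBall hxS.1), one_mul]
          · rw [indicator_of_notMem hxS]; exact mul_nonneg χ.nonneg hq1
        have h4 : 0 ≤ K2 * t * q x := by positivity
        linarith
      · have : x ∉ St := fun h => hst h.2.2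
        rw [indicator_of_notMem this, hcx]
        have h1 : c (x - t • e) ≤ χ (x - t • e) := indicator_le_self' (fun _ _ => χ.nonneg) _
        have h2 := hχlip x t ht.le
        have hq1 := hq0 x
        nlinarith
    · have : q x = 0 := indicator_of_notMem hxA _
      have h2 : St.indicator q x = 0 := by
        by_cases hxS : x ∈ St
        · rw [indicator_of_mem hxS, this]
        · rw [indicator_of_notMem hxS]
      rw [h2, this]; simp
  have hfinal := integral_mono ((hqi.indicator hStm).sub (hqi.const_mul (K2 * t))) (hcqi.sub hcqsi) hmain
  simp only [Pi.sub_apply] at hfinal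
  rw [integral_sub (hqi.indicator hStm) (hqi.const_mul (K2 * t)), integral_sub hcqi hcqsi, integral_const_mul, integral_indicator hStm] at hfinal
  have : K * K2 * ∫ x in B, d x ≤ K * K2 * (2 * t * J.toReal) := mul_le_mul_of_nonneg_left hdI (by positivity)
  rw [hsh] at hI
  linarith

end

section
open Filter Topology
open scoped ContDiff Manifold

lemma haus2_haar : (Measure.hausdorffMeasure (X := E2) 2).IsAddHaarMeasure := by
  have : (Measure.hausdorffMeasure (X := E2) (Module.finrank ℝ E2)).IsAddHaarMeasure := isAddHaarMeasure_hausdorffMeasure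
  simpa using this

lemma vol_le_haus : ∃ c : NNReal, ∀ A : Set E2, volume A = c * Measure.hausdorffMeasure (X := E2) 2 A := by
  have := haus2_haar
  refine ⟨Measure.addHaarScalarFactor (volume : Measure E2) (Measure.hausdorffMeasure (X := E2) 2), fun A => ?_⟩
  conv_lhs => rw [Measure.isAddLeftInvariant_eq_smul (volume : Measure E2) (Measure.hausdorffMeasure (X := E2) 2)]
  rfl

lemma haus_frontier {r₀ E₀ : ℝ} (hr₀ : 0 < r₀) {C : Set E3} (ho : IsOpen C) (hb : Bornology.IsBounded C) (h : HasLipschitzBoundary r₀ E₀ C) :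
    Measure.hausdorffMeasure (X := E3) 2 (frontier C) < ⊤ := by
  have hc : IsCompact (frontier C) := Metric.isCompact_of_isClosed_isBounded isClosed_frontier
    (hb.closure.subset frontier_subset_closure)
  have hh := haus2_haar
  refine hc.measure_lt_top_of_nhdsWithin fun Q hQ => ?_
  obtain ⟨e, M, s, pr, sg, c⟩ := exists_chart hr₀ h hQ
  refine ⟨frontier C ∩ ball Q r₀, inter_mem_nhdsWithin _ (ball_mem_nhds Q hr₀), ?_⟩
  have hsub : frontier C ∩ ball Q r₀ ⊆ sg '' (closedBall (pr Q) r₀) := by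
    rintro x ⟨hx, hxb⟩
    rw [ho.frontier_eq] at hx
    have h1 := (c.clC x hxb).1 hx.1
    have h2 : ¬ s x < 0 := fun h => hx.2 ((c.inC x hxb).2 h)
    have h3 : s x = 0 := le_antisymm h1 (not_lt.1 h2)
    have h4 := c.rec' x
    rw [h3, zero_smul, add_zero] at h4
    refine ⟨pr x, ?_, h4.symm⟩
    have := c.prlip.dist_le_mul x Q
    rw [mem_closedBall]
    rw [mem_ball] at hxb
    simp only [NNReal.coe_one, one_mul] at this
    linarith
  refine (measure_mono hsub).trans_lt ((c.sglip.hausdorffMeasure_image_le (by norm_num) _).trans_lt ?_)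
  refine ENNReal.mul_lt_top (ENNReal.rpow_lt_top_of_nonneg (by norm_num) ENNReal.coe_ne_top) ?_
  exact (isCompact_closedBall _ _).measure_lt_top

variable {lam mu r₀ E₀ D₀ : ℝ} {C₁ C₂ : Set E3} {w₁ w₂ : E3 → E3}
  {P : E3} {r : ℝ} {e : E3} {M : NNReal} {s : E3 → ℝ} {pr : E3 → E2} {sg : E2 → E3}

lemma small_proj (hs : Continuous s) (hpr : LipschitzWith 1 pr) (hfin : Measure.hausdorffMeasure (X := E3) 2 (frontier C₂) < ⊤)
    {δ : ENNReal} (hδ : δ ≠ 0) {t1 : ℝ} (ht1 : 0 < t1) :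
    ∃ t0, 0 < t0 ∧ t0 < t1 ∧ volume (pr '' (frontier C₂ ∩ {x | 0 < s x ∧ s x < t0})) < δ := by
  obtain ⟨c, hc⟩ := vol_le_haus
  set F : ℕ → Set E3 := fun n => frontier C₂ ∩ {x | 0 < s x ∧ s x < t1 / ((n : ℝ) + 2)} with hF
  have hm : ∀ n, NullMeasurableSet (F n) (Measure.hausdorffMeasure (X := E3) 2) := fun n =>
    (isClosed_frontier.measurableSet.inter ((measurableSet_lt measurable_const hs.measurable).inter
      (measurableSet_lt hs.measurable measurable_const))).nullMeasurableSet
  have hanti : Antitone F := by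
    intro m n hmn x hx
    refine ⟨hx.1, hx.2.1, hx.2.2.trans_le ?_⟩
    have : (m : ℝ) ≤ n := by exact_mod_cast hmn
    gcongr
  have ht := tendsto_measure_iInter_atTop hm hanti ⟨0, ((measure_mono inter_subset_left).trans_lt hfin).ne⟩
  have hempty : ⋂ n, F n = ∅ := by
    refine eq_empty_iff_forall_notMem.2 fun x hx => ?_
    rw [mem_iInter] at hx
    have h0 : 0 < s x := (hx 0).2.1
    obtain ⟨n, hn⟩ := exists_nat_gt (t1 / s x)
    have h2 : s x < t1 / ((n : ℝ) + 2) := (hx n).2.2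
    rw [lt_div_iff₀ (by positivity)] at h2
    rw [div_lt_iff₀ h0] at hn
    nlinarith
  rw [hempty, measure_empty] at ht
  have ht2 : Tendsto (fun n => (c : ENNReal) * Measure.hausdorffMeasure (X := E3) 2 (F n)) atTop (𝓝 0) := by
    have := ENNReal.Tendsto.const_mul ht (Or.inr (ENNReal.coe_ne_top (r := c)))
    simpa using this
  obtain ⟨n, hn⟩ := (ht2.eventually_lt_const (pos_iff_ne_zero.2 hδ)).exists
  refine ⟨t1 / ((n : ℝ) + 2), by positivity, ?_, lt_of_le_of_lt ?_ hn⟩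
  · rw [div_lt_iff₀ (by positivity)]
    have : (0 : ℝ) ≤ n := n.cast_nonneg
    nlinarith
  · rw [hc]
    have := hpr.hausdorffMeasure_image_le (d := 2) (by norm_num) (F n)
    simp only [ENNReal.coe_one, ENNReal.one_rpow, one_mul] at this
    exact mul_le_mul_right this _

lemma smooth_ind {A0 : Set E2} (hA : MeasurableSet A0) (p : E2) (R : ℝ) {δ : ENNReal} (hδ : δ ≠ 0) :
    ∃ (g : E2 → ℝ) (B : Set E2), ContDiff ℝ ∞ g ∧ (∀ x, 0 ≤ g x ∧ g x ≤ 1) ∧ volume B < δ ∧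
      ∀ x ∈ ball p R, x ∉ B → g x = A0.indicator 1 x := by
  have hA1 : MeasurableSet (A0 ∩ ball p R) := hA.inter measurableSet_ball
  have hfin : volume (A0 ∩ ball p R) ≠ ⊤ := ((measure_mono inter_subset_right).trans_lt measure_ball_lt_top).ne
  have hδ2 : δ / 2 ≠ 0 := by simpa using hδ
  obtain ⟨U, hU, hUo, -, hUd⟩ := hA1.exists_isOpen_sdiff_lt hfin hδ2
  obtain ⟨K, hK, hKc, hKd⟩ := hA1.exists_isCompact_sdiff_lt hfin hδ2
  obtain ⟨f, h0, h1, h01⟩ := exists_contMDiffMap_zero_one_of_isClosed (n := ⊤) 𝓘(ℝ, E2) (s := Uᶜ) (t := K) hUo.isClosed_compl hKc.isClosed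
    (disjoint_left.2 fun x hx hxK => hx (hU (hK hxK)))
  refine ⟨f, (U \ (A0 ∩ ball p R)) ∪ ((A0 ∩ ball p R) \ K), f.contMDiff.contDiff, fun x => h01 x, ?_, ?_⟩
  · calc _ ≤ _ := measure_union_le _ _
      _ < δ / 2 + δ / 2 := ENNReal.add_lt_add hUd hKd
      _ = δ := ENNReal.add_halves δ
  · intro x hx hxB
    by_cases hxA : x ∈ A0
    · have : x ∈ K := by
        by_contra hn; exact hxB (Or.inr ⟨⟨hxA, hx⟩, hn⟩)
      rw [h1 this, indicator_of_mem hxA]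
    · have : x ∈ Uᶜ := fun hn => hxB (Or.inl ⟨hn, fun h => hxA h.1⟩)
      rw [h0 this, indicator_of_notMem hxA]; rfl

lemma Two.trace (T : Two lam mu r₀ E₀ D₀ C₁ C₂ w₁ w₂) (L : Loc lam mu (lowerHalf \ closure C₁) w₁ C₁ P r e M s pr sg)
    {δ : ENNReal} (hδ : δ ≠ 0) :
    ∃ (t0 : ℝ) (g : E2 → ℝ) (A : Set E2), 0 < t0 ∧ t0 < r / 4 ∧ ContDiff ℝ ∞ g ∧ (∀ p, 0 ≤ g p ∧ g p ≤ 1) ∧ MeasurableSet A ∧ volume A < δ ∧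
      ∀ x ∈ ball P (r / 4), 0 < s x → s x < t0 → pr x ∉ A → (Dset C₁ C₂ w₁ w₂).indicator 1 x = g (pr x) := by
  have hr := L.c.rpos
  have hδ2 : δ / 2 ≠ 0 := by simpa using hδ
  obtain ⟨t0, ht0, ht1, hv⟩ := small_proj L.c.lip.continuous L.c.prlip (haus_frontier T.r0 T.c2.1.1 T.c2.1.2.1 T.c2.2) hδ2
    (show 0 < r / 4 by positivity)
  set N := pr '' (frontier C₂ ∩ {x | 0 < s x ∧ s x < t0}) with hN
  set A0 : Set E2 := {p | sg p + (t0 / 2) • e ∈ Dset C₁ C₂ w₁ w₂} with hA0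
  have hA0m : MeasurableSet A0 := T.Dmeas.preimage (by have := L.c.sglip.continuous; fun_prop : Continuous fun p => sg p + (t0 / 2) • e).measurable
  obtain ⟨g, B, hg, hg01, hB, hgB⟩ := smooth_ind hA0m (pr P) (r / 4) hδ2
  refine ⟨t0, g, toMeasurable volume (N ∪ B), ht0, ht1, hg, hg01, measurableSet_toMeasurable _ _, ?_, ?_⟩
  · rw [measure_toMeasurable]
    calc _ ≤ _ := measure_union_le _ _
      _ < δ / 2 + δ / 2 := ENNReal.add_lt_add hv hB
      _ = δ := ENNReal.add_halves δ
  · intro x hx hs0 hst hxA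
    have hxA2 : pr x ∉ N ∪ B := fun h => hxA (subset_toMeasurable _ _ h)
    have hxp : pr x ∈ ball (pr P) (r / 4) := by
      have := L.c.prlip.dist_le_mul x P
      simp only [NNReal.coe_one, one_mul] at this
      rw [mem_ball] at hx ⊢
      linarith
    rw [hgB _ hxp fun h => hxA2 (Or.inr h)]
    set S : Set E3 := (fun τ : ℝ => sg (pr x) + τ • e) '' Ioo 0 t0 with hS
    have hSc : IsPreconnected S := isPreconnected_Ioo.image _ (by fun_prop)
    have hsy : ∀ τ, s (sg (pr x) + τ • e) = τ := fun τ => by rw [L.c.tr, L.c.ssg, zero_add]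
    have hpy : ∀ τ : ℝ, pr (sg (pr x) + τ • e) = pr x := fun τ => by rw [L.c.prtr, L.c.prsg]
    have hrec := L.c.rec' x
    have hSO : ∀ y ∈ S, y ∈ interior (Dset C₁ C₂ w₁ w₂) ∪ interior (Dset C₁ C₂ w₁ w₂)ᶜ := by
      rintro y ⟨τ, hτ, rfl⟩
      have hyb : sg (pr x) + τ • e ∈ ball P r := by
        have h1 : sg (pr x) + τ • e = x + (τ - s x) • e := by
          have : sg (pr x) = x - s x • e := eq_sub_of_add_eq hrec.symm
          rw [this]; module
        rw [h1, mem_ball, dist_eq_norm, show x + (τ - s x) • e - P = (x - P) + (τ - s x) • e by abel]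
        rw [mem_ball, dist_eq_norm] at hx
        have h2 : ‖(τ - s x) • e‖ ≤ t0 := by
          rw [norm_smul, L.c.ne, mul_one, Real.norm_eq_abs, abs_le]
          constructor <;> linarith [hτ.1, hτ.2]
        linarith [norm_add_le (x - P) ((τ - s x) • e)]
      have hyΩ := (L.iff _ hyb).2 (by rw [hsy]; exact hτ.1)
      have hyf : sg (pr x) + τ • e ∉ frontier C₂ := by
        intro hf
        refine hxA2 (Or.inl ⟨_, ⟨hf, ?_⟩, hpy τ⟩)
        change 0 < s _ ∧ s _ < t0
        rw [hsy]; exact hτ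
      rcases T.locconst hyΩ hyf with h | h
      · left; exact mem_interior_iff_mem_nhds.2 h
      · right; exact mem_interior_iff_mem_nhds.2 h
    have hxS : x ∈ S := ⟨s x, ⟨hs0, hst⟩, hrec.symm⟩
    have hmS : sg (pr x) + (t0 / 2) • e ∈ S := ⟨t0 / 2, ⟨by linarith, by linarith⟩, rfl⟩
    rcases hSc.subset_or_subset isOpen_interior isOpen_interior
      (disjoint_compl_right.mono interior_subset interior_subset) hSO with h | h
    · have hm : sg (pr x) + (t0 / 2) • e ∈ Dset C₁ C₂ w₁ w₂ := interior_subset (h hmS)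
      rw [indicator_of_mem (interior_subset (h hxS)), indicator_of_mem (show pr x ∈ A0 from hm)]; rfl
    · have hm : sg (pr x) + (t0 / 2) • e ∈ (Dset C₁ C₂ w₁ w₂)ᶜ := interior_subset (h hmS)
      rw [indicator_of_notMem (interior_subset (h hxS)), indicator_of_notMem (show pr x ∉ A0 from hm)]

end

section
open Filter Topology
open scoped ContDiff

lemma bA_young {lam mu : ℝ} (hmu : 0 < mu) (hlam : 0 < 3 * lam + 2 * mu) (S T : ME) {θ : ℝ} (hθ : 0 < θ) :
    |bA lam mu S T| ≤ θ / 2 * bA lam mu S S + 1 / (2 * θ) * bA lam mu T T := by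
  have h1 := bA_nonneg hmu hlam (θ • S - T)
  have h2 := bA_nonneg hmu hlam (θ • S + T)
  simp only [map_sub, map_add, map_smul, sub_apply, add_apply, smul_apply, smul_eq_mul] at h1 h2
  rw [bA_comm lam mu T S] at h1 h2
  have h3 : θ / 2 * bA lam mu S S + 1 / (2 * θ) * bA lam mu T T =
    (θ * (θ * bA lam mu S S) + bA lam mu T T) / (2 * θ) := by field_simp
  rw [h3, le_div_iff₀ (by positivity)]
  rcases abs_cases (bA lam mu S T) with ⟨h, -⟩ | ⟨h, -⟩ <;> rw [h] <;> linarith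

variable {lam mu r₀ E₀ D₀ : ℝ} {C₁ C₂ : Set E3} {w₁ w₂ : E3 → E3}
  {P : E3} {r : ℝ} {e : E3} {M : NNReal} {s : E3 → ℝ} {pr : E3 → E2} {sg : E2 → E3}

lemma Two.LD_add (T : Two lam mu r₀ E₀ D₀ C₁ C₂ w₁ w₂) {f g : E3 → E3} (hf : ContDiff ℝ ∞ f) (hfc : HasCompactSupport f)
    (hg : ContDiff ℝ ∞ g) (hgc : HasCompactSupport g) :
    LD lam mu C₁ C₂ w₁ w₂ (f + g) = LD lam mu C₁ C₂ w₁ w₂ f + LD lam mu C₁ C₂ w₁ w₂ g := by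
  unfold LD
  rw [← integral_add (T.s1.int_test Dsub T.Dmeas (hf.of_le (by norm_cast)) hfc)
    (T.s1.int_test Dsub T.Dmeas (hg.of_le (by norm_cast)) hgc)]
  refine integral_congr_ae (Eventually.of_forall fun x => ?_)
  simp only
  rw [fderiv_add (hf.differentiable (by simp) x) (hg.differentiable (by simp) x), map_add]

lemma LD_zero : LD lam mu C₁ C₂ w₁ w₂ 0 = 0 := by
  unfold LD
  refine setIntegral_eq_zero_of_forall_eq_zero fun x hx => ?_
  simp

lemma Two.LD_Ω (T : Two lam mu r₀ E₀ D₀ C₁ C₂ w₁ w₂) {v : E3 → E3} (hv : ContDiff ℝ ∞ v) (hc : HasCompactSupport v)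
    (hs : tsupport v ⊆ lowerHalf \ closure C₁) : LD lam mu C₁ C₂ w₁ w₂ v = 0 :=
  loc_glob (LD lam mu C₁ C₂ w₁ w₂) LD_zero (fun _ _ a b c d => T.LD_add a b c d) (fun _ hP => T.stepA hP) hv hc hs

/-- density of the main term -/
def hden (lam mu : ℝ) (D : Set E3) (w : E3 → E3) (g : E3 → ℝ) (v : E3 → E3) (x : E3) : ℝ :=
  D.indicator 1 x * bA lam mu (fderiv ℝ w x) (fderiv ℝ v x) -
    bA lam mu (fderiv ℝ w x) (fderiv ℝ (fun y => g y • v y) x)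

def eden (lam mu : ℝ) (D : Set E3) (w : E3 → E3) (g η : E3 → ℝ) (v : E3 → E3) (x : E3) : ℝ :=
  (D.indicator 1 x - g x) * bA lam mu (fderiv ℝ w x) ((fderiv ℝ η x).smulRight (v x))

lemma Two.hden_int (T : Two lam mu r₀ E₀ D₀ C₁ C₂ w₁ w₂) {v : E3 → E3} (hv : ContDiff ℝ ∞ v) (hc : HasCompactSupport v)
    {g : E3 → ℝ} (hg : ContDiff ℝ ∞ g) :
    IntegrableOn (hden lam mu (Dset C₁ C₂ w₁ w₂) w₁ g v) (lowerHalf \ closure C₁) := by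
  have hgv : HasCompactSupport (fun y => g y • v y) := hc.smul_left (f := g)
  refine Integrable.sub (f := fun x => (Dset C₁ C₂ w₁ w₂).indicator 1 x * bA lam mu (fderiv ℝ w₁ x) (fderiv ℝ v x)) ?_
    (T.s1.int_test subset_rfl T.s1.op.measurableSet ((hg.smul hv).of_le (by norm_cast)) hgv)
  have h1 := (T.s1.int_test subset_rfl T.s1.op.measurableSet (hv.of_le (by norm_cast)) hc).indicator T.Dmeas
  refine h1.congr (Eventually.of_forall fun x => ?_)
  by_cases hx : x ∈ Dset C₁ C₂ w₁ w₂ <;> simp [hx]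

lemma Two.split (T : Two lam mu r₀ E₀ D₀ C₁ C₂ w₁ w₂) (L : Loc lam mu (lowerHalf \ closure C₁) w₁ C₁ P r e M s pr sg)
    {v : E3 → E3} (hv : ContDiff ℝ ∞ v) (hc : HasCompactSupport v) (hs : tsupport v ⊆ ball P (r / 4))
    {g η : E3 → ℝ} (hg : ContDiff ℝ ∞ g) (hη : ContDiff ℝ ∞ η) {ε : ℝ} (hε : 0 < ε) (hη0 : ∀ x, s x ≤ ε / 4 → η x = 0)
    (hη1 : ∀ x, 0 ≤ η x ∧ η x ≤ 1) :
    IntegrableOn (eden lam mu (Dset C₁ C₂ w₁ w₂) w₁ g η v) (lowerHalf \ closure C₁) ∧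
    LD lam mu C₁ C₂ w₁ w₂ v = (∫ x in lowerHalf \ closure C₁, (1 - η x) * hden lam mu (Dset C₁ C₂ w₁ w₂) w₁ g v x) -
      ∫ x in lowerHalf \ closure C₁, eden lam mu (Dset C₁ C₂ w₁ w₂) w₁ g η v x := by
  have hr := L.c.rpos
  set Ω := lowerHalf \ closure C₁ with hΩ
  set D := Dset C₁ C₂ w₁ w₂ with hD
  have hΩm : MeasurableSet Ω := T.s1.op.measurableSet
  set u : E3 → E3 := fun x => (1 - η x) • v x with hu
  have huC : ContDiff ℝ ∞ u := (contDiff_const.sub hη).smul hv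
  have huc : HasCompactSupport u := hc.smul_left (f := fun x => 1 - η x)
  set a : E3 → E3 := fun x => η x • v x with ha
  have haC : ContDiff ℝ ∞ a := hη.smul hv
  have hac : HasCompactSupport a := hc.smul_left (f := η)
  have hsr : ball P (r / 4) ⊆ ball P r := ball_subset_ball (by linarith)
  have hsa : tsupport a ⊆ Ω := by
    intro x hx
    have h1 : x ∈ tsupport v := closure_mono (Function.support_smul_subset_right η v) hx
    have h2 : x ∈ {x | ε / 4 ≤ s x} := by
      refine closure_minimal ?_ (isClosed_le continuous_const L.c.lip.continuous) hx
      intro y hy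
      by_contra hn
      have : s y < ε / 4 := not_le.1 hn
      exact hy (by simp [ha, hη0 y this.le])
    exact (L.iff x (hsr (hs h1))).2 (lt_of_lt_of_le (by positivity) h2)
  have e1 : LD lam mu C₁ C₂ w₁ w₂ v = LD lam mu C₁ C₂ w₁ w₂ u := by
    have h1 : v = a + u := by
      ext1 x; simp only [ha, hu, Pi.add_apply]; module
    conv_lhs => rw [h1]
    rw [T.LD_add haC hac huC huc, T.LD_Ω haC hac hsa, zero_add]
  set gu : E3 → E3 := fun x => g x • u x with hgu
  have hguC : ContDiff ℝ ∞ gu := hg.smul huC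
  have hguc : HasCompactSupport gu := huc.smul_left (f := g)
  have hgus : tsupport gu ⊆ lowerHalf := by
    intro x hx
    have h1 : x ∈ tsupport u := closure_mono (Function.support_smul_subset_right g u) hx
    have h2 : x ∈ tsupport v := closure_mono (Function.support_smul_subset_right (fun x => 1 - η x) v) h1
    exact L.lh (hsr (hs h2))
  have e2 := T.s1.wk gu hguC hguc hgus
  have i2 := T.s1.int_test subset_rfl hΩm (hguC.of_le (by norm_cast)) hguc
  have i1 := (T.s1.int_test subset_rfl hΩm (huC.of_le (by norm_cast)) huc).indicator T.Dmeas
  have e3 : LD lam mu C₁ C₂ w₁ w₂ u = ∫ x in Ω, D.indicator (fun x => bA lam mu (fderiv ℝ w₁ x) (fderiv ℝ u x)) x := by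
    rw [setIntegral_indicator T.Dmeas, inter_eq_right.2 Dsub]; rfl
  have ih : IntegrableOn (fun x => (1 - η x) * hden lam mu D w₁ g v x) Ω := by
    refine Integrable.bdd_mul (c := 1) (T.hden_int hv hc hg) ?_ (Eventually.of_forall fun x => ?_)
    · exact (continuous_const.sub hη.continuous).aestronglyMeasurable
    · rw [Real.norm_eq_abs, abs_le]; constructor <;> linarith [(hη1 x).1, (hη1 x).2]
  have hpt : ∀ x, eden lam mu D w₁ g η v x = (1 - η x) * hden lam mu D w₁ g v x -
      (D.indicator (fun x => bA lam mu (fderiv ℝ w₁ x) (fderiv ℝ u x)) x - bA lam mu (fderiv ℝ w₁ x) (fderiv ℝ gu x)) := by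
    intro x
    have dv := (hv.differentiable (by simp) x).hasFDerivAt
    have dη := (hη.differentiable (by simp) x).hasFDerivAt
    have dg := (hg.differentiable (by simp) x).hasFDerivAt
    have du : HasFDerivAt u _ x := (dη.const_sub 1).smul dv
    have d1 : fderiv ℝ u x = _ := du.fderiv
    have d2 : fderiv ℝ gu x = _ := (dg.smul du).fderiv
    have d3 : fderiv ℝ (fun y => g y • v y) x = _ := (dg.smul dv).fderiv
    have d4 : D.indicator (fun x => bA lam mu (fderiv ℝ w₁ x) (fderiv ℝ u x)) x =
      D.indicator 1 x * bA lam mu (fderiv ℝ w₁ x) (fderiv ℝ u x) := by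
      by_cases hx : x ∈ D <;> simp [hx]
    have d5 : ((-fderiv ℝ η x).smulRight (v x) : ME) = - (fderiv ℝ η x).smulRight (v x) := by ext y; simp
    have d6 : ((fderiv ℝ g x).smulRight (u x) : ME) = (1 - η x) • (fderiv ℝ g x).smulRight (v x) := by
      ext y; simp [hu]; ring
    rw [d4, d1, d2]
    unfold eden hden
    rw [d3, d5, d6]
    simp only [map_add, map_smul, map_neg, smul_eq_mul]
    ring
  have i3 : IntegrableOn (fun x => D.indicator (fun x => bA lam mu (fderiv ℝ w₁ x) (fderiv ℝ u x)) x - bA lam mu (fderiv ℝ w₁ x) (fderiv ℝ gu x)) Ω :=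
    Integrable.sub i1 i2
  have ie : IntegrableOn (eden lam mu D w₁ g η v) Ω :=
    (Integrable.sub ih i3).congr (Eventually.of_forall fun x => (hpt x).symm)
  refine ⟨ie, ?_⟩
  rw [e1, e3]
  have e4 := integral_sub ih i3
  rw [integral_sub i1 i2, e2, sub_zero] at e4
  rw [show (fun x => eden lam mu D w₁ g η v x) = _ from funext hpt, e4]
  ring

end

section
open Filter Topology
open scoped ContDiff

variable {lam mu r₀ E₀ D₀ : ℝ} {C₁ C₂ : Set E3} {w₁ w₂ : E3 → E3}
  {P : E3} {r : ℝ} {e : E3} {M : NNReal} {s : E3 → ℝ} {pr : E3 → E2} {sg : E2 → E3}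

lemma Two.bd1 (T : Two lam mu r₀ E₀ D₀ C₁ C₂ w₁ w₂) (L : Loc lam mu (lowerHalf \ closure C₁) w₁ C₁ P r e M s pr sg)
    {v : E3 → E3} (hv : ContDiff ℝ ∞ v) (hc : HasCompactSupport v) (hs : tsupport v ⊆ ball P (r / 4))
    {g η : E3 → ℝ} (hg : ContDiff ℝ ∞ g) {ε : ℝ} (hηε : ∀ x, ε ≤ s x → η x = 1)
    (hη1 : ∀ x, 0 ≤ η x ∧ η x ≤ 1) :
    |∫ x in lowerHalf \ closure C₁, (1 - η x) * hden lam mu (Dset C₁ C₂ w₁ w₂) w₁ g v x| ≤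
      ∫ x in (lowerHalf \ closure C₁) ∩ (ball P r ∩ {x | s x < ε}), |hden lam mu (Dset C₁ C₂ w₁ w₂) w₁ g v x| := by
  have hr := L.c.rpos
  have hm : MeasurableSet (ball P r ∩ {x | s x < ε}) :=
    measurableSet_ball.inter (measurableSet_lt L.c.lip.continuous.measurable measurable_const)
  have hi := (T.hden_int hv hc hg).abs
  rw [← setIntegral_indicator hm, ← Real.norm_eq_abs]
  refine norm_integral_le_of_norm_le (hi.indicator hm) (Eventually.of_forall fun x => ?_)
  rw [Real.norm_eq_abs, abs_mul, abs_of_nonneg (by linarith [(hη1 x).2] : 0 ≤ 1 - η x)]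
  by_cases hx : x ∈ ball P r ∩ {x | s x < ε}
  · rw [indicator_of_mem hx]
    exact mul_le_of_le_one_left (abs_nonneg _) (by linarith [(hη1 x).1])
  · rw [indicator_of_notMem hx]
    refine le_of_eq ?_
    by_cases hxv : x ∈ tsupport v
    · have h1 : ε ≤ s x := by
        by_contra hn
        exact hx ⟨ball_subset_ball (by linarith) (hs hxv), not_le.1 hn⟩
      rw [hηε x h1]; simp
    · have h2 : x ∉ tsupport (fun y => g y • v y) := fun h => hxv (closure_mono (Function.support_smul_subset_right g v) h)
      simp [hden, fd_zero hxv, fd_zero h2]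

lemma lim_strip {h : E3 → ℝ} {Ω : Set E3} (hΩ : MeasurableSet Ω) (hs : Continuous s) (hi : IntegrableOn h Ω)
    (hpos : ∀ x ∈ Ω ∩ ball P r, 0 < s x) {t0 : ℝ} (ht0 : 0 < t0) {κ : ℝ} (hκ : 0 < κ) :
    ∃ ε, 0 < ε ∧ ε < t0 ∧ ∫ x in Ω ∩ (ball P r ∩ {x | s x < ε}), |h x| < κ := by
  set F : ℕ → Set E3 := fun n => Ω ∩ (ball P r ∩ {x | s x < t0 / ((n : ℝ) + 2)}) with hF
  have hm : ∀ n, MeasurableSet (F n) := fun n =>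
    hΩ.inter (measurableSet_ball.inter (measurableSet_lt hs.measurable measurable_const))
  have hanti : Antitone F := by
    intro m n hmn x hx
    refine ⟨hx.1, hx.2.1, ?_⟩
    have h3 : s x < t0 / ((n : ℝ) + 2) := hx.2.2
    refine h3.trans_le ?_
    have : (m : ℝ) ≤ n := by exact_mod_cast hmn
    gcongr
  have hia : IntegrableOn (fun x => |h x|) Ω volume := hi.abs
  have ht := tendsto_setIntegral_of_antitone hm hanti ⟨0, hia.mono_set inter_subset_left⟩
  have hempty : ⋂ n, F n = ∅ := by
    refine eq_empty_iff_forall_notMem.2 fun x hx => ?_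
    rw [mem_iInter] at hx
    have h0 : 0 < s x := hpos x ⟨(hx 0).1, (hx 0).2.1⟩
    obtain ⟨n, hn⟩ := exists_nat_gt (t0 / s x)
    have h2 : s x < t0 / ((n : ℝ) + 2) := (hx n).2.2
    rw [lt_div_iff₀ (by positivity)] at h2
    rw [div_lt_iff₀ h0] at hn
    nlinarith
  rw [hempty, setIntegral_empty] at ht
  obtain ⟨n, hn⟩ := (ht.eventually_lt_const hκ).exists
  refine ⟨t0 / ((n : ℝ) + 2), by positivity, ?_, hn⟩
  rw [div_lt_iff₀ (by positivity)]
  have : (0 : ℝ) ≤ n := n.cast_nonneg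
  nlinarith

lemma Two.bd2 (T : Two lam mu r₀ E₀ D₀ C₁ C₂ w₁ w₂) (L : Loc lam mu (lowerHalf \ closure C₁) w₁ C₁ P r e M s pr sg)
    {v : E3 → E3} (hs : tsupport v ⊆ ball P (r / 4))
    {g : E2 → ℝ} {η : E3 → ℝ} {ε : ℝ} (hε : 0 < ε) (hηε : ∀ x, ε ≤ s x → η x = 1)
    (hη1 : ∀ x, 0 ≤ η x ∧ η x ≤ 1) (hηd : ∀ x, ‖fderiv ℝ η x‖ ≤ 4 * M / ε)
    {t0 σ : ℝ} (hεt : ε < t0) (htr : t0 < r / 4) {A : Set E2} (hA : MeasurableSet A) (hσ : 0 < σ)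
    (hAv : volume A ≤ ENNReal.ofReal (σ ^ 2)) (hg : ∀ p, 0 ≤ g p ∧ g p ≤ 1)
    (htrace : ∀ x ∈ ball P (r / 4), 0 < s x → s x < t0 → pr x ∉ A → (Dset C₁ C₂ w₁ w₂).indicator 1 x = g (pr x))
    {K Kv Kb : ℝ} (hKv : ∀ x, ‖v x‖ ≤ Kv) (hKb : 0 < Kb) (hbA : ∀ S T, |bA lam mu S T| ≤ Kb * ‖S‖ * ‖T‖)
    (hK : ∀ t, 0 < t → t < r / 2 →
      ∫ x in ball P (r / 4) ∩ {x | 0 < s x ∧ s x ≤ t}, qf lam mu ((lowerHalf \ closure C₁) ∩ ball P r) w₁ x ≤ K * t) :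
    |∫ x in lowerHalf \ closure C₁, eden lam mu (Dset C₁ C₂ w₁ w₂) w₁ (fun x => g (pr x)) η v x| ≤
      σ / 2 * (K + Kb * (4 * M * Kv) ^ 2) := by
  have hr := L.c.rpos
  have hsm := L.c.lip.continuous.measurable
  have hKv0 : 0 ≤ Kv := (norm_nonneg _).trans (hKv 0)
  set Ω := lowerHalf \ closure C₁ with hΩ
  set D := Dset C₁ C₂ w₁ w₂ with hD
  set q := qf lam mu (Ω ∩ ball P r) w₁ with hq
  have hqi : Integrable q := T.s1.qf_int P r
  have hq0 : ∀ x, 0 ≤ q x := L.qf_nonneg _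
  set Z : Set E3 := ball P (r / 4) ∩ {x | pr x ∈ A ∧ 0 < s x ∧ s x < ε} with hZ
  have hZm : MeasurableSet Z := measurableSet_ball.inter ((hA.preimage L.c.prlip.continuous.measurable).inter
    ((measurableSet_lt measurable_const hsm).inter (measurableSet_lt hsm measurable_const)))
  have hZv : volume Z ≤ ENNReal.ofReal (ε * σ ^ 2) := by
    refine (measure_mono inter_subset_right).trans ?_
    rw [L.c.vol A hA ε, ENNReal.ofReal_mul hε.le]
    exact mul_le_mul_right hAv _
  have hZfin : volume Z < ⊤ := hZv.trans_lt ENNReal.ofReal_lt_top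
  have hZr : volume.real Z ≤ ε * σ ^ 2 := ENNReal.toReal_le_of_le_ofReal (by positivity) hZv
  have hZΩ : Z ⊆ Ω := fun x hx => (L.iff x (ball_subset_ball (by linarith) hx.1)).2 hx.2.2.1
  set c := Kb * (4 * M * Kv / ε) ^ 2 with hcdef
  set θ := σ / ε with hθ
  have hθ0 : 0 < θ := by positivity
  set F : E3 → ℝ := fun x => θ / 2 * q x + 1 / (2 * θ) * c with hF
  have hFi : IntegrableOn F Z :=
    (hqi.integrableOn.const_mul _).add (integrableOn_const hZfin.ne)
  have h1 : |∫ x in Ω, eden lam mu D w₁ (fun x => g (pr x)) η v x| ≤ ∫ x in Ω, Z.indicator F x := by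
    rw [← Real.norm_eq_abs]
    refine norm_integral_le_of_norm_le (hFi.integrable_indicator hZm).integrableOn ?_
    refine (ae_restrict_iff' T.s1.op.measurableSet).2 (Eventually.of_forall fun x hxΩ => ?_)
    by_cases hx : x ∈ Z
    · rw [indicator_of_mem hx]
      unfold eden
      rw [norm_mul, Real.norm_eq_abs, Real.norm_eq_abs]
      have a1 : |D.indicator 1 x - g (pr x)| ≤ 1 := by
        have := hg (pr x)
        rw [abs_le]
        by_cases hxD : x ∈ D <;> simp only [hxD, indicator_of_mem, indicator_of_notMem, not_false_eq_true, Pi.one_apply] <;> constructor <;> linarith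
      refine (mul_le_of_le_one_left (abs_nonneg _) a1).trans ?_
      refine (bA_young L.mu0 L.lam0 _ _ hθ0).trans ?_
      have a2 : q x = bA lam mu (fderiv ℝ w₁ x) (fderiv ℝ w₁ x) := by
        rw [hq]; unfold qf
        exact indicator_of_mem (show x ∈ Ω ∩ ball P r from ⟨hxΩ, ball_subset_ball (by linarith) hx.1⟩) _
      have a3 : ‖((fderiv ℝ η x).smulRight (v x) : ME)‖ ≤ 4 * M * Kv / ε := by
        rw [ContinuousLinearMap.norm_smulRight_apply]
        calc _ ≤ (4 * M / ε) * Kv := mul_le_mul (hηd x) (hKv x) (norm_nonneg _) (by positivity)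
          _ = _ := by ring
      have a4 : bA lam mu ((fderiv ℝ η x).smulRight (v x)) ((fderiv ℝ η x).smulRight (v x)) ≤ c := by
        refine (le_abs_self _).trans ((hbA _ _).trans ?_)
        rw [hcdef, sq, ← mul_assoc]
        gcongr
      rw [← a2]
      change _ ≤ θ / 2 * q x + 1 / (2 * θ) * c
      gcongr
    · rw [indicator_of_notMem hx]
      refine le_of_eq ?_
      unfold eden
      by_cases hxv : x ∈ tsupport v
      · have hxb := hs hxv
        have hs0 := (L.iff x (ball_subset_ball (by linarith) hxb)).1 hxΩ
        by_cases hxs : s x < ε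
        · have hpA : pr x ∉ A := fun h => hx ⟨hxb, h, hs0, hxs⟩
          rw [htrace x hxb hs0 (hxs.trans hεt) hpA]; simp
        · have h3 : IsLocalMax η x := Eventually.of_forall fun y => by
            rw [hηε x (not_lt.1 hxs)]; exact (hη1 y).2
          rw [h3.fderiv_eq_zero]
          simp
      · rw [image_eq_zero_of_notMem_tsupport hxv]; simp
  refine h1.trans ?_
  rw [setIntegral_indicator hZm, inter_eq_right.2 hZΩ]
  have h2 : ∫ x in Z, F x = θ / 2 * (∫ x in Z, q x) + volume.real Z * (1 / (2 * θ) * c) := by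
    rw [hF, integral_add (hqi.integrableOn.const_mul _) (integrableOn_const hZfin.ne), integral_const_mul,
      setIntegral_const, smul_eq_mul]
  have h3 : ∫ x in Z, q x ≤ K * ε := by
    refine le_trans ?_ (hK ε hε (by linarith))
    refine setIntegral_mono_set hqi.integrableOn (Eventually.of_forall hq0) (LE.le.eventuallyLE ?_)
    intro x hx
    exact ⟨hx.1, hx.2.2.1, hx.2.2.2.le⟩
  rw [h2]
  have hc0 : 0 ≤ c := by positivity
  calc _ ≤ θ / 2 * (K * ε) + (ε * σ ^ 2) * (1 / (2 * θ) * c) := by gcongr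
    _ = _ := by rw [hcdef, hθ]; field_simp

lemma Two.stepB (T : Two lam mu r₀ E₀ D₀ C₁ C₂ w₁ w₂) (L : Loc lam mu (lowerHalf \ closure C₁) w₁ C₁ P r e M s pr sg)
    {v : E3 → E3} (hv : ContDiff ℝ ∞ v) (hc : HasCompactSupport v) (hs : tsupport v ⊆ ball P (r / 4)) :
    LD lam mu C₁ C₂ w₁ w₂ v = 0 := by
  have hr := L.c.rpos
  obtain ⟨K, hK0, hK⟩ := L.strip
  obtain ⟨Kv, hKv0, hKv⟩ := bdd_cs hv.continuous hc
  obtain ⟨Kb, hKb, hbA⟩ := bA_bound lam mu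
  set X := K + Kb * (4 * M * Kv) ^ 2 with hX
  have hX0 : 0 ≤ X := by positivity
  have key : ∀ σ : ℝ, 0 < σ → |LD lam mu C₁ C₂ w₁ w₂ v| ≤ σ * (1 + X) := by
    intro σ hσ
    obtain ⟨t0, g, A, ht0, htr, hg, hg1, hA, hAv, htrace⟩ := T.trace L
      (δ := ENNReal.ofReal (σ ^ 2)) (by simpa using hσ.ne')
    have hgp : ContDiff ℝ ∞ (fun x => g (pr x)) := hg.comp L.c.prsm
    obtain ⟨ε, hε, hεt, hlim⟩ := lim_strip (P := P) (r := r) T.s1.op.measurableSet L.c.lip.continuous (T.hden_int hv hc hgp)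
      (fun x hx => (L.iff x hx.2).1 hx.1) ht0 hσ
    obtain ⟨η, hη, hη1, hη0, hηε, hηd⟩ := cutoff L.c.lip hε
    have h1 := (T.split L hv hc hs hgp hη hε hη0 hη1).2
    have h2 := T.bd1 L hv hc hs hgp hηε hη1
    have h3 := T.bd2 L hs hε hηε hη1 hηd hεt htr hA hσ hAv.le hg1 htrace hKv hKb hbA hK
    rw [h1]
    refine (abs_sub _ _).trans ?_
    nlinarith
  by_contra hne
  have h1 : 0 < |LD lam mu C₁ C₂ w₁ w₂ v| := abs_pos.2 hne
  have h2 := key (|LD lam mu C₁ C₂ w₁ w₂ v| / (2 * (1 + X))) (by positivity)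
  have h3 : |LD lam mu C₁ C₂ w₁ w₂ v| / (2 * (1 + X)) * (1 + X) = |LD lam mu C₁ C₂ w₁ w₂ v| / 2 := by field_simp
  linarith

end

section
open Filter Topology
open scoped ContDiff

variable {lam mu r₀ E₀ D₀ : ℝ} {C₁ C₂ : Set E3} {w₁ w₂ : E3 → E3}

lemma Two.loc (T : Two lam mu r₀ E₀ D₀ C₁ C₂ w₁ w₂) {P : E3} (hP : P ∈ frontier C₁) :
    ∃ r e M s pr sg, Loc lam mu (lowerHalf \ closure C₁) w₁ C₁ P r e M s pr sg := by
  obtain ⟨e, M, s, pr, sg, c⟩ := exists_chart T.r0 T.c1.2 hP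
  obtain ⟨r1, hr1, hb⟩ := Metric.isOpen_iff.1 lowerHalf_open P (T.c1.1.2.2.1 (frontier_subset_closure hP))
  have hlh : ball P (min r₀ r1) ⊆ lowerHalf := (ball_subset_ball (min_le_right _ _)).trans hb
  have c' := c.mono (lt_min T.r0 hr1) (min_le_left _ _)
  refine ⟨min r₀ r1, e, M, s, pr, sg, c', T.s1, fun x hx => ?_, hlh, T.mu0, T.lam0⟩
  have h1 := c'.clC x hx
  constructor
  · exact fun h => not_le.1 fun h2 => h.2 (h1.2 h2)
  · exact fun h => ⟨hlh hx, fun h2 => absurd (h1.1 h2) (not_le.2 h)⟩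

lemma Two.Dloc (T : Two lam mu r₀ E₀ D₀ C₁ C₂ w₁ w₂) {x : E3} (hx : x ∈ Dset C₁ C₂ w₁ w₂) : x 2 ≤ -D₀ ∧ ‖x‖ ≤ 4 * D₀ := by
  constructor
  · by_contra hn
    exact hx.2 (T.big x hx.1.1 (Or.inl (not_le.1 hn)))
  · by_contra hn
    exact hx.2 (T.big x hx.1.1 (Or.inr (not_le.1 hn)))

/-- every point is in `Ω₁`, on the boundary, or has a neighbourhood missing `D`. -/
lemma Two.cases (T : Two lam mu r₀ E₀ D₀ C₁ C₂ w₁ w₂) (P : E3) : P ∈ lowerHalf \ closure C₁ ∨ P ∈ frontier C₁ ∨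
    ∃ U : Set E3, IsOpen U ∧ P ∈ U ∧ ∀ x ∈ U, x ∉ Dset C₁ C₂ w₁ w₂ := by
  by_cases h1 : P ∈ lowerHalf
  · by_cases h2 : P ∈ closure C₁
    · by_cases h3 : P ∈ C₁
      · exact Or.inr (Or.inr ⟨C₁, T.c1.1.1, h3, fun x hx hD => hD.1.2 (subset_closure hx)⟩)
      · refine Or.inr (Or.inl ?_)
        rw [T.c1.1.1.frontier_eq]; exact ⟨h2, h3⟩
    · exact Or.inl ⟨h1, h2⟩
  · refine Or.inr (Or.inr ⟨{x | -D₀ < x 2}, isOpen_lt continuous_const (by fun_prop), ?_, fun x hx hD => ?_⟩)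
    · have h3 : 0 ≤ P 2 := not_lt.1 h1
      change -D₀ < P 2
      linarith [T.D0]
    · exact absurd (T.Dloc hD).1 (not_le.2 hx)

lemma Two.LD_all (T : Two lam mu r₀ E₀ D₀ C₁ C₂ w₁ w₂) {v : E3 → E3} (hv : ContDiff ℝ ∞ v) (hc : HasCompactSupport v) :
    LD lam mu C₁ C₂ w₁ w₂ v = 0 := by
  refine loc_glob (O := univ) (LD lam mu C₁ C₂ w₁ w₂) LD_zero (fun _ _ a b c d => T.LD_add a b c d) (fun P _ => ?_) hv hc (subset_univ _)
  rcases T.cases P with h | h | ⟨U, hU, hPU, hUD⟩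
  · exact T.stepA h
  · obtain ⟨r, e, M, s, pr, sg, L⟩ := T.loc h
    exact ⟨ball P (r / 4), isOpen_ball, mem_ball_self (by linarith [L.c.rpos]), fun v hv hc hs => T.stepB L hv hc hs⟩
  · exact ⟨U, hU, hPU, fun v _ _ hs => LD_out hUD hs⟩

lemma Two.LD_C1 (T : Two lam mu r₀ E₀ D₀ C₁ C₂ w₁ w₂) {v : E3 → E3} (hv : ContDiff ℝ 1 v) (hc : HasCompactSupport v) :
    ∫ x in Dset C₁ C₂ w₁ w₂, bA lam mu (fderiv ℝ w₁ x) (fderiv ℝ v x) = 0 :=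
  ext_C1 T.s1 Dsub T.Dmeas isOpen_univ (fun _ hv hc _ => T.LD_all hv hc) hv hc (subset_univ _)

def EL (lam mu : ℝ) (C₁ C₂ : Set E3) (w₁ w₂ : E3 → E3) (χ : E3 → ℝ) : ℝ :=
  ∫ x in Dset C₁ C₂ w₁ w₂, (χ x * bA lam mu (fderiv ℝ w₁ x) (fderiv ℝ w₁ x) +
    bA lam mu (fderiv ℝ w₁ x) ((fderiv ℝ χ x).smulRight (w₁ x)))

lemma Two.EL_all (T : Two lam mu r₀ E₀ D₀ C₁ C₂ w₁ w₂) {χ : E3 → ℝ} (hχ : ContDiff ℝ ∞ χ) (hc : HasCompactSupport χ) :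
    EL lam mu C₁ C₂ w₁ w₂ χ = 0 := by
  refine loc_glob (O := univ) (EL lam mu C₁ C₂ w₁ w₂) ?_ (fun f g hf hfc hg hgc => ?_) (fun P _ => ?_) hχ hc (subset_univ _)
  · unfold EL
    refine setIntegral_eq_zero_of_forall_eq_zero fun x hx => ?_
    have : fderiv ℝ (0 : E3 → ℝ) x = 0 := by simp
    rw [this]
    simp
  · unfold EL
    obtain ⟨a1, a2⟩ := T.s1.Edens_int Dsub T.Dmeas hf hfc
    obtain ⟨b1, b2⟩ := T.s1.Edens_int Dsub T.Dmeas hg hgc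
    refine Eq.trans ?_ (integral_add (a1.add a2) (b1.add b2))
    refine integral_congr_ae (Eventually.of_forall fun x => ?_)
    have h1 : ((fderiv ℝ f x + fderiv ℝ g x).smulRight (w₁ x) : ME) =
      (fderiv ℝ f x).smulRight (w₁ x) + (fderiv ℝ g x).smulRight (w₁ x) := by ext y; simp; ring
    simp only [Pi.add_apply]
    rw [fderiv_add (hf.differentiable (by simp) x) (hg.differentiable (by simp) x), h1, map_add]
    ring
  · rcases T.cases P with h | h | ⟨U, hU, hPU, hUD⟩
    · refine ⟨_, T.s1.op, h, fun f hf hfc hfs => ?_⟩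
      have hC := c1_cut T.s1.op T.s1.c1 (hf.of_le (by norm_cast)) hfs
      have h1 := T.LD_C1 hC (hfc.smul_right (f' := w₁))
      rw [← h1]
      unfold EL
      refine setIntegral_congr_fun T.Dmeas fun x hx => ?_
      have d1 := (hf.differentiable (by simp) x).hasFDerivAt
      have d2 := ((T.s1.c1.differentiableOn (by simp)).differentiableAt (T.s1.op.mem_nhds (Dsub hx))).hasFDerivAt
      have d3 : fderiv ℝ (fun y => f y • w₁ y) x = _ := (d1.smul d2).fderiv
      simp only
      rw [d3, map_add, map_smul, smul_eq_mul]
    · obtain ⟨r, e, M, s, pr, sg, L⟩ := T.loc h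
      refine ⟨ball P (r / 2), isOpen_ball, mem_ball_self (by linarith [L.c.rpos]), fun f hf _ hfs => ?_⟩
      have h1 := L.Tlim Dsub T.Dmeas (fun v hv hc _ => T.LD_C1 hv hc) hf hfs
      rw [← h1]
      unfold EL Edens
      simp
    · refine ⟨U, hU, hPU, fun f _ _ hs => ?_⟩
      unfold EL
      refine setIntegral_eq_zero_of_forall_eq_zero fun x hx => ?_
      have hxf : x ∉ tsupport f := fun h => hUD x (hs h) hx
      rw [fd_zero1 hxf, image_eq_zero_of_notMem_tsupport hxf]; simp

lemma Two.energy (T : Two lam mu r₀ E₀ D₀ C₁ C₂ w₁ w₂) {x : E3} (hx1 : x ∈ lowerHalf \ closure C₁) (hx2 : x ∈ C₂) :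
    bA lam mu (fderiv ℝ w₁ x) (fderiv ℝ w₁ x) = 0 := by
  have hD0 := T.D0
  let χ : ContDiffBump (0 : E3) := ⟨5 * D₀, 6 * D₀, by positivity, by linarith⟩
  have h1 := T.EL_all χ.contDiff χ.hasCompactSupport
  have h2 : EL lam mu C₁ C₂ w₁ w₂ χ = ∫ x in Dset C₁ C₂ w₁ w₂, bA lam mu (fderiv ℝ w₁ x) (fderiv ℝ w₁ x) := by
    unfold EL
    refine setIntegral_congr_fun T.Dmeas fun y hy => ?_
    have hyb : y ∈ ball (0 : E3) (5 * D₀) := by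
      rw [mem_ball_zero_iff]; linarith [(T.Dloc hy).2]
    have e1 : (χ : E3 → ℝ) =ᶠ[𝓝 y] fun _ => 1 := by
      filter_upwards [isOpen_ball.mem_nhds hyb] with z hz
      exact χ.one_of_mem_closedBall (ball_subset_closedBall hz)
    have e2 : fderiv ℝ χ y = 0 := by rw [e1.fderiv_eq]; simp
    simp only
    rw [e2, e1.eq_of_nhds]
    simp
  rw [h2] at h1
  set W := (lowerHalf \ closure C₁) ∩ C₂ with hW
  have hWo : IsOpen W := T.s1.op.inter T.c2.1.1
  have hWD : W ⊆ Dset C₁ C₂ w₁ w₂ := fun y hy => ⟨hy.1, fun hg => hg.1.2.2 (subset_closure hy.2)⟩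
  have hq0 : ∀ y, 0 ≤ bA lam mu (fderiv ℝ w₁ y) (fderiv ℝ w₁ y) := fun y => bA_nonneg T.mu0 T.lam0 _
  have hi : IntegrableOn (fun y => bA lam mu (fderiv ℝ w₁ y) (fderiv ℝ w₁ y)) (Dset C₁ C₂ w₁ w₂) := by
    have h3 := (T.s1.Edens_int Dsub T.Dmeas χ.contDiff χ.hasCompactSupport).1
    refine (integrableOn_congr_fun (fun y hy => ?_) T.Dmeas).1 h3
    have hyb : y ∈ closedBall (0 : E3) (5 * D₀) := by
      rw [mem_closedBall_zero_iff]; linarith [(T.Dloc hy).2]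
    rw [χ.one_of_mem_closedBall hyb, one_mul]
  have h4 : ∫ y in W, bA lam mu (fderiv ℝ w₁ y) (fderiv ℝ w₁ y) = 0 := by
    refine le_antisymm ?_ (integral_nonneg hq0)
    rw [← h1]
    exact setIntegral_mono_set hi (Eventually.of_forall hq0) (LE.le.eventuallyLE hWD)
  have h5 := (setIntegral_eq_zero_iff_of_nonneg_ae (Eventually.of_forall hq0) (hi.mono_set hWD)).1 h4
  have hcont : ContinuousOn (fun y => bA lam mu (fderiv ℝ w₁ y) (fderiv ℝ w₁ y)) W := by
    have := T.s1.gcont.mono (inter_subset_left : W ⊆ _)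
    exact ((bA lam mu).continuous.comp_continuousOn this).clm_apply this
  exact Measure.eqOn_open_of_ae_eq (h5) hWo hcont continuousOn_const ⟨hx1, hx2⟩

end

section
open Filter Topology
open scoped ContDiff

lemma vol_inf {D₀ : ℝ} (hD : 0 < D₀) {C : Set E3} (h : IsCavity D₀ C) : volume (lowerHalf \ closure C) = ⊤ := by
  by_contra hne
  have hb := (cav_cl h).2
  set c := volume (ball (0 : E3) 1) with hc
  have hc0 : c ≠ 0 := (measure_ball_pos volume _ one_pos).ne'
  have hct : c ≠ ⊤ := measure_ball_lt_top.ne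
  have hc' : 0 < c.toReal := ENNReal.toReal_pos hc0 hct
  have key : ∀ n : ℕ, (n : ℝ) ^ 3 * c.toReal ≤ (volume (lowerHalf \ closure C)).toReal := by
    intro n
    have hn : (0 : ℝ) ≤ n := n.cast_nonneg
    set z : E3 := (-(n + 2 * D₀ + 1) : ℝ) • bv 2 with hz
    have hz2 : z 2 = -(n + 2 * D₀ + 1) := by simp [hz]
    have hsub : ball z n ⊆ lowerHalf \ closure C := by
      intro x hx
      rw [mem_ball, dist_eq_norm] at hx
      have h1 := (abs_le.1 ((coordle (x - z) 2).trans hx.le)).2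
      have h2 : x 2 ≤ -(2 * D₀ + 1) := by
        have : (x - z) 2 = x 2 - z 2 := rfl
        rw [this, hz2] at h1; linarith
      refine ⟨?_, fun hxC => ?_⟩
      · change x 2 < 0; linarith
      · have h3 := (abs_le.1 (coordle x 2)).1
        linarith [hb x hxC]
    have h1 := measure_mono (μ := volume) hsub
    rw [Measure.addHaar_ball _ _ hn] at h1
    have h2 := ENNReal.toReal_mono hne h1
    rw [ENNReal.toReal_mul, ENNReal.toReal_ofReal (by positivity)] at h2
    rw [finrank_euclideanSpace, Fintype.card_fin] at h2
    exact h2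
  obtain ⟨n, hn⟩ := exists_nat_gt ((volume (lowerHalf \ closure C)).toReal / c.toReal)
  rw [div_lt_iff₀ hc'] at hn
  have h1 := key n
  have h2 : (n : ℝ) ≤ (n : ℝ) ^ 3 := by exact_mod_cast Nat.le_self_pow (by norm_num) n
  nlinarith

variable {lam mu r₀ E₀ D₀ p : ℝ} {C₁ C₂ : Set E3} {w₁ w₂ : E3 → E3}

lemma Two.sub (T : Two lam mu r₀ E₀ D₀ C₁ C₂ w₁ w₂) (hp : 0 < p) (hw : IsNormalizedSolution lam mu p C₁ w₁) : C₂ ⊆ C₁ := by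
  refine open_sub_of_cl T.r0 T.c1.1.1 T.c1.2 T.c2.1.1 ?_
  intro z hz
  by_contra hzn
  have hzΩ : z ∈ lowerHalf \ closure C₁ := ⟨T.c2.1.2.2.1 (subset_closure hz), hzn⟩
  have hz0 : (fun x => fderiv ℝ w₁ x (bv 0) 0) =ᶠ[𝓝 z] 0 := by
    filter_upwards [(T.s1.op.inter T.c2.1.1).mem_nhds ⟨hzΩ, hz⟩] with x hx
    exact bA_zero T.mu0 T.lam0 (T.energy hx.1 hx.2)
  have hcont : ContinuousOn (fun x => fderiv ℝ w₁ x (bv 0) 0) (lowerHalf \ closure C₁) :=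
    (ent 0 0).continuous.comp_continuousOn T.s1.gcont
  have hall := uc_conn T.s1.op T.c1.1.2.2.2.1.isPreconnected hcont
    (fun φ hφ hc hs => T.s1.biharm_jac T.mu0 T.lam0 φ hφ hc hs) hzΩ hz0
  obtain ⟨-, -, -, hg, -⟩ := hw
  set c := p / (3 * lam + 2 * mu) with hc
  have hc0 : 0 < c := div_pos hp T.lam0
  have hle : ∀ x ∈ lowerHalf \ closure C₁, c ^ 2 ≤ frob2 (fun i j => jac w₁ x i j + c * (if i = j then 1 else 0)) := by
    intro x hx
    have h1 : jac w₁ x 0 0 = 0 := (hall x hx).eq_of_nhds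
    unfold frob2
    refine le_trans (le_of_eq ?_) (Finset.single_le_sum (f := fun i => ∑ j, (jac w₁ x i j + c * (if i = j then 1 else 0)) ^ 2)
      (fun i _ => Finset.sum_nonneg fun j _ => sq_nonneg _) (Finset.mem_univ 0) |> le_trans
      (Finset.single_le_sum (f := fun j => (jac w₁ x 0 j + c * (if 0 = j then 1 else 0)) ^ 2) (fun j _ => sq_nonneg _) (Finset.mem_univ 0)))
    rw [h1]; simp
  have hi : IntegrableOn (fun _ : E3 => c ^ 2) (lowerHalf \ closure C₁) := by
    refine Integrable.mono' hg aestronglyMeasurable_const ?_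
    refine (ae_restrict_iff' T.s1.op.measurableSet).2 (Eventually.of_forall fun x hx => ?_)
    rw [Real.norm_of_nonneg (sq_nonneg c)]
    exact hle x hx
  rw [integrableOn_const_iff] at hi
  rcases hi with h | h
  · exact absurd h (enorm_ne_zero.2 (pow_pos hc0 2).ne')
  · rw [vol_inf T.D0 T.c1.1] at h
    exact lt_irrefl _ h

theorem main_thm (lam mu r₀ E₀ D₀ s₀ p : ℝ)
    (hmu : 0 < mu) (hlam : 0 < 3*lam + 2*mu) (hr₀ : 0 < r₀)
    (hD₀ : 1 < D₀) (hs₀ : 0 < s₀) (hs₀D : s₀ < D₀) (hp : 0 < p)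
    (C₁ C₂ : Set E3) (h₁ : IsLipschitzCavity r₀ E₀ D₀ C₁) (h₂ : IsLipschitzCavity r₀ E₀ D₀ C₂)
    (w₁ w₂ : E3 → E3)
    (hw₁ : IsNormalizedSolution lam mu p C₁ w₁) (hw₂ : IsNormalizedSolution lam mu p C₂ w₂)
    (heq : ∀ x' : E2, ‖x'‖ < s₀ → w₁ (emb2 x') = w₂ (emb2 x')) :
    C₁ = C₂ := by
  have hD : 0 < D₀ := by linarith
  have hout : ∀ C : Set E3, IsCavity D₀ C → ∀ x ∈ closure C, x ∉ ball (0 : E3) s₀ := by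
    intro C hC x hx hxb
    rw [mem_ball_zero_iff] at hxb
    linarith [(cav_cl hC).1 x hx, (abs_le.1 (coordle x 2)).1]
  have hst := strip_eq hmu hlam hs₀ hw₁ hw₂ (hout C₁ h₁.1) (hout C₂ h₂.1) heq
  have S₁ := sol_of_norm hw₁
  have S₂ := sol_of_norm hw₂
  have T₁ : Two lam mu r₀ E₀ D₀ C₁ C₂ w₁ w₂ := ⟨hmu, hlam, hr₀, hD, h₁, h₂, S₁, S₂,
    Gset_big hmu hlam hD hs₀ h₁.1 h₂.1 S₁ S₂ hst⟩
  have T₂ : Two lam mu r₀ E₀ D₀ C₂ C₁ w₂ w₁ := ⟨hmu, hlam, hr₀, hD, h₂, h₁, S₂, S₁,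
    Gset_big hmu hlam hD hs₀ h₂.1 h₁.1 S₂ S₁ fun x hx => (hst x hx).symm⟩
  exact Subset.antisymm (T₂.sub hp hw₂) (T₁.sub hp hw₁)

end

/-- Uniqueness for the inverse problem: a single pair of Cauchy data on the disk
`{x₁² + x₂² < s₀²}` of the boundary plane determines the cavity. -/
theorem inverse_problem_uniqueness (lam mu r₀ E₀ D₀ s₀ p : ℝ)
    (hmu : 0 < mu) (hlam : 0 < 3*lam + 2*mu) (hr₀ : 0 < r₀) (hE₀ : 0 < E₀)
    (hD₀ : 1 < D₀) (hs₀ : 0 < s₀) (hs₀D : s₀ < D₀) (hp : 0 < p)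
    (C₁ C₂ : Set E3) (h₁ : IsLipschitzCavity r₀ E₀ D₀ C₁) (h₂ : IsLipschitzCavity r₀ E₀ D₀ C₂)
    (w₁ w₂ : E3 → E3)
    (hw₁ : IsNormalizedSolution lam mu p C₁ w₁) (hw₂ : IsNormalizedSolution lam mu p C₂ w₂)
    (heq : ∀ x' : E2, ‖x'‖ < s₀ → w₁ (emb2 x') = w₂ (emb2 x')) :
    C₁ = C₂ := by
  exact main_thm lam mu r₀ E₀ D₀ s₀ p hmu hlam hr₀ hD₀ hs₀ hs₀D hp C₁ C₂ h₁ h₂ w₁ w₂ hw₁ hw₂ heq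

end
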